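/- arXiv:1202.6437 — 4 statements merged into one kernel-verified Lean document; each statement's English description precedes it below -/
import Mathlib

section
/- Let H be a group and ℓ : H → ℕ a length function on H such that the growth of H with respect to ℓ is at most exponential. Then there exist a group G generated by a finite set X, an injective group homomorphism ι : H → G, and a constant c > 0 such that: (a) for every h ∈ H, c·|ι(h)|_X ≤ ℓ(h) ≤ |ι(h)|_X; and (b) there exist subgroups G₁ ≤ G₂ of G, both normal in G, such that G₁ is abelian, G₁ ∩ ι(H) = {1}, the quotient G₂/G₁ belongs to the class E(H), and the quotient G/G₂ is solvable of derived length at most 3. -/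
/-- `ℓ` is a length function on the group `H`. -/
def IsLengthFunction {H : Type*} [Group H] (ℓ : H → ℕ) : Prop :=
  (∀ h : H, ℓ h = 0 ↔ h = 1) ∧ (∀ h : H, ℓ h⁻¹ = ℓ h) ∧ ∀ g h : H, ℓ (g * h) ≤ ℓ g + ℓ h

/-- The growth of `H` with respect to `ℓ` is at most exponential: there is a constant `a`
such that the ball of radius `n` is finite of cardinality at most `a ^ n`. -/
def AtMostExponentialGrowth {H : Type*} [Group H] (ℓ : H → ℕ) : Prop :=
  ∃ a : ℕ, ∀ n : ℕ, {h : H | ℓ h ≤ n}.Finite ∧ Nat.card {h : H | ℓ h ≤ n} ≤ a ^ n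

/-- The word length of `g` with respect to a generating set `X`: the least length of a word in
`X ∪ X⁻¹` representing `g`. -/
noncomputable def wordLength {G : Type*} [Group G] (X : Set G) (g : G) : ℕ :=
  sInf {n | ∃ l : List G, l.length = n ∧ (∀ x ∈ l, x ∈ X ∨ x⁻¹ ∈ X) ∧ l.prod = g}

/-- `K` belongs to the class `E(H)`: every finitely generated subgroup of `K` embeds into a
finite direct power of `H`. -/
def InClassE (H : Type*) [Group H] (K : Type*) [Group K] : Prop :=
  ∀ S : Subgroup K, S.FG → ∃ (n : ℕ) (φ : ↥S →* (Fin n → H)), Function.Injective φ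

namespace OO

theorem pais {α : Type} (g : Equiv.Perm α) (x : α) : g (g⁻¹ x) = x := g.apply_symm_apply x

theorem pias {α : Type} (g : Equiv.Perm α) (x : α) : g⁻¹ (g x) = x := g.symm_apply_apply x

def Nice {H : Type} [Group H] (M : ℕ) (w : ℤ → ℤ → H) : Prop :=
  (∀ n a : ℤ, n < -(M : ℤ) → w n a = 1) ∧ (∀ n a : ℤ, (M : ℤ) ≤ n → w n a = w M a) ∧
    (∀ n a : ℤ, (a < -(M : ℤ) ∨ (M : ℤ) < a) → w n a = 1)

theorem Nice.mono {H : Type} [Group H] {M N : ℕ} {w : ℤ → ℤ → H} (h : Nice M w) (hMN : M ≤ N) :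
    Nice N w := by
  obtain ⟨h1, h2, h3⟩ := h
  refine ⟨fun n a hn => h1 n a (by omega), fun n a hn => ?_, fun n a ha => h3 n a (by omega)⟩
  rw [h2 n a (by omega), h2 N a (by omega)]

theorem Nice.mul {H : Type} [Group H] {M N : ℕ} {w w' : ℤ → ℤ → H} (h : Nice M w)
    (h' : Nice N w') : Nice (max M N) (fun n a => w n a * w' n a) := by
  obtain ⟨h1, h2, h3⟩ := h.mono (le_max_left M N)
  obtain ⟨h1', h2', h3'⟩ := h'.mono (le_max_right M N)
  refine ⟨fun n a hn => ?_, fun n a hn => ?_, fun n a ha => ?_⟩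
  · simp only [h1 n a hn, h1' n a hn, one_mul]
  · simp only [h2 n a hn, h2' n a hn]
  · simp only [h3 n a ha, h3' n a ha, one_mul]

theorem Nice.inv {H : Type} [Group H] {M : ℕ} {w : ℤ → ℤ → H} (h : Nice M w) :
    Nice M (fun n a => (w n a)⁻¹) := by
  obtain ⟨h1, h2, h3⟩ := h
  refine ⟨fun n a hn => ?_, fun n a hn => ?_, fun n a ha => ?_⟩
  · simp only [h1 n a hn, inv_one]
  · simp only [h2 n a hn]
  · simp only [h3 n a ha, inv_one]

theorem Nice.shift {H : Type} [Group H] {M : ℕ} {w : ℤ → ℤ → H} (h : Nice M w) (x y : ℤ) :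
    Nice (M + x.natAbs + y.natAbs) (fun n a => w (n + x) (a + y)) := by
  obtain ⟨h1, h2, h3⟩ := h
  refine ⟨fun n a hn => ?_, fun n a hn => ?_, fun n a ha => ?_⟩
  · exact h1 _ _ (by omega)
  · show w (n + x) _ = w (_ + x) _
    rw [h2 (n + x) _ (by omega), h2 (_ + x) _ (by omega)]
  · exact h3 _ _ (by omega)

abbrev Om (P H : Type) : Type := P × ℤ × ℤ × H

def IsV {P H : Type} [Group H] (g : Equiv.Perm (Om P H)) : Prop :=
  ∃ (ν α : P → ℤ) (w : P → ℤ → ℤ → H), (∀ p, ∃ M, Nice M (w p)) ∧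
    ∀ p n a v, g (p, n, a, v) = (p, n + ν p, a + α p, w p n a * v)

theorem IsV.one {P H : Type} [Group H] : IsV (1 : Equiv.Perm (Om P H)) :=
  ⟨fun _ => 0, fun _ => 0, fun _ _ _ => 1, fun _ => ⟨0, by simp [Nice]⟩, by simp⟩

theorem IsV.mul {P H : Type} [Group H] {g g' : Equiv.Perm (Om P H)} (h : IsV g) (h' : IsV g') :
    IsV (g * g') := by
  obtain ⟨ν, α, w, hw, hg⟩ := h
  obtain ⟨ν', α', w', hw', hg'⟩ := h'
  refine ⟨fun p => ν' p + ν p, fun p => α' p + α p,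
    fun p n a => w p (n + ν' p) (a + α' p) * w' p n a, fun p => ?_, fun p n a v => ?_⟩
  · obtain ⟨M, hM⟩ := hw p
    obtain ⟨M', hM'⟩ := hw' p
    exact ⟨_, (hM.shift _ _).mul hM'⟩
  · simp only [Equiv.Perm.mul_apply, hg, hg', mul_assoc, add_assoc]

theorem IsV.inv {P H : Type} [Group H] {g : Equiv.Perm (Om P H)} (h : IsV g) :
    IsV g⁻¹ := by
  obtain ⟨ν, α, w, hw, hg⟩ := h
  refine ⟨fun p => - ν p, fun p => - α p,
    fun p n a => (w p (n + - ν p) (a + - α p))⁻¹, fun p => ?_, fun p n a v => ?_⟩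
  · obtain ⟨M, hM⟩ := hw p
    exact ⟨_, (hM.shift _ _).inv⟩
  · rw [Equiv.Perm.inv_eq_iff_eq, hg]
    simp

def rho (P H : Type) : Equiv.Perm P →* Equiv.Perm (Om P H) where
  toFun s := Equiv.prodCongr s (Equiv.refl _)
  map_one' := by ext x <;> rfl
  map_mul' := by intro s t; ext x <;> rfl

theorem rho_apply {P H : Type} (s : Equiv.Perm P) (p : P) (y : ℤ × ℤ × H) :
    rho P H s (p, y) = (s p, y) := rfl

theorem rho_inv_apply {P H : Type} (s : Equiv.Perm P) (p : P) (y : ℤ × ℤ × H) :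
    (rho P H s)⁻¹ (p, y) = (s⁻¹ p, y) := by
  rw [← map_inv]; rfl

theorem IsV.conj_rho {P H : Type} [Group H] {g : Equiv.Perm (Om P H)} (h : IsV g)
    (s : Equiv.Perm P) : IsV (rho P H s * g * (rho P H s)⁻¹) := by
  obtain ⟨ν, α, w, hw, hg⟩ := h
  refine ⟨fun p => ν (s⁻¹ p), fun p => α (s⁻¹ p), fun p => w (s⁻¹ p), fun p => hw _,
    fun p n a v => ?_⟩
  simp only [Equiv.Perm.mul_apply, rho_inv_apply, hg, rho_apply, pais]

def pr {P H : Type} (x : Om P H) : P × ℤ × ℤ := (x.1, x.2.1, x.2.2.1)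

def supp {P H : Type} (g : Equiv.Perm (Om P H)) : Set P := {p | ∃ y, g (p, y) ≠ (p, y)}

def IsT {P H : Type} [Group H] (g : Equiv.Perm (Om P H)) : Prop :=
  IsV g ∧ (∀ x, pr (g x) = pr x) ∧ (supp g).Finite

theorem supp_mul {P H : Type} (g g' : Equiv.Perm (Om P H)) : supp (g * g') ⊆ supp g ∪ supp g' := by
  rintro p ⟨y, hy⟩
  by_contra hc
  simp only [supp, Set.mem_union, Set.mem_ofPred_eq, not_or, not_exists, not_not] at hc
  apply hy
  rw [Equiv.Perm.mul_apply, hc.2, hc.1]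

theorem supp_inv {P H : Type} (g : Equiv.Perm (Om P H)) : supp g⁻¹ ⊆ supp g := by
  rintro p ⟨y, hy⟩
  by_contra hc
  simp only [supp, Set.mem_ofPred_eq, not_exists, not_not] at hc
  apply hy
  rw [Equiv.Perm.inv_eq_iff_eq, hc]

def TT (P H : Type) [Group H] : Subgroup (Equiv.Perm (Om P H)) where
  carrier := {g | IsT g}
  one_mem' := ⟨IsV.one, fun _ => rfl, by simp [supp]⟩
  mul_mem' := by
    rintro g g' ⟨h1, h2, h3⟩ ⟨h1', h2', h3'⟩
    exact ⟨h1.mul h1', fun x => by rw [Equiv.Perm.mul_apply, h2, h2'],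
      (h3.union h3').subset (supp_mul g g')⟩
  inv_mem' := by
    rintro g ⟨h1, h2, h3⟩
    exact ⟨h1.inv, fun x => by rw [← h2 (g⁻¹ x), pais],
      h3.subset (supp_inv g)⟩

theorem TT_conj_rho {P H : Type} [Group H] {g : Equiv.Perm (Om P H)} (h : g ∈ TT P H)
    (s : Equiv.Perm P) : rho P H s * g * (rho P H s)⁻¹ ∈ TT P H := by
  obtain ⟨h1, h2, h3⟩ := h
  refine ⟨h1.conj_rho s, ?_, ?_⟩
  · rintro ⟨p, y⟩
    rw [Equiv.Perm.mul_apply, Equiv.Perm.mul_apply, rho_inv_apply]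
    have := h2 (s⁻¹ p, y)
    rcases hq : g (s⁻¹ p, y) with ⟨q, z⟩
    rw [hq] at this
    rw [rho_apply]
    simp only [pr, Prod.mk.injEq] at this ⊢
    refine ⟨by rw [this.1, pais], this.2⟩
  · refine (h3.image s).subset ?_
    rintro p ⟨y, hy⟩
    refine ⟨s⁻¹ p, ⟨y, fun hc => hy ?_⟩, by simp⟩
    rw [Equiv.Perm.mul_apply, Equiv.Perm.mul_apply, rho_inv_apply, hc, rho_apply,
      pais]

theorem comm_mem_TT {P H : Type} [Group H] {g g' : Equiv.Perm (Om P H)} (h : IsV g) (h' : IsV g')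
    (hf : {p : P | ∃ y, (g * g') (p, y) ≠ (g' * g) (p, y)}.Finite) :
    g * g' * (g' * g)⁻¹ ∈ TT P H := by
  refine ⟨(h.mul h').mul (h'.mul h).inv, ?_, ?_⟩
  · intro x
    obtain ⟨y, rfl⟩ := (g' * g).surjective x
    rw [Equiv.Perm.mul_apply (g * g'), pias]
    obtain ⟨ν, α, w, hw, hg⟩ := h
    obtain ⟨ν', α', w', hw', hg'⟩ := h'
    obtain ⟨p, n, a, v⟩ := y
    simp only [pr, Equiv.Perm.mul_apply, hg, hg', Prod.mk.injEq, true_and]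
    constructor <;> ring
  · refine hf.subset ?_
    rintro p ⟨y, hy⟩
    have hV := (h'.mul h).inv
    obtain ⟨ν, α, w, hw, hg⟩ := hV
    obtain ⟨n, a, v⟩ := y
    refine ⟨(n + ν p, a + α p, w p n a * v), fun hc => hy ?_⟩
    · rw [Equiv.Perm.mul_apply (g * g'), hg, hc, ← hg, pais]

theorem TT_conj_V {P H : Type} [Group H] {t g : Equiv.Perm (Om P H)} (ht : t ∈ TT P H)
    (h : IsV g) : g * t * g⁻¹ ∈ TT P H := by
  have h1 : g * t * (t * g)⁻¹ ∈ TT P H := by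
    refine comm_mem_TT h ht.1 (ht.2.2.subset ?_)
    rintro p ⟨y, hy⟩
    by_contra hc
    simp only [supp, Set.mem_ofPred_eq, not_exists, not_not] at hc
    apply hy
    obtain ⟨ν, α, w, hw, hg⟩ := h
    obtain ⟨n, a, v⟩ := y
    rw [Equiv.Perm.mul_apply, hc, Equiv.Perm.mul_apply, hg, hc]
  have := (TT P H).mul_mem h1 ht
  have e : g * t * (t * g)⁻¹ * t = g * t * g⁻¹ := by group
  rwa [e] at this

/-! class E -/

def ev {P H : Type} [Group H] (g : Equiv.Perm (Om P H)) (p : P) (n a : ℤ) : H :=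
  (g (p, n, a, 1)).2.2.2

theorem TT_form {P H : Type} [Group H] {g : Equiv.Perm (Om P H)} (h : g ∈ TT P H) (p : P)
    (n a : ℤ) (v : H) : g (p, n, a, v) = (p, n, a, ev g p n a * v) := by
  obtain ⟨⟨ν, α, w, hw, hg⟩, h2, h3⟩ := h
  have := h2 (p, n, a, v)
  simp only [pr, hg, Prod.mk.injEq, true_and] at this
  simp only [ev, hg, Prod.mk.injEq, mul_one, and_true, true_and]
  exact this

theorem ev_mul {P H : Type} [Group H] {g g' : Equiv.Perm (Om P H)} (h : g ∈ TT P H)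
    (h' : g' ∈ TT P H) (p : P) (n a : ℤ) : ev (g * g') p n a = ev g p n a * ev g' p n a := by
  have : ev (g * g') p n a = (g (g' (p, n, a, 1))).2.2.2 := rfl
  rw [this, TT_form h', TT_form h]
  simp

theorem TT_eq_one {P H : Type} [Group H] {g : Equiv.Perm (Om P H)} (h : g ∈ TT P H)
    (h1 : ∀ p n a, ev g p n a = 1) : g = 1 := by
  ext1 ⟨p, n, a, v⟩
  rw [TT_form h, h1]; simp

def Bd {P H : Type} [Group H] (E : Finset P) (M : ℕ) (g : Equiv.Perm (Om P H)) : Prop :=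
  (∀ p, Nice M (ev g p)) ∧ ∀ p ∉ E, ∀ n a, ev g p n a = 1

theorem Bd.mono {P H : Type} [Group H] {E E' : Finset P} {M M' : ℕ} {g : Equiv.Perm (Om P H)}
    (h : Bd E M g) (hE : E ⊆ E') (hM : M ≤ M') : Bd E' M' g :=
  ⟨fun p => (h.1 p).mono hM, fun p hp => h.2 p (fun hc => hp (hE hc))⟩

theorem TT_Bd {P H : Type} [Group H] {g : Equiv.Perm (Om P H)} (h : g ∈ TT P H) :
    ∃ E M, Bd E M g := by
  classical
  have hform := TT_form h
  obtain ⟨⟨ν, α, w, hw, hg⟩, h2, h3⟩ := h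
  choose M hM using hw
  have hev : ev g = w := by
    funext p n a
    simp [ev, hg]
  have hout : ∀ p ∉ h3.toFinset, ∀ n a, ev g p n a = 1 := by
    intro p hp n a
    simp only [supp, Set.Finite.mem_toFinset, Set.mem_ofPred_eq, not_exists, not_not] at hp
    simp [ev, hp]
  refine ⟨h3.toFinset, h3.toFinset.sup M, ?_, hout⟩
  intro p
  by_cases hp : p ∈ h3.toFinset
  · rw [hev]
    exact (hM p).mono (Finset.le_sup hp)
  · have : ev g p = fun _ _ => 1 := by
      funext n a
      exact hout p hp n a
    rw [this]
    simp [Nice]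

theorem TT_inClassE (P H : Type) [Group H] : InClassE H ↥(TT P H) := by
  classical
  intro S hS
  obtain ⟨s, rfl⟩ := hS
  have hs : ∃ E M, ∀ g ∈ s, Bd E M (g : Equiv.Perm (Om P H)) := by
    induction s using Finset.induction_on with
    | empty => exact ⟨∅, 0, by simp⟩
    | insert g s hg ih =>
      obtain ⟨E, M, h⟩ := ih
      obtain ⟨E', M', h'⟩ := TT_Bd g.2
      refine ⟨E ∪ E', max M M', fun x hx => ?_⟩
      rcases Finset.mem_insert.1 hx with rfl | hx
      · exact h'.mono Finset.subset_union_right (le_max_right _ _)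
      · exact (h x hx).mono Finset.subset_union_left (le_max_left _ _)
  obtain ⟨E, M, hEM⟩ := hs
  have ev1 : ∀ p n a, ev (1 : Equiv.Perm (Om P H)) p n a = 1 := fun _ _ _ => rfl
  have hall : ∀ g ∈ Subgroup.closure (s : Set ↥(TT P H)), Bd E M (g : Equiv.Perm (Om P H)) := by
    intro g hg
    induction hg using Subgroup.closure_induction with
    | mem x hx => exact hEM x hx
    | one => exact ⟨fun p => by simp [Nice, ev1], fun p _ n a => ev1 p n a⟩
    | mul x y _ _ hx hy =>
      have := fun p n a => ev_mul x.2 y.2 p n a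
      refine ⟨fun p => ?_, fun p hp n a => ?_⟩
      · have e : ev ((x * y : ↥(TT P H)) : Equiv.Perm (Om P H)) p =
            fun n a => ev (x : Equiv.Perm (Om P H)) p n a * ev (y : Equiv.Perm (Om P H)) p n a := by
          funext n a; exact this p n a
        rw [e]
        simpa using (hx.1 p).mul (hy.1 p)
      · rw [Subgroup.coe_mul, this, hx.2 p hp, hy.2 p hp, one_mul]
    | inv x _ hx =>
      have key : ∀ p n a, ev ((x⁻¹ : ↥(TT P H)) : Equiv.Perm (Om P H)) p n a =
          (ev (x : Equiv.Perm (Om P H)) p n a)⁻¹ := by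
        intro p n a
        have := ev_mul (x⁻¹).2 x.2 p n a
        rw [← Subgroup.coe_mul, inv_mul_cancel, Subgroup.coe_one, ev1] at this
        exact eq_inv_of_mul_eq_one_left this.symm
      refine ⟨fun p => ?_, fun p hp n a => ?_⟩
      · have e : ev ((x⁻¹ : ↥(TT P H)) : Equiv.Perm (Om P H)) p =
            fun n a => (ev (x : Equiv.Perm (Om P H)) p n a)⁻¹ := by
          funext n a; exact key p n a
        rw [e]
        exact (hx.1 p).inv
      · rw [key, hx.2 p hp, inv_one]
  let I : Type := ↥E × ↥(Finset.Icc (-(M : ℤ)) M) × ↥(Finset.Icc (-(M : ℤ)) M)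
  let eI : Fin (Fintype.card I) ≃ I := (Fintype.equivFin I).symm
  refine ⟨Fintype.card I, ⟨⟨fun g i => ev (g : Equiv.Perm (Om P H)) (eI i).1 (eI i).2.1 (eI i).2.2,
    ?_⟩, ?_⟩, ?_⟩
  · funext i; rfl
  · intro x y
    funext i
    exact ev_mul x.1.2 y.1.2 _ _ _
  · rw [injective_iff_map_eq_one]
    intro g hg
    have hb := hall g.1 g.2
    have hz : ∀ p n a, ev (g : Equiv.Perm (Om P H)) p n a = 1 := by
      intro p n a
      by_cases hp : p ∈ E
      swap
      · exact hb.2 p hp n a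
      obtain ⟨h1, h2, h3⟩ := hb.1 p
      by_cases ha : a < -(M : ℤ) ∨ (M : ℤ) < a
      · exact h3 n a ha
      by_cases hn : n < -(M : ℤ)
      · exact h1 n a hn
      have hin : ∀ n : ℤ, -(M : ℤ) ≤ n → n ≤ M → ev (g : Equiv.Perm (Om P H)) p n a = 1 := by
        intro n hn hn'
        have := congrFun hg (eI.symm (⟨p, hp⟩, ⟨n, by simp [hn, hn']⟩, ⟨a, by
          simp only [Finset.mem_Icc]; omega⟩))
        change ev (g : Equiv.Perm (Om P H)) (eI (eI.symm _)).1 (eI (eI.symm _)).2.1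
          (eI (eI.symm _)).2.2 = 1 at this
        rw [Equiv.apply_symm_apply] at this
        exact this
      by_cases hn' : (M : ℤ) ≤ n
      · rw [h2 n a hn']
        exact hin _ (by omega) le_rfl
      · exact hin n (by omega) (by omega)
    exact Subtype.ext (Subtype.ext (TT_eq_one g.1.2 hz))

theorem InClassE.of_inj {H K K' : Type} [Group H] [Group K] [Group K'] (h : InClassE H K')
    (φ : K →* K') (hφ : Function.Injective φ) : InClassE H K := by
  intro S hS
  have hfg : (S.map φ).FG := by
    classical
    obtain ⟨s, rfl⟩ := hS
    exact ⟨s.image φ, by rw [MonoidHom.map_closure, Finset.coe_image]⟩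
  obtain ⟨n, ψ, hψ⟩ := h (S.map φ) hfg
  refine ⟨n, ψ.comp (φ.subgroupMap S), ?_⟩
  rw [MonoidHom.coe_comp]
  refine hψ.comp ?_
  intro x y hxy
  have := congrArg Subtype.val hxy
  exact Subtype.ext (hφ this)

/-! the generators -/

open Classical in
noncomputable def eps {P H : Type} [Group H] (d : P → H) (p : P) : ℤ := if d p = 1 then 0 else 1

open Classical in
noncomputable def uu {P H : Type} [Group H] (d : P → H) (p : P) (n a : ℤ) : H :=
  if a = 0 ∧ 0 < n then d p else 1

noncomputable def fP {P H : Type} [Group H] (d : P → H) : Equiv.Perm (Om P H) where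
  toFun x := (x.1, x.2.1, x.2.2.1 + eps d x.1, uu d x.1 x.2.1 x.2.2.1 * x.2.2.2)
  invFun x := (x.1, x.2.1, x.2.2.1 - eps d x.1,
    (uu d x.1 x.2.1 (x.2.2.1 - eps d x.1))⁻¹ * x.2.2.2)
  left_inv := by rintro ⟨p, n, a, v⟩; simp
  right_inv := by rintro ⟨p, n, a, v⟩; simp

open Classical in
noncomputable def del {P : Type} (p0 p : P) : ℤ := if p = p0 then 1 else 0

noncomputable def tP {P : Type} (H : Type) (p0 : P) : Equiv.Perm (Om P H) where
  toFun x := (x.1, x.2.1 - del p0 x.1, x.2.2.1, x.2.2.2)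
  invFun x := (x.1, x.2.1 + del p0 x.1, x.2.2.1, x.2.2.2)
  left_inv := by rintro ⟨p, n, a, v⟩; simp
  right_inv := by rintro ⟨p, n, a, v⟩; simp

theorem fP_apply {P H : Type} [Group H] (d : P → H) (p : P) (n a : ℤ) (v : H) :
    fP d (p, n, a, v) = (p, n, a + eps d p, uu d p n a * v) := rfl

theorem fP_inv_apply {P H : Type} [Group H] (d : P → H) (p : P) (n a : ℤ) (v : H) :
    (fP d)⁻¹ (p, n, a, v) = (p, n, a - eps d p, (uu d p n (a - eps d p))⁻¹ * v) := rfl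

theorem tP_apply {P H : Type} (p0 p : P) (n a : ℤ) (v : H) :
    tP H p0 (p, n, a, v) = (p, n - del p0 p, a, v) := rfl

theorem tP_inv_apply {P H : Type} (p0 p : P) (n a : ℤ) (v : H) :
    (tP H p0)⁻¹ (p, n, a, v) = (p, n + del p0 p, a, v) := rfl

theorem fP_V {P H : Type} [Group H] (d : P → H) : IsV (fP d) := by
  refine ⟨fun _ => 0, eps d, uu d, fun p => ⟨1, ?_, ?_, ?_⟩, fun p n a v => ?_⟩
  · intro n a hn
    rw [uu, if_neg]; push_cast at hn; omega
  · intro n a hn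
    push_cast at hn
    simp only [uu, Nat.cast_one]
    congr 1
    simp; intro _; omega
  · intro n a ha
    rw [uu, if_neg]; push_cast at ha; omega
  · simp [fP_apply]

theorem tP_V {P H : Type} [Group H] (p0 : P) : IsV (tP H p0) := by
  refine ⟨fun p => - del p0 p, fun _ => 0, fun _ _ _ => 1, fun p => ⟨0, by simp [Nice]⟩,
    fun p n a v => ?_⟩
  simp [tP_apply, sub_eq_add_neg]

theorem fP_fix {P H : Type} [Group H] (d : P → H) {p : P} (h : d p = 1) (y : ℤ × ℤ × H) :
    fP d (p, y) = (p, y) := by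
  obtain ⟨n, a, v⟩ := y
  simp [fP_apply, eps, uu, h]

theorem tP_fix {P H : Type} [Group H] {p0 p : P} (h : p ≠ p0) (y : ℤ × ℤ × H) :
    tP H p0 (p, y) = (p, y) := by
  obtain ⟨n, a, v⟩ := y
  simp [tP_apply, del, h]

theorem V_fst {P H : Type} [Group H] {g : Equiv.Perm (Om P H)} (h : IsV g) (p : P)
    (y : ℤ × ℤ × H) : ∃ z, g (p, y) = (p, z) := by
  obtain ⟨ν, α, w, hw, hg⟩ := h
  obtain ⟨n, a, v⟩ := y
  exact ⟨_, hg p n a v⟩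

theorem noncomm_subset {P H : Type} [Group H] {g g' : Equiv.Perm (Om P H)} (h : IsV g)
    (h' : IsV g') : {p : P | ∃ y, (g * g') (p, y) ≠ (g' * g) (p, y)} ⊆ supp g ∩ supp g' := by
  rintro p ⟨y, hy⟩
  constructor
  · by_contra hc
    simp only [supp, Set.mem_ofPred_eq, not_exists, not_not] at hc
    apply hy
    obtain ⟨z, hz⟩ := V_fst h' p y
    rw [Equiv.Perm.mul_apply, Equiv.Perm.mul_apply, hz, hc, hc, hz]
  · by_contra hc
    simp only [supp, Set.mem_ofPred_eq, not_exists, not_not] at hc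
    apply hy
    obtain ⟨z, hz⟩ := V_fst h p y
    rw [Equiv.Perm.mul_apply, Equiv.Perm.mul_apply, hz, hc, hc, hz]

theorem supp_conj {P H : Type} (g : Equiv.Perm (Om P H)) (s : Equiv.Perm P) :
    supp (rho P H s * g * (rho P H s)⁻¹) ⊆ {p | s⁻¹ p ∈ supp g} := by
  rintro p ⟨y, hy⟩
  refine ⟨y, fun hc => hy ?_⟩
  rw [Equiv.Perm.mul_apply, Equiv.Perm.mul_apply, rho_inv_apply, hc, rho_apply, pais]

theorem supp_fP {P H : Type} [Group H] (d : P → H) : supp (fP d) ⊆ {p | d p ≠ 1} := by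
  rintro p ⟨y, hy⟩ hc
  exact hy (fP_fix d hc y)

theorem supp_tP {P H : Type} [Group H] (p0 : P) : supp (tP H p0) ⊆ {p0} := by
  rintro p ⟨y, hy⟩
  by_contra hc
  exact hy (tP_fix hc y)

def gens {P H : Type} [Group H] (σ l : Equiv.Perm P) (d : P → H) (p0 : P) :
    Set (Equiv.Perm (Om P H)) := {rho P H σ, rho P H l, fP d, tP H p0}

abbrev GG {P H : Type} [Group H] (σ l : Equiv.Perm P) (d : P → H) (p0 : P) :
    Subgroup (Equiv.Perm (Om P H)) := Subgroup.closure (gens σ l d p0)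

theorem GG_normalizes {P H : Type} [Group H] (σ l : Equiv.Perm P) (d : P → H) (p0 : P)
    {g : Equiv.Perm (Om P H)} (hg : g ∈ GG σ l d p0) :
    ∀ t ∈ TT P H, g * t * g⁻¹ ∈ TT P H := by
  have hh : ∀ x ∈ gens σ l d p0, (∀ t ∈ TT P H, x * t * x⁻¹ ∈ TT P H) ∧
      (∀ t ∈ TT P H, x⁻¹ * t * x⁻¹⁻¹ ∈ TT P H) := by
    rintro x (rfl | rfl | rfl | rfl)
    · refine ⟨fun t ht => TT_conj_rho ht _, fun t ht => ?_⟩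
      rw [← map_inv]; exact TT_conj_rho ht _
    · refine ⟨fun t ht => TT_conj_rho ht _, fun t ht => ?_⟩
      rw [← map_inv]; exact TT_conj_rho ht _
    · exact ⟨fun t ht => TT_conj_V ht (fP_V d), fun t ht => TT_conj_V ht (fP_V d).inv⟩
    · exact ⟨fun t ht => TT_conj_V ht (tP_V p0), fun t ht => TT_conj_V ht (tP_V p0).inv⟩
  have : ∀ t ∈ TT P H, (g * t * g⁻¹ ∈ TT P H) ∧ (g⁻¹ * t * g⁻¹⁻¹ ∈ TT P H) := by
    induction hg using Subgroup.closure_induction with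
    | mem x hx => exact fun t ht => ⟨(hh x hx).1 t ht, (hh x hx).2 t ht⟩
    | one => intro t ht; simpa using ht
    | mul x y _ _ hx hy =>
      intro t ht
      constructor
      · have := (hx _ (hy t ht).1).1
        convert this using 1; group
      · have := (hy _ (hx t ht).2).2
        convert this using 1; group
    | inv x _ hx => intro t ht; simpa using (hx t ht).symm
  exact fun t ht => (this t ht).1

open scoped commutatorElement

theorem closure_comm_quot {G : Type} [Group G] (N : Subgroup G) [N.Normal] (T : Set G)
    (h : ∀ x ∈ T, ∀ y ∈ T, x * y * (y * x)⁻¹ ∈ N) :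
    ∀ x ∈ Subgroup.closure T, ∀ y ∈ Subgroup.closure T, ⁅x, y⁆ ∈ N := by
  have h1 : ∀ x ∈ T, ∀ y ∈ T, Commute (x : G ⧸ N) (y : G ⧸ N) := by
    intro x hx y hy
    have := h x hx y hy
    rw [← QuotientGroup.eq_one_iff] at this
    exact mul_inv_eq_one.1 this
  intro x hx y hy
  rw [← QuotientGroup.eq_one_iff]
  have : Commute (x : G ⧸ N) (y : G ⧸ N) := by
    induction hx, hy using Subgroup.closure_induction₂ with
    | mem x y hx hy => exact h1 x hx y hy
    | one_left x hx => exact Commute.one_left _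
    | one_right x hx => exact Commute.one_right _
    | mul_left x y z _ _ _ h h' => exact h.mul_left h'
    | mul_right x y z _ _ _ h h' => exact h.mul_right h'
    | inv_left x y _ _ h => exact h.inv_left
    | inv_right x y _ _ h => exact h.inv_right
  have e : ((⁅x, y⁆ : G) : G ⧸ N) = ⁅(x : G ⧸ N), (y : G ⧸ N)⁆ := rfl
  rw [e, commutatorElement_eq_one_iff_commute]
  exact this

theorem derived_bound {G S : Type} [Group G] [Group S] (θ : S →* G) (f t : G)
    (hgen : Subgroup.closure (Set.range θ ∪ {f, t}) = ⊤) (hS : derivedSeries S 2 = ⊥)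
    (N : Subgroup G) [N.Normal]
    (hff : ∀ x y : S, (θ x * f * (θ x)⁻¹) * (θ y * f * (θ y)⁻¹) *
      ((θ y * f * (θ y)⁻¹) * (θ x * f * (θ x)⁻¹))⁻¹ ∈ N)
    (hft : ∀ x y : S, (θ x * f * (θ x)⁻¹) * (θ y * t * (θ y)⁻¹) *
      ((θ y * t * (θ y)⁻¹) * (θ x * f * (θ x)⁻¹))⁻¹ ∈ N)
    (htt : ∀ x y : S, (θ x * t * (θ x)⁻¹) * (θ y * t * (θ y)⁻¹) *
      ((θ y * t * (θ y)⁻¹) * (θ x * t * (θ x)⁻¹))⁻¹ ∈ N) :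
    derivedSeries (G ⧸ N) 3 = ⊥ := by
  let T : Set G := {z | ∃ x : S, z = θ x * f * (θ x)⁻¹ ∨ z = θ x * t * (θ x)⁻¹}
  let K := Subgroup.closure T
  have hfK : f ∈ K := Subgroup.subset_closure ⟨1, by simp⟩
  have htK : t ∈ K := Subgroup.subset_closure ⟨1, by simp⟩
  have hconj : ∀ x : S, ∀ k ∈ K, θ x * k * (θ x)⁻¹ ∈ K := by
    intro x k hk
    induction hk using Subgroup.closure_induction with
    | mem z hz =>
      obtain ⟨y, rfl | rfl⟩ := hz
      · exact Subgroup.subset_closure ⟨x * y, Or.inl (by rw [map_mul]; group)⟩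
      · exact Subgroup.subset_closure ⟨x * y, Or.inr (by rw [map_mul]; group)⟩
    | one => simp
    | mul a b _ _ ha hb => convert K.mul_mem ha hb using 1; group
    | inv a _ ha => convert K.inv_mem ha using 1; group
  have hKn : K.Normal := by
    rw [← Subgroup.normalizer_eq_top_iff, eq_top_iff, ← hgen, Subgroup.closure_le]
    rintro z (⟨x, rfl⟩ | rfl | rfl)
    · rw [SetLike.mem_coe, Subgroup.mem_normalizer_iff]
      intro k
      refine ⟨hconj x k, fun hk => ?_⟩
      have := hconj x⁻¹ _ hk
      convert this using 1
      rw [map_inv]; group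
    · exact Subgroup.le_normalizer hfK
    · exact Subgroup.le_normalizer htK
  have hcomm : ∀ x ∈ K, ∀ y ∈ K, ⁅x, y⁆ ∈ N := by
    apply closure_comm_quot
    rintro _ ⟨x, rfl | rfl⟩ _ ⟨y, rfl | rfl⟩
    · exact hff x y
    · exact hft x y
    · have := N.inv_mem (hft y x)
      rwa [mul_inv_rev, inv_inv] at this
    · exact htt x y
  have hsurj : Function.Surjective ((QuotientGroup.mk' K).comp θ) := by
    rw [← MonoidHom.range_eq_top, MonoidHom.range_comp]
    rw [eq_top_iff, ← (MonoidHom.range_eq_top.2 (QuotientGroup.mk'_surjective K)),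
      MonoidHom.range_eq_map, ← hgen, MonoidHom.map_closure, Subgroup.closure_le]
    rintro _ ⟨z, ⟨x, rfl⟩ | rfl | rfl, rfl⟩
    · exact ⟨θ x, ⟨x, rfl⟩, rfl⟩
    · exact ⟨1, Subgroup.one_mem _, ((QuotientGroup.eq_one_iff _).2 hfK).symm⟩
    · exact ⟨1, Subgroup.one_mem _, ((QuotientGroup.eq_one_iff _).2 htK).symm⟩
  have h2 : derivedSeries G 2 ≤ K := by
    have e1 : derivedSeries (G ⧸ K) 2 = ⊥ := by
      rw [← map_derivedSeries_eq hsurj, hS, Subgroup.map_bot]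
    have e2 := map_derivedSeries_le_derivedSeries (QuotientGroup.mk' K) 2
    rw [e1, le_bot_iff, Subgroup.map_eq_bot_iff, QuotientGroup.ker_mk'] at e2
    exact e2
  have h3 : derivedSeries G 3 ≤ N := by
    rw [derivedSeries_succ, Subgroup.commutator_le]
    exact fun x hx y hy => hcomm x (h2 hx) y (h2 hy)
  rw [← map_derivedSeries_eq (QuotientGroup.mk'_surjective N), Subgroup.map_eq_bot_iff,
    QuotientGroup.ker_mk']
  exact h3

theorem rho_mem_GG {P H : Type} [Group H] (σ l : Equiv.Perm P) (d : P → H) (p0 : P)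
    {s : Equiv.Perm P} (hs : s ∈ Subgroup.closure ({σ, l} : Set (Equiv.Perm P))) :
    rho P H s ∈ GG σ l d p0 := by
  induction hs using Subgroup.closure_induction with
  | mem x hx =>
    apply Subgroup.subset_closure
    rcases hx with rfl | rfl <;> simp [gens]
  | one => rw [map_one]; exact Subgroup.one_mem _
  | mul x y _ _ hx hy => rw [map_mul]; exact Subgroup.mul_mem _ hx hy
  | inv x _ hx => rw [map_inv]; exact Subgroup.inv_mem _ hx

abbrev G2 {P H : Type} [Group H] (σ l : Equiv.Perm P) (d : P → H) (p0 : P) :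
    Subgroup ↥(GG σ l d p0) := (TT P H).comap (GG σ l d p0).subtype

theorem G2_normal {P H : Type} [Group H] (σ l : Equiv.Perm P) (d : P → H) (p0 : P) :
    (G2 σ l d p0).Normal :=
  ⟨fun t ht g => GG_normalizes σ l d p0 g.2 t.1 ht⟩

theorem G2_derived {P H : Type} [Group H] (σ l : Equiv.Perm P) (d : P → H) (p0 : P)
    (hS : derivedSeries ↥(Subgroup.closure ({σ, l} : Set (Equiv.Perm P))) 2 = ⊥)
    (hfin : ∀ s ∈ Subgroup.closure ({σ, l} : Set (Equiv.Perm P)), s ≠ 1 →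
      {p | d p ≠ 1 ∧ d (s p) ≠ 1}.Finite)
    [(G2 σ l d p0).Normal] :
    derivedSeries (↥(GG σ l d p0) ⧸ G2 σ l d p0) 3 = ⊥ := by
  let S0 := Subgroup.closure ({σ, l} : Set (Equiv.Perm P))
  let θ : ↥S0 →* ↥(GG σ l d p0) :=
    ((rho P H).comp S0.subtype).codRestrict (GG σ l d p0) (fun s => rho_mem_GG σ l d p0 s.2)
  let f : ↥(GG σ l d p0) := ⟨fP d, Subgroup.subset_closure (by simp [gens])⟩
  let t : ↥(GG σ l d p0) := ⟨tP H p0, Subgroup.subset_closure (by simp [gens])⟩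
  refine derived_bound θ f t ?_ hS _ ?_ ?_ ?_
  · rw [eq_top_iff, ← Subgroup.closure_closure_coe_preimage (k := gens σ l d p0)]
    refine Subgroup.closure_mono ?_
    rintro ⟨g, hg⟩ (h | h | h | h)
    · left; exact ⟨⟨σ, Subgroup.subset_closure (by simp)⟩, Subtype.ext h.symm⟩
    · left; exact ⟨⟨l, Subgroup.subset_closure (by simp)⟩, Subtype.ext h.symm⟩
    · right; left; exact Subtype.ext h
    · right; right; exact Subtype.ext h
  · intro x y
    show (rho P H x * fP d * (rho P H x)⁻¹) * (rho P H y * fP d * (rho P H y)⁻¹) *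
      ((rho P H y * fP d * (rho P H y)⁻¹) * (rho P H x * fP d * (rho P H x)⁻¹))⁻¹ ∈ TT P H
    by_cases hxy : x = y
    · subst hxy
      rw [mul_inv_cancel]; exact Subgroup.one_mem _
    have hx := (fP_V d).conj_rho (x : Equiv.Perm P)
    have hy := (fP_V d).conj_rho (y : Equiv.Perm P)
    refine comm_mem_TT hx hy (Set.Finite.subset ?_ (noncomm_subset hx hy))
    have h1 := hfin ((y⁻¹ * x : ↥S0) : Equiv.Perm P) (y⁻¹ * x).2 (by
      intro hc
      apply hxy
      have : y⁻¹ * x = 1 := Subtype.ext hc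
      exact (inv_mul_eq_one.1 this).symm)
    refine (h1.image (x : Equiv.Perm P)).subset ?_
    rintro p ⟨hp, hp'⟩
    have hp := supp_fP d (supp_conj _ _ hp)
    have hp' := supp_fP d (supp_conj _ _ hp')
    refine ⟨(x : Equiv.Perm P)⁻¹ p, ⟨hp, ?_⟩, pais _ _⟩
    simp only [Subgroup.coe_mul, Subgroup.coe_inv, Equiv.Perm.mul_apply, pais]
    exact hp'
  · intro x y
    have hx := (fP_V d).conj_rho (x : Equiv.Perm P)
    have hy := (tP_V (H := H) p0).conj_rho (y : Equiv.Perm P)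
    refine comm_mem_TT hx hy (Set.Finite.subset ?_ (noncomm_subset hx hy))
    refine (Set.finite_singleton ((y : Equiv.Perm P) p0)).subset ?_
    rintro p ⟨_, hp⟩
    have hp := supp_tP p0 (supp_conj _ _ hp)
    have hp : (y : Equiv.Perm P)⁻¹ p = p0 := hp
    rw [Set.mem_singleton_iff, ← hp, pais]
  · intro x y
    have hx := (tP_V (H := H) p0).conj_rho (x : Equiv.Perm P)
    have hy := (tP_V (H := H) p0).conj_rho (y : Equiv.Perm P)
    refine comm_mem_TT hx hy (Set.Finite.subset ?_ (noncomm_subset hx hy))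
    refine (Set.finite_singleton ((y : Equiv.Perm P) p0)).subset ?_
    rintro p ⟨_, hp⟩
    have hp := supp_tP p0 (supp_conj _ _ hp)
    have hp : (y : Equiv.Perm P)⁻¹ p = p0 := hp
    rw [Set.mem_singleton_iff, ← hp, pais]

theorem G2_inClassE {P H : Type} [Group H] (σ l : Equiv.Perm P) (d : P → H) (p0 : P)
    [((⊥ : Subgroup ↥(GG σ l d p0)).subgroupOf (G2 σ l d p0)).Normal] :
    InClassE H (↥(G2 σ l d p0) ⧸ (⊥ : Subgroup ↥(GG σ l d p0)).subgroupOf (G2 σ l d p0)) := by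
  have e : (⊥ : Subgroup ↥(GG σ l d p0)).subgroupOf (G2 σ l d p0) = ⊥ := Subgroup.bot_subgroupOf _
  let e1 := (QuotientGroup.quotientMulEquivOfEq e).trans QuotientGroup.quotientBot
  let ψ : ↥(G2 σ l d p0) →* ↥(TT P H) :=
    (((GG σ l d p0).subtype).comp (G2 σ l d p0).subtype).codRestrict (TT P H) (fun x => x.2)
  have hψ : Function.Injective ψ := by
    intro x y hxy
    have := congrArg Subtype.val hxy
    exact Subtype.ext (Subtype.ext this)
  exact InClassE.of_inj (TT_inClassE P H) (ψ.comp e1.toMonoidHom) (by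
    rw [MonoidHom.coe_comp]; exact hψ.comp e1.injective)

/-! the embedding of `H` -/

open Classical in
noncomputable def iotaFun {P H : Type} [Group H] (p0 : P) (h : H) (p : P) (n a : ℤ) : H :=
  if p = p0 ∧ n = 0 ∧ a = 0 then h else 1

theorem iotaFun_mul {P H : Type} [Group H] (p0 : P) (h h' : H) (p : P) (n a : ℤ) :
    iotaFun p0 (h * h') p n a = iotaFun p0 h p n a * iotaFun p0 h' p n a := by
  unfold iotaFun; split_ifs <;> simp

theorem iotaFun_one {P H : Type} [Group H] (p0 : P) (p : P) (n a : ℤ) :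
    iotaFun p0 (1 : H) p n a = 1 := by
  unfold iotaFun; split_ifs <;> simp

noncomputable def iota {P : Type} (H : Type) [Group H] (p0 : P) : H →* Equiv.Perm (Om P H) where
  toFun h :=
    { toFun := fun x => (x.1, x.2.1, x.2.2.1, iotaFun p0 h x.1 x.2.1 x.2.2.1 * x.2.2.2)
      invFun := fun x => (x.1, x.2.1, x.2.2.1, iotaFun p0 h⁻¹ x.1 x.2.1 x.2.2.1 * x.2.2.2)
      left_inv := by
        rintro ⟨p, n, a, v⟩
        simp [← mul_assoc, ← iotaFun_mul, iotaFun_one]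
      right_inv := by
        rintro ⟨p, n, a, v⟩
        simp [← mul_assoc, ← iotaFun_mul, iotaFun_one] }
  map_one' := by
    ext1 ⟨p, n, a, v⟩
    simp [iotaFun_one]
  map_mul' h h' := by
    ext1 ⟨p, n, a, v⟩
    simp [iotaFun_mul, mul_assoc]

theorem iota_apply {P H : Type} [Group H] (p0 : P) (h : H) (p : P) (n a : ℤ) (v : H) :
    iota H p0 h (p, n, a, v) = (p, n, a, iotaFun p0 h p n a * v) := rfl

theorem iota_eq {P H : Type} [Group H] (d : P → H) (p0 : P) (x : Equiv.Perm P) :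
    iota H p0 (d (x p0)) = ((rho P H x)⁻¹ * fP d * rho P H x)⁻¹ * tP H p0 *
      ((rho P H x)⁻¹ * fP d * rho P H x) * (tP H p0)⁻¹ := by
  have e : ((rho P H x)⁻¹ * fP d * rho P H x)⁻¹ = (rho P H x)⁻¹ * (fP d)⁻¹ * rho P H x := by group
  rw [e]
  ext1 ⟨p, n, a, v⟩
  simp only [Equiv.Perm.mul_apply, iota_apply, tP_inv_apply, tP_apply, rho_apply, rho_inv_apply,
    fP_apply, fP_inv_apply, pias]
  by_cases hp : p = p0
  · subst hp
    simp only [del, if_true, add_sub_cancel_right, Prod.mk.injEq, true_and, ← mul_assoc]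
    congr 1
    by_cases ha : a = 0
    · by_cases hn : n = 0
      · simp [iotaFun, uu, hn, ha]
      · have : (0 < n + 1) ↔ (0 < n) := by omega
        by_cases hn' : 0 < n <;> simp [iotaFun, uu, hn, ha, this, hn']
    · simp [iotaFun, uu, ha]
  · simp [del, hp, iotaFun]

/-! word length -/

def WL {G : Type} [Group G] (X : Set G) (k : ℕ) (g : G) : Prop :=
  ∃ l : List G, l.length ≤ k ∧ (∀ x ∈ l, x ∈ X ∨ x⁻¹ ∈ X) ∧ l.prod = g

theorem WL.mul {G : Type} [Group G] {X : Set G} {k k' : ℕ} {g g' : G} (h : WL X k g)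
    (h' : WL X k' g') : WL X (k + k') (g * g') := by
  obtain ⟨l, h1, h2, h3⟩ := h
  obtain ⟨l', h1', h2', h3'⟩ := h'
  refine ⟨l ++ l', by rw [List.length_append]; omega, fun x hx => ?_, by simp [h3, h3']⟩
  rcases List.mem_append.1 hx with hx | hx
  · exact h2 x hx
  · exact h2' x hx

theorem WL.inv {G : Type} [Group G] {X : Set G} {k : ℕ} {g : G} (h : WL X k g) :
    WL X k g⁻¹ := by
  obtain ⟨l, h1, h2, h3⟩ := h
  refine ⟨(l.map (·⁻¹)).reverse, by simpa using h1, fun x hx => ?_, by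
    rw [← h3, List.prod_inv_reverse]⟩
  simp only [List.mem_reverse, List.mem_map] at hx
  obtain ⟨y, hy, rfl⟩ := hx
  have := h2 y hy
  simpa using this.symm

theorem WL.of_mem {G : Type} [Group G] {X : Set G} {g : G} (h : g ∈ X) : WL X 1 g :=
  ⟨[g], by simp, by simp [h], by simp⟩

theorem WL.one {G : Type} [Group G] {X : Set G} : WL X 0 (1 : G) :=
  ⟨[], by simp, by simp, by simp⟩

theorem WL.pow {G : Type} [Group G] {X : Set G} {k : ℕ} {g : G} (h : WL X k g) (m : ℕ) :
    WL X (m * k) (g ^ m) := by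
  induction m with
  | zero => simpa using WL.one
  | succ m ih => rw [pow_succ, Nat.succ_mul]; exact ih.mul h

theorem WL.mono {G : Type} [Group G] {X : Set G} {k k' : ℕ} {g : G} (h : WL X k g)
    (hk : k ≤ k') : WL X k' g := by
  obtain ⟨l, h1, h2⟩ := h
  exact ⟨l, h1.trans hk, h2⟩

theorem WL.le {G : Type} [Group G] {X : Set G} {k : ℕ} {g : G} (h : WL X k g) :
    wordLength X g ≤ k := by
  obtain ⟨l, h1, h2⟩ := h
  have : l.length ∈ {n | ∃ l : List G, l.length = n ∧
      (∀ x ∈ l, x ∈ X ∨ x⁻¹ ∈ X) ∧ l.prod = g} := ⟨l, rfl, h2⟩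
  exact (Nat.sInf_le this).trans h1

theorem WL.exists {G : Type} [Group G] {X : Set G} {g : G}
    (hg : g ∈ Subgroup.closure X) : ∃ k, WL X k g := by
  induction hg using Subgroup.closure_induction with
  | mem x hx => exact ⟨1, WL.of_mem hx⟩
  | one => exact ⟨0, WL.one⟩
  | mul x y _ _ hx hy => obtain ⟨k, hk⟩ := hx; obtain ⟨k', hk'⟩ := hy; exact ⟨_, hk.mul hk'⟩
  | inv x _ hx => obtain ⟨k, hk⟩ := hx; exact ⟨_, hk.inv⟩

theorem WL.wordLength {G : Type} [Group G] {X : Set G} {g : G}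
    (hg : g ∈ Subgroup.closure X) : WL X (wordLength X g) g := by
  obtain ⟨k, l, h1, h2⟩ := WL.exists hg
  have : (_root_.wordLength X g) ∈ {n | ∃ l : List G, l.length = n ∧
      (∀ x ∈ l, x ∈ X ∨ x⁻¹ ∈ X) ∧ l.prod = g} := Nat.sInf_mem ⟨l.length, l, rfl, h2⟩
  obtain ⟨l, h1, h2⟩ := this
  exact ⟨l, h1.le, h2⟩

theorem WL.map {G G' : Type} [Group G] [Group G'] {X : Set G} {X' : Set G'} {k : ℕ} {g : G}
    (h : WL X k g) (φ : G →* G') (hφ : ∀ x ∈ X, φ x ∈ X') : WL X' k (φ g) := by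
  obtain ⟨l, h1, h2, h3⟩ := h
  refine ⟨l.map φ, by simpa using h1, fun x hx => ?_, by rw [← h3, map_list_prod]⟩
  obtain ⟨y, hy, rfl⟩ := List.mem_map.1 hx
  rcases h2 y hy with h | h
  · exact Or.inl (hφ y h)
  · right; rw [← map_inv]; exact hφ _ h

/-- potential argument -/
theorem WL.lipschitz {α : Type} {X : Set (Equiv.Perm α)} (Φ : α → ℤ)
    (hΦ : ∀ g ∈ X, ∀ x, |Φ (g x) - Φ x| ≤ 1) {k : ℕ} {g : Equiv.Perm α} (h : WL X k g) (x : α) :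
    |Φ (g x) - Φ x| ≤ k := by
  obtain ⟨l, h1, h2, rfl⟩ := h
  have : |Φ (l.prod x) - Φ x| ≤ l.length := by
    clear h1
    induction l with
    | nil => simp
    | cons a l ih =>
      have ih := ih (fun y hy => h2 y (List.mem_cons_of_mem _ hy))
      rw [List.prod_cons, Equiv.Perm.mul_apply, List.length_cons]
      have : |Φ (a (l.prod x)) - Φ (l.prod x)| ≤ 1 := by
        rcases h2 a List.mem_cons_self with h | h
        · exact hΦ a h _
        · have := hΦ _ h (a (l.prod x))
          rw [pias, abs_sub_comm] at this
          exact this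
      push_cast
      rw [abs_le] at *
      constructor <;> linarith [this.1, this.2, ih.1, ih.2]
  exact this.trans (by exact_mod_cast h1)

/-! the lamplighter -/

abbrev PP : Type := (ℤ → ℤ) × ℤ

def sg : Equiv.Perm PP where
  toFun p := (p.1, p.2 + 1)
  invFun p := (p.1, p.2 - 1)
  left_inv := by rintro ⟨F, k⟩; simp
  right_inv := by rintro ⟨F, k⟩; simp

def la : Equiv.Perm PP where
  toFun p := (fun i => p.1 i + if i = p.2 then 1 else 0, p.2)
  invFun p := (fun i => p.1 i - if i = p.2 then 1 else 0, p.2)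
  left_inv := by rintro ⟨F, k⟩; simp
  right_inv := by rintro ⟨F, k⟩; simp

theorem sg_apply (F : ℤ → ℤ) (k : ℤ) : sg (F, k) = (F, k + 1) := rfl

theorem la_apply (F : ℤ → ℤ) (k : ℤ) : la (F, k) = (fun i => F i + if i = k then 1 else 0, k) := rfl

theorem la_pow (m : ℕ) (F : ℤ → ℤ) (k : ℤ) :
    (la ^ m) (F, k) = (fun i => F i + if i = k then (m : ℤ) else 0, k) := by
  induction m with
  | zero => simp
  | succ m ih =>
    rw [pow_succ', Equiv.Perm.mul_apply, ih, la_apply]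
    ext i
    · simp only []
      split_ifs <;> push_cast <;> ring
    · rfl

theorem sg_pow (m : ℕ) (F : ℤ → ℤ) (k : ℤ) : (sg ^ m) (F, k) = (F, k + m) := by
  induction m with
  | zero => simp
  | succ m ih =>
    rw [pow_succ', Equiv.Perm.mul_apply, ih, sg_apply]
    push_cast; rw [add_assoc]

abbrev S0 : Subgroup (Equiv.Perm PP) := Subgroup.closure ({sg, la} : Set (Equiv.Perm PP))

theorem S0_form {s : Equiv.Perm PP} (hs : s ∈ S0) :
    ∃ (φ : ℤ → ℤ) (j : ℤ), ∀ F k, s (F, k) = (fun i => F i + φ (i - k), k + j) := by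
  induction hs using Subgroup.closure_induction with
  | mem x hx =>
    rcases hx with rfl | rfl
    · exact ⟨fun _ => 0, 1, fun F k => by simp [sg_apply]⟩
    · exact ⟨fun i => if i = 0 then 1 else 0, 0, fun F k => by simp [la_apply, sub_eq_zero]⟩
  | one => exact ⟨fun _ => 0, 0, fun F k => by simp⟩
  | mul x y _ _ hx hy =>
    obtain ⟨φ, j, h⟩ := hx
    obtain ⟨φ', j', h'⟩ := hy
    refine ⟨fun i => φ' i + φ (i - j'), j' + j, fun F k => ?_⟩
    rw [Equiv.Perm.mul_apply, h', h]
    ext i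
    · simp only [add_assoc, sub_sub]
    · simp only [add_assoc]
  | inv x _ hx =>
    obtain ⟨φ, j, h⟩ := hx
    refine ⟨fun i => - φ (i + j), -j, fun F k => ?_⟩
    rw [Equiv.Perm.inv_eq_iff_eq, h]
    ext i
    · simp only []
      rw [show i - (k + -j) = i - k + j by ring]; ring
    · simp

theorem S0_free {s : Equiv.Perm PP} (hs : s ∈ S0) (p : PP) (hp : s p = p) : s = 1 := by
  obtain ⟨φ, j, h⟩ := S0_form hs
  obtain ⟨F, k⟩ := p
  rw [h, Prod.mk.injEq] at hp
  have hj : j = 0 := by linarith [hp.2]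
  have hφ : ∀ i, φ i = 0 := by
    intro i
    have := congrFun hp.1 (i + k)
    simp only [add_sub_cancel_right] at this
    linarith
  ext1 ⟨F, k⟩
  rw [h]
  simp [hφ, hj]

theorem S0_derived : derivedSeries ↥S0 2 = ⊥ := by
  have h1 : ∀ x ∈ derivedSeries ↥S0 1, ∃ φ : ℤ → ℤ, ∀ F k,
      (x : Equiv.Perm PP) (F, k) = (fun i => F i + φ (i - k), k) := by
    intro x hx
    let Z0 : Subgroup ↥S0 :=
      { carrier := {x | ∀ p, ((x : Equiv.Perm PP) p).2 = p.2}
        one_mem' := fun p => rfl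
        mul_mem' := by
          intro x y hx hy p
          rw [Subgroup.coe_mul, Equiv.Perm.mul_apply, hx, hy]
        inv_mem' := by
          intro x hx p
          have := hx ((x : Equiv.Perm PP)⁻¹ p)
          rw [pais] at this
          exact this.symm }
    have hle : derivedSeries ↥S0 1 ≤ Z0 := by
      rw [derivedSeries_succ, Subgroup.commutator_le]
      intro x _ y _ p
      have key : ∀ p, ((x * y : Equiv.Perm PP) p).2 = ((y * x : Equiv.Perm PP) p).2 := by
        intro p
        obtain ⟨φ, j, h⟩ := S0_form x.2
        obtain ⟨φ', j', h'⟩ := S0_form y.2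
        obtain ⟨F, k⟩ := p
        simp only [Equiv.Perm.mul_apply, h, h']
        ring
      have e : ((⁅x, y⁆ : ↥S0) : Equiv.Perm PP) = (x * y : Equiv.Perm PP) * (y * x : Equiv.Perm PP)⁻¹ := by
        rw [commutatorElement_def]; simp [mul_assoc]
      rw [e, Equiv.Perm.mul_apply, key, pais]
    obtain ⟨φ, j, h⟩ := S0_form x.2
    have := hle hx (fun _ => 0, 0)
    rw [h] at this
    have hj : j = 0 := by simpa using this
    exact ⟨φ, fun F k => by rw [h, hj, add_zero]⟩
  rw [derivedSeries_succ, eq_bot_iff, Subgroup.commutator_le]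
  intro x hx y hy
  rw [Subgroup.mem_bot, commutatorElement_eq_one_iff_mul_comm]
  obtain ⟨φ, h⟩ := h1 x hx
  obtain ⟨φ', h'⟩ := h1 y hy
  apply Subtype.ext
  ext1 ⟨F, k⟩
  simp only [Subgroup.coe_mul, Equiv.Perm.mul_apply, h, h', Prod.mk.injEq, and_true]
  funext i
  ring

/-! coding -/

def Fh {H : Type} (ℓ : H → ℕ) (c : H → ℕ → ℕ) (h : H) (i : ℤ) : ℤ :=
  if 0 ≤ i ∧ i < ℓ h then (c h i.toNat : ℤ) + 1 else 0

def Ag {H : Type} (ℓ : H → ℕ) (c : H → ℕ → ℕ) (h : H) (F : ℤ → ℤ) : Prop :=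
  ∀ i : ℤ, 0 ≤ i → i ≤ ℓ h → F i = Fh ℓ c h i

def Good {H : Type} (ℓ : H → ℕ) (c : H → ℕ → ℕ) : Prop :=
  ∀ h h', ℓ h = ℓ h' → (∀ i < ℓ h, c h i = c h' i) → h = h'

theorem Ag_inj {H : Type} {ℓ : H → ℕ} {c : H → ℕ → ℕ} (hc : Good ℓ c) {h h' : H} {F : ℤ → ℤ}
    (hF : Ag ℓ c h F) (hF' : Ag ℓ c h' F) : h = h' := by
  have key : ∀ {h h' : H}, Ag ℓ c h F → Ag ℓ c h' F → ℓ h' ≤ ℓ h := by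
    intro h h' hF hF'
    by_contra hlt
    have h1 := hF (ℓ h) (by omega) le_rfl
    have h2 := hF' (ℓ h) (by omega) (by omega)
    rw [h1, Fh, Fh, if_neg (by omega), if_pos (by omega)] at h2
    omega
  have hl : ℓ h = ℓ h' := le_antisymm (key hF' hF) (key hF hF')
  refine hc h h' hl (fun i hi => ?_)
  have h1 := hF i (by omega) (by omega)
  have h2 := hF' i (by omega) (by omega)
  rw [h1, Fh, Fh, if_pos (by omega), if_pos (by omega), Int.toNat_natCast] at h2
  omega

open Classical in
noncomputable def DD {H : Type} [Group H] (ℓ : H → ℕ) (c : H → ℕ → ℕ) (F : ℤ → ℤ) : H :=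
  if hF : ∃ h, Ag ℓ c h F then hF.choose else 1

theorem DD_eq {H : Type} [Group H] {ℓ : H → ℕ} {c : H → ℕ → ℕ} (hc : Good ℓ c) {h : H}
    {F : ℤ → ℤ} (hF : Ag ℓ c h F) : DD ℓ c F = h := by
  have : ∃ h, Ag ℓ c h F := ⟨h, hF⟩
  rw [DD, dif_pos this]
  exact Ag_inj hc this.choose_spec hF

theorem DD_spec {H : Type} [Group H] {ℓ : H → ℕ} {c : H → ℕ → ℕ}
    {F : ℤ → ℤ} (hF : DD ℓ c F ≠ 1) : Ag ℓ c (DD ℓ c F) F := by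
  by_cases h : ∃ h, Ag ℓ c h F
  · rw [DD, dif_pos h]; exact h.choose_spec
  · rw [DD, dif_neg h] at hF; exact absurd rfl hF

def ph {H : Type} (ℓ : H → ℕ) (c : H → ℕ → ℕ) (h : H) : PP := (Fh ℓ c h, 2 * ℓ h)

open Classical in
noncomputable def dd {H : Type} [Group H] (ℓ : H → ℕ) (c : H → ℕ → ℕ) (p : PP) : H :=
  if p = ph ℓ c (DD ℓ c p.1) then DD ℓ c p.1 else 1

theorem DD_ph {H : Type} [Group H] {ℓ : H → ℕ} {c : H → ℕ → ℕ} (hc : Good ℓ c) (h : H) :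
    DD ℓ c (ph ℓ c h).1 = h := DD_eq hc (fun _ _ _ => rfl)

theorem dd_ph {H : Type} [Group H] {ℓ : H → ℕ} {c : H → ℕ → ℕ} (hc : Good ℓ c) (h : H) :
    dd ℓ c (ph ℓ c h) = h := by
  rw [dd, DD_ph hc, if_pos rfl]

theorem dd_spec {H : Type} [Group H] {ℓ : H → ℕ} {c : H → ℕ → ℕ} {p : PP}
    (h : dd ℓ c p ≠ 1) : p = ph ℓ c (dd ℓ c p) := by
  by_cases hp : p = ph ℓ c (DD ℓ c p.1)
  · rw [dd, if_pos hp]; exact hp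
  · rw [dd, if_neg hp] at h; exact absurd rfl h

noncomputable def rr {H : Type} [Group H] (ℓ : H → ℕ) (c : H → ℕ → ℕ) (p : PP) : ℤ :=
  max 0 (min (p.2 - ℓ (DD ℓ c p.1)) (3 * ℓ (DD ℓ c p.1) - p.2))

theorem rr_ph {H : Type} [Group H] {ℓ : H → ℕ} {c : H → ℕ → ℕ} (hc : Good ℓ c) (h : H) :
    rr ℓ c (ph ℓ c h) = ℓ h := by
  rw [rr, DD_ph hc]
  simp only [ph]
  omega

theorem step {H : Type} [Group H] {ℓ : H → ℕ} (hℓ : IsLengthFunction ℓ) {c : H → ℕ → ℕ}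
    (hc : Good ℓ c) (g : Equiv.Perm PP) (hg : g = sg ∨ g = la) (p : PP) :
    (DD ℓ c (g p).1 = DD ℓ c p.1 ∧ |rr ℓ c (g p) - rr ℓ c p| ≤ 1) ∨
      (rr ℓ c (g p) = 0 ∧ rr ℓ c p = 0) := by
  obtain ⟨F, k⟩ := p
  have l1 : ℓ 1 = 0 := (hℓ.1 1).2 rfl
  rcases hg with rfl | rfl
  · left
    rw [sg_apply]
    refine ⟨rfl, ?_⟩
    simp only [rr]
    rw [abs_le]
    omega
  · rw [la_apply]
    by_cases hD : DD ℓ c (fun i => F i + if i = k then 1 else 0) = DD ℓ c F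
    · left
      refine ⟨hD, ?_⟩
      simp only [rr, hD]
      simp
    · right
      by_contra hr
      apply hD
      by_cases h1 : rr ℓ c (F, k) = 0
      · have h2 : rr ℓ c (fun i => F i + if i = k then 1 else 0, k) ≠ 0 := fun h => hr ⟨h, h1⟩
        simp only [rr] at h2
        symm
        have hk : (ℓ (DD ℓ c (fun i => F i + if i = k then 1 else 0)) : ℤ) < k := by omega
        apply DD_eq hc
        have hne : DD ℓ c (fun i => F i + if i = k then 1 else 0) ≠ 1 := by
          intro h
          rw [h, l1] at h2
          omega
        have := DD_spec hne
        intro i hi hi'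
        rw [← this i hi hi']
        show _ = _
        simp only []
        rw [if_neg (by omega), add_zero]
      · simp only [rr] at h1
        have hk : (ℓ (DD ℓ c F) : ℤ) < k := by omega
        apply DD_eq hc
        have hne : DD ℓ c F ≠ 1 := by
          intro h
          rw [h, l1] at h1
          omega
        have := DD_spec hne
        intro i hi hi'
        rw [← this i hi hi']
        show _ = _
        simp only []
        rw [if_neg (by omega), add_zero]

theorem dd_fin {H : Type} [Group H] {ℓ : H → ℕ} (hℓ : IsLengthFunction ℓ)
    (hgr : AtMostExponentialGrowth ℓ) {c : H → ℕ → ℕ} (hc : Good ℓ c) :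
    ∀ s ∈ S0, s ≠ 1 → {p | dd ℓ c p ≠ 1 ∧ dd ℓ c (s p) ≠ 1}.Finite := by
  classical
  intro s hs hs1
  obtain ⟨k, hk⟩ := WL.exists hs
  obtain ⟨a, ha⟩ := hgr
  refine ((ha k).1.image (ph ℓ c)).subset ?_
  rintro p ⟨h1, h2⟩
  refine ⟨dd ℓ c p, ?_, (dd_spec h1).symm⟩
  by_contra hlt
  have hlt : k < ℓ (dd ℓ c p) := by simpa using hlt
  generalize hh : dd ℓ c p = h at *
  have hp := dd_spec (by rwa [hh] : dd ℓ c p ≠ 1)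
  rw [hh] at hp
  let Ψ : PP → ℤ := fun q => if DD ℓ c q.1 = h then rr ℓ c q else 0
  have hΨ : ∀ g ∈ ({sg, la} : Set (Equiv.Perm PP)), ∀ q, |Ψ (g q) - Ψ q| ≤ 1 := by
    intro g hg q
    rcases step hℓ hc g hg q with ⟨e1, e2⟩ | ⟨e1, e2⟩
    · simp only [Ψ, e1]
      split_ifs
      · exact e2
      · simp
    · simp [Ψ, e1, e2]
  have hL := hk.lipschitz Ψ hΨ p
  have e1 : Ψ p = ℓ h := by
    simp only [Ψ]
    rw [hp, DD_ph hc, if_pos rfl, rr_ph hc]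
  have e2 : Ψ (s p) ≠ 0 := by
    intro h0
    rw [h0, e1, abs_le] at hL
    omega
  have hsp := dd_spec h2
  have e3 : DD ℓ c (s p).1 = h := by
    by_contra hne
    simp only [Ψ, if_neg hne] at e2
    exact e2 rfl
  have e4 : dd ℓ c (s p) = h := by
    rw [hsp, DD_ph hc] at e3
    exact e3
  rw [e4, ← hp] at hsp
  exact hs1 (S0_free hs p hsp)

/-! potential on `Om` -/

open Classical in
noncomputable def Phi {H : Type} [Group H] (ℓ : H → ℕ) (c : H → ℕ → ℕ) (x : Om PP H) : ℤ :=
  if 0 < x.2.1 ∧ 0 < x.2.2.1 then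
    max (ℓ x.2.2.2 - rr ℓ c x.1) (min (ℓ x.2.2.2 + rr ℓ c x.1) (ℓ ((DD ℓ c x.1.1)⁻¹ * x.2.2.2)))
  else ℓ x.2.2.2

theorem Phi_zero {H : Type} [Group H] {ℓ : H → ℕ} {c : H → ℕ → ℕ} {p : PP}
    (hp : rr ℓ c p = 0) (n a : ℤ) (v : H) : Phi ℓ c (p, n, a, v) = ℓ v := by
  simp only [Phi, hp]
  split_ifs <;> omega

theorem Phi_lip {H : Type} [Group H] {ℓ : H → ℕ} (hℓ : IsLengthFunction ℓ) {c : H → ℕ → ℕ}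
    (hc : Good ℓ c) : ∀ g ∈ gens sg la (dd ℓ c) ((fun _ => 0, 0) : PP), ∀ x : Om PP H,
    |Phi ℓ c (g x) - Phi ℓ c x| ≤ 1 := by
  have hrho : ∀ g : Equiv.Perm PP, (g = sg ∨ g = la) → ∀ x : Om PP H,
      |Phi ℓ c (rho PP H g x) - Phi ℓ c x| ≤ 1 := by
    rintro g hg ⟨p, n, a, v⟩
    rw [rho_apply]
    rcases step hℓ hc g hg p with ⟨e1, e2⟩ | ⟨e1, e2⟩
    · simp only [Phi, e1]
      split_ifs
      · rw [abs_le] at *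
        omega
      · simp
    · rw [Phi_zero e1, Phi_zero e2]; simp
  rintro g (rfl | rfl | rfl | rfl) x
  · exact hrho _ (Or.inl rfl) x
  · exact hrho _ (Or.inr rfl) x
  · obtain ⟨p, n, a, v⟩ := x
    by_cases hd : dd ℓ c p = 1
    · rw [fP_fix _ hd]; simp
    have hp := dd_spec hd
    rw [fP_apply]
    have hinv : Phi ℓ c (p, n, a + eps (dd ℓ c) p, uu (dd ℓ c) p n a * v) =
        Phi ℓ c (p, n, a, v) := by
      rw [eps, if_neg hd, uu]
      generalize dd ℓ c p = h at *
      subst hp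
      have t1 : ∀ v, ℓ (h⁻¹ * v) ≤ ℓ h + ℓ v := fun v => by
        have := hℓ.2.2 h⁻¹ v
        rwa [hℓ.2.1] at this
      have t2 : ∀ v, ℓ v ≤ ℓ h + ℓ (h⁻¹ * v) := fun v => by
        have := hℓ.2.2 h (h⁻¹ * v)
        rwa [mul_inv_cancel_left] at this
      simp only [Phi, rr_ph hc, DD_ph hc]
      by_cases hn : 0 < n
      · by_cases ha : a = 0
        · subst ha
          have t1 := t1 (h * v)
          have t2 := t2 (h * v)
          simp only [hn, inv_mul_cancel_left, and_self, if_true] at *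
          simp only [zero_add, zero_lt_one, and_true, lt_irrefl, and_false, if_true, if_false]
          omega
        · have : (0 < a + 1) ↔ 0 < a := by omega
          simp [ha, this]
      · simp [hn]
    rw [hinv]; simp
  · obtain ⟨p, n, a, v⟩ := x
    by_cases hp : p = (fun _ => 0, 0)
    · have : rr ℓ c p = 0 := by
        rw [hp, rr]
        simp only []
        omega
      rw [tP_apply, Phi_zero this, Phi_zero this]; simp
    · rw [tP_fix hp]; simp

theorem reach {H : Type} [Group H] (ℓ : H → ℕ) (c : H → ℕ → ℕ) (A : ℕ) (hA : ∀ h i, c h i ≤ A)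
    (h : H) : ∃ x : Equiv.Perm PP, x ∈ S0 ∧ WL ({sg, la} : Set (Equiv.Perm PP)) (ℓ h * (A + 3)) x ∧
      x (fun _ => 0, 0) = ph ℓ c h := by
  have hsg : WL ({sg, la} : Set (Equiv.Perm PP)) 1 sg := WL.of_mem (by simp)
  have hla : WL ({sg, la} : Set (Equiv.Perm PP)) 1 la := WL.of_mem (by simp)
  have msg : sg ∈ S0 := Subgroup.subset_closure (by simp)
  have mla : la ∈ S0 := Subgroup.subset_closure (by simp)
  have key : ∀ m : ℕ, ∃ x : Equiv.Perm PP, x ∈ S0 ∧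
      WL ({sg, la} : Set (Equiv.Perm PP)) (m * (A + 2)) x ∧
      x (fun _ => 0, 0) = (fun i : ℤ => if 0 ≤ i ∧ i < m then (c h i.toNat : ℤ) + 1 else 0, (m : ℤ)) := by
    intro m
    induction m with
    | zero =>
      refine ⟨1, Subgroup.one_mem _, by simpa using WL.one, ?_⟩
      ext i
      · simp only [Equiv.Perm.one_apply]
        rw [if_neg (by push_cast; omega)]
      · rfl
    | succ m ih =>
      obtain ⟨x, hx, hW, hv⟩ := ih
      refine ⟨sg * la ^ (c h m + 1) * x, mul_mem (mul_mem msg (pow_mem mla _)) hx,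
        ((hsg.mul (hla.pow _)).mul hW).mono ?_, ?_⟩
      · have := hA h m
        rw [Nat.add_mul m 1]; omega
      · rw [Equiv.Perm.mul_apply, hv, Equiv.Perm.mul_apply, la_pow, sg_apply]
        ext i
        · simp only []
          by_cases hi : i = m
          · subst hi
            rw [if_neg (by omega), if_pos rfl, if_pos (by push_cast; omega), Int.toNat_natCast]
            push_cast; ring
          · by_cases hi' : 0 ≤ i ∧ i < m
            · rw [if_pos hi', if_neg hi, if_pos (by push_cast; omega), add_zero]
            · rw [if_neg hi', if_neg hi, if_neg (by push_cast; omega), add_zero]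
        · simp
  obtain ⟨x, hx, hW, hv⟩ := key (ℓ h)
  refine ⟨sg ^ (ℓ h) * x, mul_mem (pow_mem msg _) hx, ((hsg.pow _).mul hW).mono (by ring_nf; omega),
    ?_⟩
  rw [Equiv.Perm.mul_apply, hv, sg_pow]
  ext i
  · rfl
  · simp only [ph]; ring

theorem exists_code {H : Type} [Group H] {ℓ : H → ℕ} (hgr : AtMostExponentialGrowth ℓ) :
    ∃ (A : ℕ) (c : H → ℕ → ℕ), (∀ h i, c h i ≤ A) ∧ Good ℓ c := by
  classical
  obtain ⟨a, ha⟩ := hgr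
  have he : ∀ n, Nonempty ({h : H | ℓ h ≤ n} ↪ (Fin n → Fin a)) := by
    intro n
    have := (ha n).1.fintype
    apply Function.Embedding.nonempty_of_card_le
    rw [← Nat.card_eq_fintype_card]
    simpa using (ha n).2
  let e := fun n => (he n).some
  refine ⟨a, fun h i => if hi : i < ℓ h then (e (ℓ h) ⟨h, le_refl (ℓ h)⟩ ⟨i, hi⟩ : ℕ) else 0, ?_, ?_⟩
  · intro h i
    simp only []
    split_ifs
    · exact (Fin.is_lt _).le
    · exact Nat.zero_le _
  · intro h h' hl hcode
    have gen : ∀ n (h1 : ℓ h = n) (h2 : ℓ h' = n),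
        (∀ i (hi : i < n), (e n ⟨h, h1.le⟩ ⟨i, hi⟩ : ℕ) = e n ⟨h', h2.le⟩ ⟨i, hi⟩) → h = h' := by
      intro n h1 h2 hh
      have : e n ⟨h, h1.le⟩ = e n ⟨h', h2.le⟩ := by
        funext i
        exact Fin.ext (hh i.1 i.2)
      exact congrArg Subtype.val ((e n).injective this)
    refine gen (ℓ h) rfl hl.symm (fun i hi => ?_)
    have := hcode i hi
    simp only [dif_pos hi, dif_pos (hl ▸ hi : i < ℓ h')] at this
    rw [this]
    have gen2 : ∀ n m (h1 : ℓ h' ≤ n) (h2 : ℓ h' ≤ m) (hi1 : i < n) (hi2 : i < m), n = m →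
        (e n ⟨h', h1⟩ ⟨i, hi1⟩ : ℕ) = e m ⟨h', h2⟩ ⟨i, hi2⟩ := by
      intro n m h1 h2 hi1 hi2 hnm
      subst hnm
      rfl
    exact gen2 _ _ _ _ _ _ hl.symm

end OO

/-- **Olshanskii–Osin embedding theorem.** Every group `H` of at most exponential growth with
respect to a length function `ℓ` embeds into a finitely generated group `G` such that the word
length on the image of `H` is bi-Lipschitz equivalent to `ℓ`, and `G` has a normal series
`G₁ ⊴ G₂ ⊴ G` with `G₁` abelian meeting `H` trivially, `G₂/G₁ ∈ E(H)`, and `G/G₂` solvable of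
derived length at most `3`. -/
theorem embedding_theorem {H : Type} [Group H] (ℓ : H → ℕ)
    (hℓ : IsLengthFunction ℓ) (hgrowth : AtMostExponentialGrowth ℓ) :
    ∃ (G : Type) (instG : Group G) (X : Finset G) (ι : H →* G) (c : ℝ),
      Subgroup.closure (X : Set G) = ⊤ ∧
      Function.Injective ι ∧ 0 < c ∧
      (∀ h : H, c * (wordLength (X : Set G) (ι h) : ℝ) ≤ (ℓ h : ℝ) ∧
        ℓ h ≤ wordLength (X : Set G) (ι h)) ∧
      ∃ (G₁ G₂ : Subgroup G) (_ : G₁.Normal) (_ : G₂.Normal)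
        (_ : (G₁.subgroupOf G₂).Normal),
        G₁ ≤ G₂ ∧
        (∀ a b : ↥G₁, a * b = b * a) ∧
        (∀ g : G, g ∈ G₁ → g ∈ ι.range → g = 1) ∧
        InClassE H (↥G₂ ⧸ G₁.subgroupOf G₂) ∧
        derivedSeries (G ⧸ G₂) 3 = ⊥ := by
  classical
  obtain ⟨A, c, hA, hc⟩ := OO.exists_code hgrowth
  let p0 : OO.PP := (fun _ => 0, 0)
  let d := OO.dd ℓ c
  let G := OO.GG OO.sg OO.la d p0
  let Y := OO.gens OO.sg OO.la d p0
  have m1 : OO.rho OO.PP H OO.sg ∈ Y := by simp [Y, OO.gens]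
  have m2 : OO.rho OO.PP H OO.la ∈ Y := by simp [Y, OO.gens]
  have m3 : OO.fP d ∈ Y := by simp [Y, OO.gens]
  have m4 : OO.tP H p0 ∈ Y := by simp [Y, OO.gens]
  have hY : ∀ {y}, y ∈ Y → y ∈ G := fun hy => Subgroup.subset_closure hy
  let X : Finset ↥G := {⟨_, hY m1⟩, ⟨_, hY m2⟩, ⟨_, hY m3⟩, ⟨_, hY m4⟩}
  have hX : (X : Set ↥G) = ((↑) : ↥G → Equiv.Perm (OO.Om OO.PP H)) ⁻¹' Y := by
    ext ⟨g, hg⟩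
    simp [X, Y, OO.gens]
  have hgen : Subgroup.closure (X : Set ↥G) = ⊤ := by
    rw [hX]; exact Subgroup.closure_closure_coe_preimage
  have hword : ∀ h : H, ∃ (hm : OO.iota H p0 h ∈ G),
      OO.WL (X : Set ↥G) (4 * (ℓ h * (A + 3)) + 4) ⟨OO.iota H p0 h, hm⟩ := by
    intro h
    obtain ⟨x, hx, hW, hv⟩ := OO.reach ℓ c A hA h
    have hd : d (x p0) = h := by
      show OO.dd ℓ c (x p0) = h
      rw [hv, OO.dd_ph hc]
    have hxG : OO.rho OO.PP H x ∈ G := OO.rho_mem_GG _ _ _ _ hx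
    have hWx : OO.WL (X : Set ↥G) (ℓ h * (A + 3)) ⟨OO.rho OO.PP H x, hxG⟩ := by
      obtain ⟨l, l1, l2, l3⟩ := hW
      have hl : ∀ y ∈ l, y ∈ OO.S0 := by
        intro y hy
        rcases l2 y hy with h | h
        · exact Subgroup.subset_closure h
        · rw [← inv_inv y]; exact Subgroup.inv_mem _ (Subgroup.subset_closure h)
      have : ∀ l : List (Equiv.Perm OO.PP), (∀ y ∈ l, y ∈ ({OO.sg, OO.la} : Set _) ∨
          y⁻¹ ∈ ({OO.sg, OO.la} : Set _)) → ∀ hm : OO.rho OO.PP H l.prod ∈ G,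
          OO.WL (X : Set ↥G) l.length ⟨OO.rho OO.PP H l.prod, hm⟩ := by
        intro l
        induction l with
        | nil =>
          intro _ hm
          have e0 : (⟨OO.rho OO.PP H ([] : List (Equiv.Perm OO.PP)).prod, hm⟩ : ↥G) = 1 :=
            Subtype.ext (by simp)
          rw [e0]
          exact OO.WL.one
        | cons a l ih =>
          intro hl hm
          have hl' := hl a List.mem_cons_self
          have hlX : ∀ y ∈ ({OO.sg, OO.la} : Set (Equiv.Perm OO.PP)),
              ∃ hy : OO.rho OO.PP H y ∈ G, OO.WL (X : Set ↥G) 1 ⟨OO.rho OO.PP H y, hy⟩ := by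
            rintro y (rfl | rfl)
            · exact ⟨hY m1, OO.WL.of_mem (by rw [hX]; exact m1)⟩
            · exact ⟨hY m2, OO.WL.of_mem (by rw [hX]; exact m2)⟩
          have ha : ∃ hy : OO.rho OO.PP H a ∈ G, OO.WL (X : Set ↥G) 1 ⟨OO.rho OO.PP H a, hy⟩ := by
            rcases hl' with h | h
            · exact hlX a h
            · obtain ⟨hy, hw⟩ := hlX _ h
              have hy' : OO.rho OO.PP H a ∈ G := by
                have := G.inv_mem hy
                rwa [← map_inv, inv_inv] at this
              refine ⟨hy', ?_⟩
              convert hw.inv using 1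
              apply Subtype.ext
              simp
          obtain ⟨hy, hw⟩ := ha
          have hm' : OO.rho OO.PP H l.prod ∈ G := by
            rw [List.prod_cons, map_mul] at hm
            exact (G.mul_mem_cancel_left hy).1 hm
          have := hw.mul (ih (fun y hy => hl y (List.mem_cons_of_mem _ hy)) hm')
          rw [List.length_cons, add_comm]
          convert this using 1
          apply Subtype.ext
          simp
      subst l3
      exact (this l l2 hxG).mono l1
    have hWf : OO.WL (X : Set ↥G) 1 ⟨OO.fP d, hY m3⟩ := OO.WL.of_mem (by rw [hX]; exact m3)
    have hWt : OO.WL (X : Set ↥G) 1 ⟨OO.tP H p0, hY m4⟩ := OO.WL.of_mem (by rw [hX]; exact m4)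
    have hWc := (hWx.inv.mul hWf).mul hWx
    have hWW := ((hWc.inv.mul hWt).mul hWc).mul hWt.inv
    have e := OO.iota_eq d p0 x
    rw [hd] at e
    have hm : OO.iota H p0 h ∈ G := by
      rw [e]
      have hf := hY m3
      have ht := hY m4
      have hcc := G.mul_mem (G.mul_mem (G.inv_mem hxG) hf) hxG
      exact G.mul_mem (G.mul_mem (G.mul_mem (G.inv_mem hcc) ht) hcc) (G.inv_mem ht)
    refine ⟨hm, ?_⟩
    have hWW' := hWW.mono (k' := 4 * (ℓ h * (A + 3)) + 4) (by omega)
    convert hWW' using 1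
    exact Subtype.ext e
  let ι : H →* ↥G := (OO.iota H p0).codRestrict G (fun h => (hword h).1)
  have hev : ∀ h : H, OO.iota H p0 h (p0, 0, 0, 1) = (p0, 0, 0, h) := by
    intro h
    rw [OO.iota_apply]
    simp [OO.iotaFun]
  have l1 : ℓ 1 = 0 := (hℓ.1 1).2 rfl
  have hK : (0 : ℝ) < 4 * (A + 3) + 4 := by positivity
  refine ⟨↥G, inferInstance, X, ι, (4 * (A + 3) + 4 : ℝ)⁻¹, hgen, ?_, by positivity, ?_, ?_⟩
  · intro h h' hh
    have h1 : OO.iota H p0 h = OO.iota H p0 h' := congrArg Subtype.val hh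
    have h2 := hev h
    rw [h1, hev h'] at h2
    simp only [Prod.mk.injEq, true_and] at h2
    exact h2.symm
  · intro h
    constructor
    · rw [inv_mul_le_iff₀ hK]
      by_cases h1 : h = 1
      · subst h1
        have : wordLength (X : Set ↥G) (ι 1) ≤ 0 := by
          rw [map_one]; exact OO.WL.one.le
        have : wordLength (X : Set ↥G) (ι 1) = 0 := by omega
        rw [this, l1]; simp
      · have hpos : 1 ≤ ℓ h := by
          rcases Nat.eq_zero_or_pos (ℓ h) with h0 | h0
          · exact absurd ((hℓ.1 h).1 h0) h1
          · exact h0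
        have hle : wordLength (X : Set ↥G) (ι h) ≤ 4 * (ℓ h * (A + 3)) + 4 := (hword h).2.le
        have hle' : wordLength (X : Set ↥G) (ι h) ≤ (4 * (A + 3) + 4) * ℓ h := by
          refine hle.trans ?_
          nlinarith
        exact_mod_cast hle'
    · have hW : OO.WL (X : Set ↥G) _ (ι h) := OO.WL.wordLength (by rw [hgen]; trivial)
      have hW' := hW.map G.subtype (X' := Y) (fun x hx => by rw [hX] at hx; exact hx)
      have := hW'.lipschitz (OO.Phi ℓ c) (OO.Phi_lip hℓ hc) (p0, 0, 0, 1)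
      have e1 : (G.subtype (ι h)) (p0, 0, 0, 1) = (p0, 0, 0, h) := hev h
      rw [e1] at this
      simp only [OO.Phi, lt_irrefl, and_self, if_false, l1] at this
      rw [abs_le] at this
      have := this.2
      omega
  · have hn := OO.G2_normal OO.sg OO.la d p0
    refine ⟨⊥, OO.G2 OO.sg OO.la d p0, inferInstance, hn, inferInstance, bot_le, ?_, ?_, ?_, ?_⟩
    · rintro ⟨a, ha⟩ ⟨b, hb⟩
      rw [Subgroup.mem_bot] at ha hb
      subst ha; subst hb; rfl
    · intro g hg _
      exact Subgroup.mem_bot.1 hg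
    · exact OO.G2_inClassE OO.sg OO.la d p0
    · exact OO.G2_derived OO.sg OO.la d p0 OO.S0_derived (OO.dd_fin hℓ hgrowth hc)
end

section
/- Let H be a solvable group and ℓ : H → ℕ a length function on H such that the growth of H with respect to ℓ is at most exponential. Then there exist a finitely generated solvable group G with finite generating set X, an injective group homomorphism ι : H → G, and a constant c > 0 such that c·|ι(h)|_X ≤ ℓ(h) ≤ |ι(h)|_X for every h ∈ H. -/
namespace SolvEmb

/-- `g` is a product of at most `n` letters from `X ∪ X⁻¹`. -/
def Reach {G : Type*} [Group G] (X : Set G) (g : G) (n : ℕ) : Prop :=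
  ∃ l : List G, l.length ≤ n ∧ (∀ x ∈ l, x ∈ X ∨ x⁻¹ ∈ X) ∧ l.prod = g

section
variable {G : Type*} [Group G] {X : Set G}

theorem Reach.mul {g h : G} {m n : ℕ} (hg : Reach X g m) (hh : Reach X h n) :
    Reach X (g * h) (m + n) := by
  obtain ⟨l, h1, h2, h3⟩ := hg
  obtain ⟨l', h1', h2', h3'⟩ := hh
  refine ⟨l ++ l', by simp; omega, ?_, by simp [h3, h3']⟩
  intro x hx
  rcases List.mem_append.1 hx with hx | hx
  · exact h2 x hx
  · exact h2' x hx

theorem Reach.mono {g : G} {m n : ℕ} (hg : Reach X g m) (hmn : m ≤ n) : Reach X g n := by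
  obtain ⟨l, h1, h2, h3⟩ := hg
  exact ⟨l, h1.trans hmn, h2, h3⟩

theorem Reach.inv {g : G} {m : ℕ} (hg : Reach X g m) : Reach X g⁻¹ m := by
  obtain ⟨l, h1, h2, h3⟩ := hg
  refine ⟨(l.map (·⁻¹)).reverse, by simpa using h1, ?_, by rw [← h3, List.prod_inv_reverse]⟩
  intro x hx
  simp only [List.mem_reverse, List.mem_map] at hx
  obtain ⟨y, hy, rfl⟩ := hx
  rw [inv_inv]
  exact (h2 y hy).symm

theorem Reach.one : Reach X (1 : G) 0 := ⟨[], by simp⟩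

theorem Reach.of {x : G} (hx : x ∈ X) : Reach X x 1 := ⟨[x], by simp [hx]⟩

theorem Reach.pow {g : G} {m : ℕ} (hg : Reach X g m) (k : ℕ) : Reach X (g ^ k) (k * m) := by
  induction k with
  | zero => simpa using Reach.one
  | succ k ih => rw [pow_succ, Nat.succ_mul]; exact ih.mul hg

theorem Reach.mem_closure {g : G} {m : ℕ} (hg : Reach X g m) : g ∈ Subgroup.closure X := by
  obtain ⟨l, h1, h2, rfl⟩ := hg
  refine Subgroup.list_prod_mem _ fun x hx => ?_
  rcases h2 x hx with h | h
  · exact Subgroup.subset_closure h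
  · exact (inv_mem_iff).1 (Subgroup.subset_closure h)

end

instance pi_solvable {I D : Type*} [Group D] [hD : Group.IsSolvable D] : Group.IsSolvable (I → D) := by
  obtain ⟨n, hn⟩ := hD
  refine ⟨n, ?_⟩
  rw [eq_bot_iff]
  intro f hf
  rw [Subgroup.mem_bot]
  funext i
  have := map_derivedSeries_le_derivedSeries (Pi.evalMonoidHom (fun _ : I => D) i) n
    (Subgroup.mem_map_of_mem _ hf)
  rw [hn] at this
  simpa using this

instance wr_solvable {D Q : Type*} [Group D] [Group Q] [Group.IsSolvable D] [Group.IsSolvable Q] :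
    Group.IsSolvable (D ≀ᵣ Q) := by
  let f : (Q → D) →* D ≀ᵣ Q :=
    { toFun := fun a => ⟨a, 1⟩
      map_one' := rfl
      map_mul' := fun a b => by ext <;> simp }
  refine Group.isSolvable_of_ker_le_range f RegularWreathProduct.rightHom ?_
  intro x hx
  refine ⟨x.left, ?_⟩
  have : x.right = 1 := hx
  ext <;> simp [f, this]

/-- Passing from a big solvable group to the subgroup generated by `X`. -/
theorem finish {H Γ : Type} [Group H] [Group Γ] (hΓ : Group.IsSolvable Γ) (ℓ : H → ℕ)
    (hℓ1 : ∀ h, ℓ h = 0 ↔ h = 1)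
    (X : Finset Γ) (j : H →* Γ) (C : ℕ)
    (hup : ∀ h, h ≠ 1 → Reach (X : Set Γ) (j h) (C * ℓ h))
    (hlow : ∀ h n, Reach (X : Set Γ) (j h) n → ℓ h ≤ n) :
    ∃ (G : Type) (instG : Group G) (X : Finset G) (ι : H →* G) (c : ℝ),
      IsSolvable G ∧
      Subgroup.closure (X : Set G) = ⊤ ∧
      Function.Injective ι ∧ 0 < c ∧
      ∀ h : H, c * (wordLength (X : Set G) (ι h) : ℝ) ≤ (ℓ h : ℝ) ∧
        ℓ h ≤ wordLength (X : Set G) (ι h) := by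
  classical
  have hinj : Function.Injective j := by
    rw [injective_iff_map_eq_one]
    intro h hh
    have := hlow h 0 (by rw [hh]; exact Reach.one)
    exact (hℓ1 h).1 (by omega)
  have hup' : ∀ h, Reach (X : Set Γ) (j h) (C * ℓ h) := by
    intro h
    by_cases hh : h = 1
    · subst hh
      rw [map_one]
      exact Reach.one.mono (Nat.zero_le _)
    · exact hup h hh
  let S : Subgroup Γ := Subgroup.closure (X : Set Γ)
  have hmem : ∀ h, j h ∈ S := fun h => (hup' h).mem_closure
  let Y : Finset S := X.preimage (Subtype.val : S → Γ) Subtype.val_injective.injOn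
  have hY : (Y : Set S) = (Subtype.val : S → Γ) ⁻¹' (X : Set Γ) := by simp [Y]
  have hYm : ∀ y : S, y ∈ (Y : Set S) ↔ (y : Γ) ∈ (X : Set Γ) := by
    intro y; rw [hY]; rfl
  let ι : H →* S := j.codRestrict S hmem
  have hιr : ∀ h, Reach (Y : Set S) (ι h) (C * ℓ h) := by
    intro h
    obtain ⟨l, h1, h2, h3⟩ := hup' h
    have h4 : ∀ x ∈ l, x ∈ S := by
      intro x hx
      rcases h2 x hx with h | h
      · exact Subgroup.subset_closure h
      · exact (inv_mem_iff).1 (Subgroup.subset_closure h)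
    lift l to List S using h4
    refine ⟨l, by simpa using h1, ?_, ?_⟩
    · intro x hx
      rw [hYm, hYm]
      exact h2 x (List.mem_map_of_mem hx)
    · apply Subtype.ext
      change S.subtype l.prod = _
      rw [map_list_prod]
      exact h3
  have hS : Group.IsSolvable S := inferInstance
  refine ⟨S, inferInstance, Y, ι, 1 / (C + 1), hS, ?_, ?_, by positivity, ?_⟩
  · rw [hY]
    exact Subgroup.closure_closure_coe_preimage
  · intro a b hab
    exact hinj (congrArg Subtype.val hab)
  · intro h
    obtain ⟨l, h1, h2, h3⟩ := hιr h
    constructor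
    · have : wordLength (Y : Set S) (ι h) ≤ C * ℓ h :=
        le_trans (Nat.sInf_le (Exists.intro l ⟨rfl, h2, h3⟩)) h1
      have h5 : (wordLength (Y : Set S) (ι h) : ℝ) ≤ C * ℓ h := by exact_mod_cast this
      have : (0 : ℝ) < C + 1 := by positivity
      rw [one_div, inv_mul_le_iff₀ this]
      have : (0 : ℝ) ≤ ℓ h := by positivity
      linarith
    · refine le_csInf (Set.nonempty_of_mem (x := l.length) (Exists.intro l ⟨rfl, h2, h3⟩)) ?_
      rintro n ⟨l', rfl, h2', h3'⟩
      apply hlow h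
      refine ⟨l'.map Subtype.val, by simp, ?_, ?_⟩
      · intro x hx
        obtain ⟨y, hy, rfl⟩ := List.mem_map.1 hx
        have := h2' y hy
        rw [hYm, hYm] at this
        exact this
      · have := congrArg S.subtype h3'
        rw [map_list_prod] at this
        exact this

theorem exists_B : ∃ (B : Type) (_ : Group B) (κ : B → ℤ) (σ s : B), Group.IsSolvable B ∧
    σ * σ = 1 ∧ σ ≠ 1 ∧ κ 1 = 0 ∧ (∀ b, κ (σ * b) = - κ b) ∧ ∀ b, κ (s * b) = κ b + 1 := by
  let z : Multiplicative (ZMod 2) := Multiplicative.ofAdd 1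
  have hz : z * z = 1 := by decide
  have hz1 : z ≠ 1 := by decide
  have hzi : z⁻¹ = z := by decide
  refine ⟨Multiplicative ℤ ≀ᵣ Multiplicative (ZMod 2), inferInstance,
    fun b => (b.left 1).toAdd - (b.left z).toAdd, ⟨1, z⟩,
    ⟨fun x => if x = 1 then Multiplicative.ofAdd 1 else 1, 1⟩, inferInstance, ?_, ?_, ?_, ?_, ?_⟩
  · ext <;> simp [hz]
  · intro h
    exact hz1 (congrArg RegularWreathProduct.right h)
  · simp
  · intro b
    simp [hzi, hz]
  · intro b
    simp [hz1]
    ring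

section K
variable {H B : Type} [Group H] [Group B] (κ : B → ℤ) (σ s : B)

/-- The involutions `u_h`. -/
def uK (h : H) : H ≀ᵣ B := ⟨fun b => h ^ (-(κ b).sign), σ⟩

/-- The embedding of `H`. -/
def jK : H →* H ≀ᵣ B where
  toFun h := ⟨fun b => if κ b = 0 ∨ κ b = -1 then h else 1, 1⟩
  map_one' := by ext <;> simp
  map_mul' a b := by
    ext x
    · by_cases hx : κ x = 0 ∨ κ x = -1 <;> simp [hx]
    · simp

variable {κ σ s} (hσ : σ * σ = 1) (hκσ : ∀ b, κ (σ * b) = - κ b) (hκs : ∀ b, κ (s * b) = κ b + 1)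

include hσ hκσ in
theorem uK_sq (h : H) : uK κ σ h * uK κ σ h = 1 := by
  have hi : σ⁻¹ = σ := inv_eq_of_mul_eq_one_left hσ
  ext x
  · simp [uK, hi, hκσ]
  · simp [uK, hσ]

include hσ hκσ hκs in
theorem uK_comm (h : H) :
    uK κ σ h * RegularWreathProduct.inl s * (uK κ σ h)⁻¹ * (RegularWreathProduct.inl s)⁻¹ *
      (RegularWreathProduct.inl (σ * s * σ⁻¹ * s⁻¹))⁻¹ = jK κ h := by
  have hi : σ⁻¹ = σ := inv_eq_of_mul_eq_one_left hσ
  have hu : (uK κ σ h)⁻¹ = uK κ σ h := inv_eq_of_mul_eq_one_left (uK_sq hσ hκσ h)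
  have hsi : ∀ b, κ (s⁻¹ * b) = κ b - 1 := by
    intro b
    have := hκs (s⁻¹ * b)
    rw [mul_inv_cancel_left] at this
    omega
  rw [hu]
  ext x
  · simp [uK, hi, hκσ, hsi, jK, mul_assoc]
    rcases lt_trichotomy (κ x) 0 with hx | hx | hx
    · by_cases hx' : κ x = -1
      · simp [hx']
      · have h2 : 0 < -κ x - 1 := by omega
        have h3 : ¬ (κ x = 0 ∨ κ x = -1) := by omega
        rw [if_neg h3, Int.sign_eq_neg_one_of_neg hx, Int.sign_eq_one_of_pos h2]
        simp
    · simp [hx]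
    · have h2 : -κ x - 1 < 0 := by omega
      have h3 : ¬ (κ x = 0 ∨ κ x = -1) := by omega
      rw [if_neg h3, Int.sign_eq_one_of_pos hx, Int.sign_eq_neg_one_of_neg h2]
      simp
  · simp [uK, jK, hi, mul_assoc]
    rw [← mul_assoc σ σ, hσ]; simp [hσ]

variable (κ σ) in
/-- Values which may be read at the site of `h`. -/
def UK (h : H) (r : H ≀ᵣ B) : Prop := r = 1 ∨ r = uK κ σ h ∨ (h = 1 ∧ r.left = 1)

include hσ hκσ in
theorem UK_mul {h : H} {r r' : H ≀ᵣ B} (hr : UK κ σ h r) (hr' : UK κ σ h r') :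
    UK κ σ h (r * r') := by
  by_cases hh : h = 1
  · have key : ∀ r, UK κ σ h r → r.left = 1 := by
      rintro r (rfl | rfl | ⟨_, h⟩)
      · simp
      · subst hh; ext; simp [uK]
      · exact h
    right; right
    refine ⟨hh, ?_⟩
    ext; simp [key r hr, key r' hr']
  · rcases hr with rfl | rfl | ⟨h1, _⟩
    · simpa using hr'
    · rcases hr' with rfl | rfl | ⟨h1, _⟩
      · right; left; simp
      · left; exact uK_sq hσ hκσ h
      · exact absurd h1 hh
    · exact absurd h1 hh

theorem UK_len {ℓ : H → ℕ} (h0 : ∀ h, ℓ h = 0 ↔ h = 1) (h1 : ∀ h, ℓ h⁻¹ = ℓ h) {h : H}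
    {r : H ≀ᵣ B} (hr : UK κ σ h r) (b : B) : ℓ (r.left b) ≤ ℓ h := by
  have h01 : ℓ 1 = 0 := (h0 1).2 rfl
  rcases hr with rfl | rfl | ⟨_, h⟩
  · simp [h01]
  · rcases Int.sign_trichotomy (κ b) with h | h | h <;> simp [uK, h, h01, h1]
  · simp [h, h01]

end K

theorem exists_digits {H : Type} [Group H] (ℓ : H → ℕ) (h0 : ∀ h, ℓ h = 0 ↔ h = 1) (a : ℕ)
    (ha : ∀ n : ℕ, {h : H | ℓ h ≤ n}.Finite ∧ Nat.card {h : H | ℓ h ≤ n} ≤ a ^ n) :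
    ∃ d : H → ℕ → ℕ, (∀ h i, d h i ≤ a) ∧ (∀ h i, 3 * ℓ h ≤ i → d h i = 0) ∧
      ∀ h h', h ≠ h' → ∃ i, d h i ≠ d h' i ∧ ℓ h + ℓ h' ≤ i := by
  classical
  have he : ∀ n : ℕ, ∃ e : {h : H | ℓ h ≤ n} → (Fin n → Fin a), Function.Injective e := by
    intro n
    have : Finite {h : H | ℓ h ≤ n} := (ha n).1
    have : Fintype {h : H | ℓ h ≤ n} := Fintype.ofFinite _
    have h2 := (ha n).2
    rw [Nat.card_eq_fintype_card] at h2
    have : Nonempty ({h : H | ℓ h ≤ n} ↪ (Fin n → Fin a)) := by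
      apply Function.Embedding.nonempty_of_card_le
      simpa using h2
    obtain ⟨e⟩ := this
    exact ⟨e, e.injective⟩
  choose e he using he
  let d : H → ℕ → ℕ := fun h i =>
    if hi : 2 * ℓ h ≤ i ∧ i < 3 * ℓ h then (e (ℓ h) ⟨h, le_refl (ℓ h)⟩ ⟨i - 2 * ℓ h, by omega⟩ : ℕ) + 1
    else 0
  have key : ∀ h h', ℓ h < ℓ h' → ∃ i, d h i ≠ d h' i ∧ ℓ h + ℓ h' ≤ i := by
    intro h h' hlt
    refine ⟨3 * ℓ h' - 1, ?_, by omega⟩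
    have h1 : d h (3 * ℓ h' - 1) = 0 := dif_neg (by omega)
    have h2 : d h' (3 * ℓ h' - 1) ≠ 0 := by
      simp only [d]
      rw [dif_pos (by omega)]
      omega
    rw [h1]; exact h2.symm
  refine ⟨d, ?_, ?_, ?_⟩
  · intro h i
    simp only [d]
    split_ifs with hi
    · have := (e (ℓ h) ⟨h, le_refl (ℓ h)⟩ ⟨i - 2 * ℓ h, by omega⟩).2
      omega
    · omega
  · intro h i hi
    exact dif_neg (by omega)
  · intro h h' hne
    rcases lt_trichotomy (ℓ h) (ℓ h') with hlt | heq | hlt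
    · exact key h h' hlt
    · have h1 : e (ℓ h) ⟨h, le_refl (ℓ h)⟩ ≠ e (ℓ h) ⟨h', heq.ge⟩ := by
        intro hh
        have := he _ hh
        exact hne (congrArg Subtype.val this)
      obtain ⟨k, hk⟩ := Function.ne_iff.1 h1
      refine ⟨2 * ℓ h + k, ?_, by omega⟩
      have hgen : ∀ (n : ℕ) (g : H) (hg : ℓ g = n) (k : Fin n),
          d g (2 * n + k) = (e n ⟨g, hg.le⟩ k : ℕ) + 1 := by
        intro n g hg k
        subst hg
        simp only [d]
        rw [dif_pos (by omega)]
        congr 3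
        ext
        simp
      rw [hgen _ h rfl, hgen _ h' heq.symm]
      intro h3
      exact hk (Fin.ext (by omega))
    · obtain ⟨i, h1, h2⟩ := key h' h hlt
      exact ⟨i, h1.symm, by omega⟩

/-- lamplighter -/
abbrev LA := Multiplicative ℤ ≀ᵣ Multiplicative ℤ

/-- the step -/
def LT : LA := ⟨1, Multiplicative.ofAdd 1⟩

/-- the lamp -/
def LL (k : ℤ) : LA := ⟨fun q => if q = 1 then Multiplicative.ofAdd k else 1, 1⟩

theorem LL_add (k k' : ℤ) : LL (k + k') = LL k * LL k' := by
  ext q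
  · by_cases hq : q = 1 <;> simp [LL, hq]
  · simp [LL]

theorem LL_pow (k : ℕ) : LL 1 ^ k = LL k := by
  induction k with
  | zero => ext <;> simp [LL]
  | succ k ih => rw [pow_succ, ih, ← LL_add]; simp

theorem LT_pow (k : ℕ) : LT ^ k = ⟨1, Multiplicative.ofAdd (k : ℤ)⟩ := by
  induction k with
  | zero => ext <;> simp
  | succ k ih =>
    rw [pow_succ, ih]
    ext
    · simp [LT]
    · simp [LT]

/-- writing digits -/
def LW (d : ℕ → ℕ) (m : ℕ) (p : ℤ) : LA :=
  ⟨fun q => Multiplicative.ofAdd (if 0 ≤ q.toAdd ∧ q.toAdd < m then (d q.toAdd.toNat : ℤ) else 0),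
    Multiplicative.ofAdd p⟩

theorem LW_succ (d : ℕ → ℕ) (m : ℕ) : LW d (m + 1) (m + 1 : ℕ) = LW d m m * LL (d m) * LT := by
  ext q
  · have h1 : ((Multiplicative.ofAdd (m : ℤ))⁻¹ * q = 1) ↔ q.toAdd = m := by
      rw [inv_mul_eq_one]
      constructor
      · rintro rfl; rfl
      · intro h; rw [← h]; rfl
    simp only [LW, LL, LT, RegularWreathProduct.mul_left, Pi.mul_apply, h1, Pi.one_apply, mul_one,
      toAdd_mul, toAdd_ofAdd]
    by_cases hq : q.toAdd = m
    · simp [hq]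
    · rw [if_neg hq]
      simp only [toAdd_one, add_zero]
      congr 1
      simp only [eq_iff_iff]
      push_cast
      omega
  · simp [LW, LL, LT]

theorem LW_reach {X : Set LA} (hT : LT ∈ X) (hL : LL 1 ∈ X) (d : ℕ → ℕ) (a : ℕ)
    (hd : ∀ i, d i ≤ a) (m : ℕ) : Reach X (LW d m m) (m * (a + 1)) := by
  induction m with
  | zero =>
    have : LW d 0 (0 : ℕ) = 1 := by
      ext q
      · simp only [LW]
        rw [if_neg (by push_cast; omega)]
        simp
      · simp [LW]
    rw [this]
    simpa using Reach.one
  | succ m ih =>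
    rw [LW_succ, ← LL_pow]
    refine ((ih.mul ((Reach.of hL).pow (d m))).mul (Reach.of hT)).mono ?_
    have := hd m
    nlinarith

theorem LW_reach0 {X : Set LA} (hT : LT ∈ X) (hL : LL 1 ∈ X) (d : ℕ → ℕ) (a : ℕ)
    (hd : ∀ i, d i ≤ a) (m : ℕ) : Reach X (LW d m 0) (m * (a + 2)) := by
  have : LW d m 0 = LW d m m * (LT ^ m)⁻¹ := by
    rw [LT_pow]
    ext q
    · simp [LW]
    · simp [LW]
  rw [this]
  refine ((LW_reach hT hL d a hd m).mul ((Reach.of hT).pow m).inv).mono ?_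
  nlinarith

theorem exists_A {H : Type} [Group H] (ℓ : H → ℕ) (h0 : ∀ h, ℓ h = 0 ↔ h = 1) (a : ℕ)
    (ha : ∀ n : ℕ, {h : H | ℓ h ≤ n}.Finite ∧ Nat.card {h : H | ℓ h ≤ n} ≤ a ^ n) :
    ∃ (A : Type) (_ : Group A) (S : Finset A) (pt : H → A) (Near : A → H → ℕ → Prop) (C : ℕ),
      Group.IsSolvable A ∧ pt 1 = 1 ∧ (∀ h, Reach (S : Set A) (pt h) (C * ℓ h)) ∧
      (∀ h, Near (pt h) h 0) ∧
      (∀ h h' m, h ≠ h' → Near (pt h') h m → ℓ h + ℓ h' ≤ m) ∧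
      (∀ x h m, Near x h m → Near x h (m + 1)) ∧
      (∀ x h m s, (s ∈ S ∨ s⁻¹ ∈ S) → Near (s⁻¹ * x) h m → Near x h (m + 1)) := by
  classical
  obtain ⟨d, hd1, hd2, hd3⟩ := exists_digits ℓ h0 a ha
  let c : H → ℤ → ℤ := fun h q => if 0 ≤ q then (d h q.toNat : ℤ) else 0
  let pt : H → LA := fun h => ⟨fun q => Multiplicative.ofAdd (c h q.toAdd), 1⟩
  have hpt : ∀ h, pt h = LW (d h) (3 * ℓ h) 0 := by
    intro h
    ext q
    · simp only [pt, c, LW, toAdd_ofAdd]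
      by_cases h1 : 0 ≤ q.toAdd
      · by_cases h2 : q.toAdd < (3 * ℓ h : ℕ)
        · rw [if_pos h1, if_pos ⟨h1, h2⟩]
        · rw [if_pos h1, if_neg (by omega), hd2 h _ (by omega)]; rfl
      · rw [if_neg h1, if_neg (by omega)]
    · simp [pt, LW]
  let Near : LA → H → ℕ → Prop := fun x h m =>
    ∀ j : ℤ, (x.left (Multiplicative.ofAdd j)).toAdd ≠ c h (j - x.right.toAdd) → |j| ≤ m
  have hT : ∀ x h m (e : ℤ), |e| ≤ 1 → Near (⟨1, Multiplicative.ofAdd e⟩ * x) h m →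
      Near x h (m + 1) := by
    intro x h m e he hN j hj
    have := hN (j + e) (by
      simp only [RegularWreathProduct.mul_left, RegularWreathProduct.mul_right, Pi.mul_apply,
        Pi.one_apply, one_mul, toAdd_mul, toAdd_ofAdd]
      have e1 : (Multiplicative.ofAdd e)⁻¹ * Multiplicative.ofAdd (j + e) =
          Multiplicative.ofAdd j := by
        rw [← ofAdd_neg, ← ofAdd_add]; congr 1; ring
      have e2 : j + e - (e + x.right.toAdd) = j - x.right.toAdd := by ring
      rw [e1, e2]
      exact hj)
    push_cast
    rw [abs_le] at *
    omega
  have hL : ∀ x h m (e : ℤ), Near (LL e * x) h m → Near x h (m + 1) := by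
    intro x h m e hN j hj
    by_cases hj0 : j = 0
    · subst hj0; simp; omega
    · have := hN j (by
        have : (Multiplicative.ofAdd j) ≠ 1 := by simpa using hj0
        simpa [LL, this] using hj)
      push_cast
      omega
  have hTi : LT⁻¹ = ⟨1, Multiplicative.ofAdd (-1)⟩ := by ext <;> simp [LT]
  have hLi : (LL 1)⁻¹ = LL (-1) := by
    rw [inv_eq_iff_mul_eq_one, ← LL_add]
    ext <;> simp [LL]
  refine ⟨LA, inferInstance, {LT, LL 1}, pt, Near, 3 * (a + 2), inferInstance, ?_, ?_, ?_, ?_, ?_, ?_⟩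
  · rw [hpt, (h0 1).2 rfl]
    ext q
    · simp only [LW]
      rw [if_neg (by push_cast; omega)]
      simp
    · simp [LW]
  · intro h
    rw [hpt]
    refine (LW_reach0 (by simp) (by simp) (d h) a (hd1 h) _).mono ?_
    apply le_of_eq; ring
  · intro h j hj
    simp [pt] at hj
  · intro h h' m hne hN
    obtain ⟨i, h1, h2⟩ := hd3 h h' hne
    have := hN i (by
      simp only [pt, c, toAdd_ofAdd, toAdd_one, sub_zero]
      rw [if_pos (by omega), if_pos (by omega)]
      simpa using h1.symm)
    rw [abs_le] at this
    omega
  · intro x h m hN j hj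
    have := hN j hj
    push_cast
    omega
  · intro x h m s hs hN
    have hs' : s = LT ∨ s = LL 1 ∨ s⁻¹ = LT ∨ s⁻¹ = LL 1 := by
      simpa [or_assoc] using hs
    rcases hs' with rfl | rfl | h1 | h1
    · rw [hTi] at hN
      exact hT _ _ _ _ (by simp) hN
    · rw [hLi] at hN
      exact hL _ _ _ _ hN
    · rw [h1] at hN
      exact hT _ _ _ _ (by simp) hN
    · rw [h1] at hN
      exact hL _ _ _ _ hN

section main
variable {H A B : Type} [Group H] [Group A] [Group B]

/-- reading at `x` -/
def Read (κ : B → ℤ) (σ : B) (pt : H → A) (x : A) (r : H ≀ᵣ B) : Prop :=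
  r = 1 ∨ ∃ h, x = pt h ∧ UK κ σ h r

/-- the invariant -/
def Inv (κ : B → ℤ) (σ : B) (ℓ : H → ℕ) (Near : A → H → ℕ → Prop) (x : A) (P : H ≀ᵣ B) (n : ℕ) :
    Prop :=
  P = 1 ∨ ∃ (h : H) (r Q : H ≀ᵣ B) (m k : ℕ), P = r * Q ∧ UK κ σ h r ∧ Near x h m ∧ m + k ≤ n ∧
    (Q = 1 ∨ ∀ b, ℓ (Q.left b) + ℓ h ≤ k)

/-- the letter supported at one point -/
noncomputable def psi (v : B) : (H ≀ᵣ B) ≀ᵣ A := by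
  classical
  exact ⟨fun x => if x = 1 then RegularWreathProduct.inl v else 1, 1⟩

/-- the main letter -/
noncomputable def phi (κ : B → ℤ) (σ : B) (pt : H → A) : (H ≀ᵣ B) ≀ᵣ A := by
  classical
  exact ⟨fun x => if hx : ∃ h, pt h = x then uK κ σ hx.choose else 1, 1⟩

/-- the embedding -/
noncomputable def jG (κ : B → ℤ) : H →* (H ≀ᵣ B) ≀ᵣ A := by
  classical
  exact
  { toFun := fun h => ⟨fun x => if x = 1 then jK κ h else 1, 1⟩
    map_one' := by ext : 1 <;> simp <;> rfl
    map_mul' := fun a b => by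
      ext : 1
      · funext x
        by_cases hx : x = 1 <;> simp [hx]
      · simp }

variable {κ : B → ℤ} {σ s : B} (ℓ : H → ℕ)
    (h0 : ∀ h, ℓ h = 0 ↔ h = 1) (h1 : ∀ h, ℓ h⁻¹ = ℓ h) (h2 : ∀ g h, ℓ (g * h) ≤ ℓ g + ℓ h)
    (hσ : σ * σ = 1) (hσ1 : σ ≠ 1) (hκ1 : κ 1 = 0) (hκσ : ∀ b, κ (σ * b) = - κ b)
    (hκs : ∀ b, κ (s * b) = κ b + 1)
    (S : Finset A) (pt : H → A) (Near : A → H → ℕ → Prop) (C : ℕ)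
    (hpt1 : pt 1 = 1) (hreach : ∀ h, Reach (S : Set A) (pt h) (C * ℓ h))
    (hN0 : ∀ h, Near (pt h) h 0)
    (hNsep : ∀ h h' m, h ≠ h' → Near (pt h') h m → ℓ h + ℓ h' ≤ m)
    (hNmono : ∀ x h m, Near x h m → Near x h (m + 1))
    (hNstep : ∀ x h m s, (s ∈ S ∨ s⁻¹ ∈ S) → Near (s⁻¹ * x) h m → Near x h (m + 1))

include hNstep in
theorem Inv_step {x : A} {P : H ≀ᵣ B} {n : ℕ} {g : A} (hg : g ∈ S ∨ g⁻¹ ∈ S)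
    (hI : Inv κ σ ℓ Near (g⁻¹ * x) P n) : Inv κ σ ℓ Near x P (n + 1) := by
  rcases hI with rfl | ⟨h, r, Q, m, k, hP, hr, hN, hmk, hQ⟩
  · exact Or.inl rfl
  · exact Or.inr ⟨h, r, Q, m + 1, k, hP, hr, hNstep _ _ _ _ hg hN, by omega, hQ⟩

include h0 h1 h2 hσ hκσ hN0 hNsep hNmono in
theorem Inv_read {x : A} {P r : H ≀ᵣ B} {n : ℕ} (hr : Read κ σ pt x r)
    (hI : Inv κ σ ℓ Near x P n) : Inv κ σ ℓ Near x (r * P) (n + 1) := by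
  rcases hr with rfl | ⟨h', rfl, hr⟩
  · rw [one_mul]
    rcases hI with rfl | ⟨h, r, Q, m, k, hP, hr, hN, hmk, hQ⟩
    · exact Or.inl rfl
    · exact Or.inr ⟨h, r, Q, m + 1, k, hP, hr, hNmono _ _ _ hN, by omega, hQ⟩
  · right
    rcases hI with rfl | ⟨h, r', Q, m, k, hP, hr', hN, hmk, hQ⟩
    · exact ⟨h', r, 1, 0, 0, rfl, hr, hN0 _, by omega, Or.inl rfl⟩
    · by_cases hh : h = h'
      · subst hh
        refine ⟨h, r * r', Q, m, k, ?_, UK_mul hσ hκσ hr hr', hN, by omega, hQ⟩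
        rw [hP, mul_assoc]
      · refine ⟨h', r, P, 0, n, rfl, hr, hN0 _, by omega, Or.inr ?_⟩
        intro b
        have h3 := hNsep h h' m hh hN
        rw [hP]
        have h4 := UK_len h0 h1 hr' b
        have h5 := h2 (r'.left b) (Q.left (r'.right⁻¹ * b))
        rcases hQ with rfl | hQ
        · have : ℓ 1 = 0 := (h0 1).2 rfl
          simp at h5 ⊢
          omega
        · have h6 := hQ (r'.right⁻¹ * b)
          simp at h5 ⊢
          omega

include hpt1 in
theorem read_psi (v : B) (x : A) : Read κ σ pt x ((psi v : (H ≀ᵣ B) ≀ᵣ A).left x) := by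
  by_cases hx : x = 1
  · right
    refine ⟨1, by rw [hx, hpt1], Or.inr (Or.inr ⟨rfl, ?_⟩)⟩
    simp [psi, hx]
  · left; simp [psi, hx]

theorem read_phi (x : A) : Read κ σ pt x ((phi κ σ pt : (H ≀ᵣ B) ≀ᵣ A).left x) := by
  by_cases hx : ∃ h, pt h = x
  · right
    refine ⟨hx.choose, hx.choose_spec.symm, Or.inr (Or.inl ?_)⟩
    simp [phi, hx]
  · left; simp [phi, hx]

theorem psi_inv (v : B) : (psi v : (H ≀ᵣ B) ≀ᵣ A)⁻¹ = psi v⁻¹ := by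
  ext : 1
  · funext x
    by_cases hx : x = 1 <;> simp [psi, hx]
  · simp [psi]

include hσ hκσ in
theorem phi_inv : (phi κ σ pt : (H ≀ᵣ B) ≀ᵣ A)⁻¹ = phi κ σ pt := by
  ext : 1
  · funext x
    by_cases hx : ∃ h, pt h = x
    · simp [phi, hx]
      exact inv_eq_of_mul_eq_one_left (uK_sq hσ hκσ _)
    · simp [phi, hx]
  · simp [phi]

open RegularWreathProduct in
include h0 h1 h2 hσ hσ1 hκ1 hκσ hκs hpt1 hreach hN0 hNsep hNmono hNstep in
theorem main [hH : Group.IsSolvable H] [hA : Group.IsSolvable A] [hB : Group.IsSolvable B] :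
    ∃ (G : Type) (instG : Group G) (X : Finset G) (ι : H →* G) (c : ℝ),
      IsSolvable G ∧
      Subgroup.closure (X : Set G) = ⊤ ∧
      Function.Injective ι ∧ 0 < c ∧
      ∀ h : H, c * (wordLength (X : Set G) (ι h) : ℝ) ≤ (ℓ h : ℝ) ∧
        ℓ h ≤ wordLength (X : Set G) (ι h) := by
  classical
  let b : B := σ * s * σ⁻¹ * s⁻¹
  let φ : (H ≀ᵣ B) ≀ᵣ A := phi κ σ pt
  let X : Finset ((H ≀ᵣ B) ≀ᵣ A) := S.image inl ∪ {φ, psi s, psi b}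
  have hptinj : Function.Injective pt := by
    intro h h' hh
    by_contra hne
    have h3 := hNsep h h' 0 hne (by rw [← hh]; exact hN0 h)
    exact hne (((h0 h).1 (by omega)).trans ((h0 h').1 (by omega)).symm)
  have hφpt : ∀ h, φ.left (pt h) = uK κ σ h := by
    intro h
    have hx : ∃ h', pt h' = pt h := ⟨h, rfl⟩
    have := hptinj hx.choose_spec
    simp only [φ, phi]
    rw [dif_pos hx, this]
  -- classification of letters
  have hX : ∀ g, (g ∈ (X : Set _) ∨ g⁻¹ ∈ (X : Set _)) →
      (∃ q, (q ∈ S ∨ q⁻¹ ∈ S) ∧ g = inl q) ∨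
        (g.right = 1 ∧ ∀ x, Read κ σ pt x (g.left x)) := by
    have hX1 : ∀ g, g ∈ (X : Set _) → (∃ q ∈ S, g = inl q) ∨ g = φ ∨ ∃ v, g = psi v := by
      intro g hg
      simp only [X, Finset.coe_union, Finset.coe_image, Finset.coe_insert, Finset.coe_singleton,
        Set.mem_union, Set.mem_image, Set.mem_insert_iff, Set.mem_singleton_iff, Finset.mem_coe] at hg
      rcases hg with ⟨q, hq, rfl⟩ | rfl | rfl | rfl
      · exact Or.inl ⟨q, hq, rfl⟩
      · exact Or.inr (Or.inl rfl)
      · exact Or.inr (Or.inr ⟨_, rfl⟩)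
      · exact Or.inr (Or.inr ⟨_, rfl⟩)
    have hX2 : ∀ g, g ∈ (X : Set _) ∨ g⁻¹ ∈ (X : Set _) →
        (∃ q, (q ∈ S ∨ q⁻¹ ∈ S) ∧ g = inl q) ∨ g = φ ∨ ∃ v, g = psi v := by
      rintro g (hg | hg)
      · rcases hX1 g hg with ⟨q, hq, h⟩ | h
        · exact Or.inl ⟨q, Or.inl hq, h⟩
        · exact Or.inr h
      · rcases hX1 _ hg with ⟨q, hq, h⟩ | h | ⟨v, h⟩
        · exact Or.inl ⟨q⁻¹, Or.inr (by simpa using hq), by rw [map_inv, ← h, inv_inv]⟩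
        · right; left
          rw [← inv_inv g, h]
          exact phi_inv hσ hκσ pt
        · right; right
          refine ⟨v⁻¹, ?_⟩
          rw [← inv_inv g, h, psi_inv]
    intro g hg
    rcases hX2 g hg with h | rfl | ⟨v, rfl⟩
    · exact Or.inl h
    · exact Or.inr ⟨rfl, read_phi pt⟩
    · exact Or.inr ⟨rfl, read_psi pt hpt1 v⟩
  have hInv : ∀ (l : List ((H ≀ᵣ B) ≀ᵣ A)), (∀ g ∈ l, g ∈ (X : Set _) ∨ g⁻¹ ∈ (X : Set _)) →
      ∀ x, Inv κ σ ℓ Near x (l.prod.left x) l.length := by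
    intro l
    induction l with
    | nil => intro _ x; left; simp
    | cons g l ih =>
      intro hl x
      have ih' := ih (fun g hg => hl g (List.mem_cons_of_mem _ hg))
      rw [List.prod_cons, List.length_cons]
      rcases hX g (hl g List.mem_cons_self) with ⟨q, hq, rfl⟩ | ⟨hg1, hg⟩
      · have e : (inl q * l.prod : (H ≀ᵣ B) ≀ᵣ A).left x = l.prod.left (q⁻¹ * x) := by simp
        rw [e]
        exact Inv_step ℓ S Near hNstep hq (ih' _)
      · have e : (g * l.prod).left x = g.left x * l.prod.left x := by simp [hg1]
        rw [e]
        exact Inv_read ℓ h0 h1 h2 hσ hκσ pt Near hN0 hNsep hNmono (hg x) (ih' x)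
  refine finish (Γ := (H ≀ᵣ B) ≀ᵣ A) inferInstance ℓ h0 X (jG κ) (4 * C + 5) ?_ ?_
  · intro h hne
    have hlen : ℓ h ≠ 0 := fun h' => hne ((h0 h).1 h')
    have hsub : ∀ (g : A) (n : ℕ), Reach (S : Set A) g n →
        Reach (X : Set _) (inl g : (H ≀ᵣ B) ≀ᵣ A) n := by
      rintro g n ⟨l, h3, h4, rfl⟩
      refine ⟨l.map inl, by simpa using h3, ?_, by rw [map_list_prod]⟩
      intro x hx
      obtain ⟨y, hy, rfl⟩ := List.mem_map.1 hx
      have key : ∀ y, y ∈ (S : Set A) → (inl y : (H ≀ᵣ B) ≀ᵣ A) ∈ (X : Set _) := by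
        intro y hy
        simp only [X, Finset.coe_union, Finset.coe_image]
        exact Or.inl ⟨y, hy, rfl⟩
      rcases h4 y hy with h | h
      · exact Or.inl (key _ h)
      · right; rw [← map_inv]; exact key _ h
    have r1 := hsub _ _ (hreach h)
    have rφ : Reach (X : Set _) φ 1 := Reach.of (by simp [X])
    have rs : Reach (X : Set _) (psi s : (H ≀ᵣ B) ≀ᵣ A) 1 := Reach.of (by simp [X])
    have rb : Reach (X : Set _) (psi b : (H ≀ᵣ B) ≀ᵣ A) 1 := Reach.of (by simp [X])
    have r2 := (r1.inv.mul rφ).mul r1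
    have r3 := (((r2.mul rs).mul r2.inv).mul rs.inv).mul rb.inv
    have e : (((inl (pt h))⁻¹ * φ * inl (pt h)) * psi s * ((inl (pt h))⁻¹ * φ * inl (pt h))⁻¹ *
        (psi s)⁻¹ * (psi b)⁻¹ : (H ≀ᵣ B) ≀ᵣ A) = jG κ h := by
      have hφr : φ.right = 1 := rfl
      have hψr : ∀ v, (psi v : (H ≀ᵣ B) ≀ᵣ A).right = 1 := fun _ => rfl
      have hψl : ∀ v x, (psi v : (H ≀ᵣ B) ≀ᵣ A).left x = if x = 1 then inl v else 1 := by
        intro v x; simp [psi]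
      set U : (H ≀ᵣ B) ≀ᵣ A := (inl (pt h))⁻¹ * φ * inl (pt h) with hU
      have hUr : U.right = 1 := by simp [hU, hφr]
      have hU1 : U.left 1 = uK κ σ h := by simp [hU, hφpt]
      ext : 1
      · funext x
        by_cases hx : x = 1
        · subst hx
          have := uK_comm hσ hκσ hκs h
          simp only [mul_left, inv_left, Pi.mul_apply, Pi.inv_apply, mul_right, inv_right, hUr, hψr,
            hψl, hU1, mul_one, inv_one, if_true]
          rw [this]
          simp [jG]
        · simp [hUr, hψr, hψl, hx, jG]
      · simp [hUr, hψr, jG]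
    rw [e] at r3
    refine r3.mono ?_
    have : 1 ≤ ℓ h := by omega
    nlinarith
  · rintro h n ⟨l, h3, h4, h5⟩
    have h6 := hInv l h4 1
    rw [h5] at h6
    have e : (jG κ h : (H ≀ᵣ B) ≀ᵣ A).left 1 = jK κ h := by simp [jG]
    have e1 : (jK κ h : H ≀ᵣ B).left 1 = h := by simp [jK, hκ1]
    have e2 : (jK κ h : H ≀ᵣ B).right = 1 := rfl
    rw [e] at h6
    have hone : (jK κ h : H ≀ᵣ B).left 1 = 1 → ℓ h ≤ n := by
      intro h7
      rw [e1] at h7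
      rw [(h0 h).2 h7]; omega
    rcases h6 with h6 | ⟨k, r, Q, m, c, hP, hr, -, hmc, hQ⟩
    · exact hone (by rw [h6]; rfl)
    · rcases hQ with rfl | hQ
      · rw [mul_one] at hP
        rcases hr with rfl | rfl | ⟨_, hr⟩
        · exact hone (by rw [hP]; rfl)
        · rw [hP] at e2
          exact absurd e2 hσ1
        · exact hone (by rw [hP, hr]; rfl)
      · have h7 := h2 (r.left 1) (Q.left (r.right⁻¹ * 1))
        have h8 := UK_len h0 h1 hr 1
        have h9 := hQ (r.right⁻¹ * 1)
        have h10 : h = r.left 1 * Q.left (r.right⁻¹ * 1) := by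
          rw [← e1, hP]; rfl
        rw [← h10] at h7
        omega

end main

end SolvEmb

/-- Every solvable group of at most exponential growth with respect to a length function `ℓ`
embeds into a finitely generated solvable group, bi-Lipschitzly with respect to `ℓ`. -/
theorem solvable_embedding_theorem {H : Type} [Group H] (ℓ : H → ℕ)
    (hℓ : IsLengthFunction ℓ) (hgrowth : AtMostExponentialGrowth ℓ)
    (hsolv : IsSolvable H) :
    ∃ (G : Type) (instG : Group G) (X : Finset G) (ι : H →* G) (c : ℝ),
      IsSolvable G ∧
      Subgroup.closure (X : Set G) = ⊤ ∧
      Function.Injective ι ∧ 0 < c ∧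
      ∀ h : H, c * (wordLength (X : Set G) (ι h) : ℝ) ≤ (ℓ h : ℝ) ∧
        ℓ h ≤ wordLength (X : Set G) (ι h) := by
  classical
  obtain ⟨h0, h1, h2⟩ := hℓ
  obtain ⟨a, ha⟩ := hgrowth
  have hsolv' : Group.IsSolvable H := hsolv
  obtain ⟨B, instB, κ, σ, s, hB, hσ, hσ1, hκ1, hκσ, hκs⟩ := SolvEmb.exists_B
  obtain ⟨A, instA, S, pt, Near, C, hA, hpt1, hreach, hN0, hNsep, hNmono, hNstep⟩ :=
    SolvEmb.exists_A ℓ h0 a ha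
  exact SolvEmb.main ℓ h0 h1 h2 hσ hσ1 hκ1 hκσ hκs S pt Near C hpt1 hreach hN0 hNsep hNmono hNstep
end

section
/- Let H be a group satisfying a non-trivial identity and ℓ : H → ℕ a length function on H such that the growth of H with respect to ℓ is at most exponential. Then there exist a finitely generated group G satisfying a non-trivial identity, with finite generating set X, an injective group homomorphism ι : H → G, and a constant c > 0 such that c·|ι(h)|_X ≤ ℓ(h) ≤ |ι(h)|_X for every h ∈ H. -/
/-- `H` satisfies a non-trivial identity: there is a non-trivial element `w` of a free group of
finite rank which is sent to `1` by every homomorphism to `H`. -/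
def SatisfiesNontrivialIdentity (H : Type*) [Group H] : Prop :=
  ∃ (k : ℕ) (w : FreeGroup (Fin k)), w ≠ 1 ∧ ∀ φ : FreeGroup (Fin k) →* H, φ w = 1

/-- The commutator. -/
def cmt {G : Type*} [Group G] (x y : G) : G := x * y * x⁻¹ * y⁻¹

/-- The word substituted for a letter. -/
def cw {α : Type*} (x : α × Bool) : List ((α ⊕ α) × Bool) :=
  if x.2 then [(Sum.inl x.1, true), (Sum.inr x.1, true), (Sum.inl x.1, false), (Sum.inr x.1, false)]
  else [(Sum.inr x.1, true), (Sum.inl x.1, true), (Sum.inr x.1, false), (Sum.inl x.1, false)]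

theorem cw_reduced {α : Type*} : ∀ L : List (α × Bool), FreeGroup.IsReduced L →
    FreeGroup.IsReduced (L.flatMap cw) := by
  intro L
  induction L with
  | nil => intro _; simp [FreeGroup.IsReduced]
  | cons x L ih =>
    intro h
    cases L with
    | nil =>
      obtain ⟨a, b⟩ := x
      cases b <;> simp [FreeGroup.IsReduced, cw]
    | cons y L =>
      rw [FreeGroup.IsReduced, List.isChain_cons_cons] at h
      have ih' := ih h.2
      obtain ⟨a, b⟩ := x
      obtain ⟨a', b'⟩ := y
      have h1 := h.1
      simp only [FreeGroup.IsReduced, List.flatMap_cons] at ih' ⊢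
      cases b <;> cases b' <;> simp [cw] at ih' h1 ⊢ <;> tauto

theorem lift_cw {α : Type*} (L : List (α × Bool)) :
    FreeGroup.lift (fun i : α => cmt (FreeGroup.of (Sum.inl i : α ⊕ α)) (FreeGroup.of (Sum.inr i)))
      (FreeGroup.mk L) = FreeGroup.mk (L.flatMap cw) := by
  induction L with
  | nil => simp [← FreeGroup.one_eq_mk]
  | cons x L ih =>
    have : (FreeGroup.mk (x :: L) : FreeGroup α) = FreeGroup.mk [x] * FreeGroup.mk L := by
      simp [FreeGroup.mul_mk]
    rw [this, map_mul, ih, List.flatMap_cons, ← FreeGroup.mul_mk]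
    congr 1
    obtain ⟨a, b⟩ := x
    cases b <;> simp [cw, cmt, FreeGroup.of, FreeGroup.mul_mk, FreeGroup.inv_mk, FreeGroup.invRev]

theorem lift_comm_ne_one {α : Type*} (w : FreeGroup α) (hw : w ≠ 1) :
    FreeGroup.lift (fun i : α => cmt (FreeGroup.of (Sum.inl i : α ⊕ α)) (FreeGroup.of (Sum.inr i))) w
      ≠ 1 := by
  classical
  intro h
  apply hw
  rw [← FreeGroup.mk_toWord (x := w), lift_cw] at h
  have hr := cw_reduced _ (FreeGroup.isReduced_toWord (x := w))
  have h2 := congrArg FreeGroup.toWord h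
  rw [FreeGroup.toWord_mk, hr.reduce_eq, FreeGroup.toWord_one] at h2
  rw [← FreeGroup.toWord_eq_nil_iff]
  cases hL : w.toWord with
  | nil => rfl
  | cons x L =>
    rw [hL] at h2
    simp only [List.flatMap_cons, List.append_eq_nil_iff] at h2
    have := h2.1
    unfold cw at this
    split_ifs at this

theorem sat_of_commutator {Γ : Type*} [Group Γ] (K N : Subgroup Γ)
    (h : ∀ x ∈ K, ∀ y ∈ K, cmt x y ∈ N) (hN : SatisfiesNontrivialIdentity N) :
    SatisfiesNontrivialIdentity K := by
  obtain ⟨k, w, hw, hφ⟩ := hN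
  let e : FreeGroup (Fin k ⊕ Fin k) ≃* FreeGroup (Fin (k + k)) :=
    FreeGroup.freeGroupCongr finSumFinEquiv
  refine ⟨k + k, e (FreeGroup.lift (fun i => cmt (FreeGroup.of (Sum.inl i)) (FreeGroup.of (Sum.inr i))) w), ?_, ?_⟩
  · intro h1
    exact lift_comm_ne_one w hw (by simpa using h1)
  · intro φ
    let ψ : FreeGroup (Fin k) →* N := FreeGroup.lift (fun i =>
      ⟨cmt (φ (e (FreeGroup.of (Sum.inl i))) : Γ) (φ (e (FreeGroup.of (Sum.inr i))) : Γ),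
        h _ (φ _).2 _ (φ _).2⟩)
    have h2 := hφ ψ
    have h3 : N.subtype.comp ψ = K.subtype.comp (φ.comp (e.toMonoidHom.comp
        (FreeGroup.lift (fun i => cmt (FreeGroup.of (Sum.inl i)) (FreeGroup.of (Sum.inr i)))))) := by
      apply FreeGroup.ext_hom
      intro i
      simp [ψ, cmt]
    have h4 := DFunLike.congr_fun h3 w
    apply Subtype.ext
    have : ((ψ w : N) : Γ) = 1 := by rw [h2]; rfl
    simpa [this] using h4.symm

theorem sat_mono {Γ : Type*} [Group Γ] (K N : Subgroup Γ) (h : K ≤ N)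
    (hN : SatisfiesNontrivialIdentity N) : SatisfiesNontrivialIdentity K := by
  obtain ⟨k, w, hw, hφ⟩ := hN
  refine ⟨k, w, hw, fun φ => ?_⟩
  have := hφ ((Subgroup.inclusion h).comp φ)
  exact Subgroup.inclusion_injective h (by simpa using this)

/-- Permutations compatible with `β` which translate `κ` by an amount depending only on `β`. -/
def TT {X B A : Type*} [Group A] (β : X → B) (κ : X → A) : Subgroup (Equiv.Perm X) where
  carrier := {π | (∀ x y, β x = β y ↔ β (π x) = β (π y)) ∧
    ∀ x y, β x = β y → κ (π x) * (κ x)⁻¹ = κ (π y) * (κ y)⁻¹}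
  one_mem' := by simp
  mul_mem' := by
    rintro p q ⟨hp, hp'⟩ ⟨hq, hq'⟩
    refine ⟨fun x y => (hq x y).trans (hp _ _), fun x y hxy => ?_⟩
    have h1 := hq' x y hxy
    have h2 := hp' _ _ ((hq x y).1 hxy)
    calc κ (p (q x)) * (κ x)⁻¹ = (κ (p (q x)) * (κ (q x))⁻¹) * (κ (q x) * (κ x)⁻¹) := by group
      _ = _ := by rw [h1, h2]; simp
  inv_mem' := by
    rintro p ⟨hp, hp'⟩
    have h0 : ∀ x y, β x = β y ↔ β (p⁻¹ x) = β (p⁻¹ y) := fun x y => by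
      rw [hp (p⁻¹ x) (p⁻¹ y)]; simp
    refine ⟨h0, fun x y hxy => ?_⟩
    have h2 := hp' _ _ ((h0 x y).1 hxy)
    have e1 : ∀ x, p (p⁻¹ x) = x := fun x => by simp
    rw [e1, e1] at h2
    have := congrArg (·⁻¹) h2
    simpa using this

/-- Permutations preserving `β`. -/
def FX {X B : Type*} (β : X → B) : Subgroup (Equiv.Perm X) where
  carrier := {π | ∀ x, β (π x) = β x}
  one_mem' := by simp
  mul_mem' := by
    intro p q hp hq x
    exact (hp _).trans (hq x)
  inv_mem' := by
    intro p hp x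
    have := hp (p⁻¹ x)
    simpa using this.symm

theorem comm_FX {X B A : Type*} [CommGroup A] (β : X → B) (κ : X → A) (p q : Equiv.Perm X)
    (hp : p ∈ TT β κ) (hq : q ∈ TT β κ) (hp' : p ∈ FX β) (hq' : q ∈ FX β) :
    cmt p q ∈ FX κ := by
  have key : ∀ z, κ (p (q z)) = κ (q (p z)) := by
    intro z
    have h1 := hp.2 (q z) z (hq' z)
    have h2 := hq.2 (p z) z (hp' z)
    rw [mul_inv_eq_iff_eq_mul] at h1 h2
    rw [h1, h2, mul_comm, mul_comm (κ (p z)), ← mul_assoc, mul_comm _ (κ (p z))]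
  intro x
  have := key (p⁻¹ (q⁻¹ x))
  simpa [cmt] using this

theorem sat_FX {X B A : Type*} [Group A] (β : X → B) (κ : X → A)
    (hinj : ∀ x y, β x = β y → κ x = κ y → x = y) (hA : SatisfiesNontrivialIdentity A) :
    SatisfiesNontrivialIdentity ↥(TT β κ ⊓ FX β) := by
  obtain ⟨k, w, hw, hφ⟩ := hA
  refine ⟨k, w, hw, fun φ => ?_⟩
  apply Subtype.ext
  apply Equiv.ext
  intro x
  let ψ : ↥(TT β κ ⊓ FX β) →* A :=
    { toFun := fun p => κ (p.1 x) * (κ x)⁻¹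
      map_one' := by simp
      map_mul' := by
        intro p q
        have h1 := p.2.1.2 (q.1 x) x (q.2.2 x)
        simp only [Subgroup.coe_mul, Equiv.Perm.mul_apply]
        rw [← h1]; group }
  have h1 := hφ (ψ.comp φ)
  refine hinj _ _ ((φ w).2.2 x) ?_
  exact mul_inv_eq_one.1 h1

/-- Base space: lamp configurations with a cursor. -/
abbrev Om := (ℤ → ℤ) × ℤ
/-- Fibre. -/
abbrev RR (H : Type*) := (ℤ × ℤ) × H
/-- Total space. -/
abbrev XX (H : Type*) := Om × RR H

/-- Move the cursor. -/
def ub : Equiv.Perm Om where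
  toFun x := (x.1, x.2 + 1)
  invFun x := (x.1, x.2 - 1)
  left_inv x := by simp
  right_inv x := by simp

/-- Increase the lamp at the cursor. -/
def vb : Equiv.Perm Om where
  toFun x := (x.1 + Pi.single x.2 1, x.2)
  invFun x := (x.1 - Pi.single x.2 1, x.2)
  left_inv x := by simp
  right_inv x := by simp

section
variable {H : Type*} [Group H]

/-- Shift of the second fibre coordinate. -/
def sg : Equiv.Perm (RR H) where
  toFun x := ((x.1.1, x.1.2 + 1), x.2)
  invFun x := ((x.1.1, x.1.2 - 1), x.2)
  left_inv x := by simp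
  right_inv x := by simp

/-- Shift of the first fibre coordinate, twisted by `h`. -/
def Fh (h : H) : Equiv.Perm (RR H) where
  toFun x := ((x.1.1 + 1, x.1.2), if x.1.1 = -1 ∧ 0 ≤ x.1.2 then h * x.2 else x.2)
  invFun x := ((x.1.1 - 1, x.1.2), if x.1.1 = 0 ∧ 0 ≤ x.1.2 then h⁻¹ * x.2 else x.2)
  left_inv x := by
    obtain ⟨⟨i, j⟩, g⟩ := x
    have : i + 1 = 0 ↔ i = -1 := by omega
    by_cases h1 : i = -1 ∧ 0 ≤ j <;> simp [this, h1]
  right_inv x := by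
    obtain ⟨⟨i, j⟩, g⟩ := x
    have : i - 1 = -1 ↔ i = 0 := by omega
    by_cases h1 : i = 0 ∧ 0 ≤ j <;> simp [this, h1]

/-- Multiplication by `h` over the origin of the fibre. -/
def dl : H →* Equiv.Perm (RR H) where
  toFun h :=
    { toFun := fun x => (x.1, if x.1 = 0 then h * x.2 else x.2)
      invFun := fun x => (x.1, if x.1 = 0 then h⁻¹ * x.2 else x.2)
      left_inv := fun x => by
        by_cases h1 : x.1 = 0 <;> simp [h1] <;> simp [← h1]
      right_inv := fun x => by
        by_cases h1 : x.1 = 0 <;> simp [h1] <;> simp [← h1] }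
  map_one' := by ext x <;> simp
  map_mul' a b := by
    apply Equiv.ext
    intro x
    by_cases h1 : x.1 = 0 <;> simp [h1, mul_assoc]

theorem Fh_comm (h : H) : cmt (Fh h) sg = dl h := by
  have : Fh h * sg = dl h * sg * Fh h := by
    apply Equiv.ext
    rintro ⟨⟨i, j⟩, g⟩
    simp only [Equiv.Perm.mul_apply, Fh, sg, dl, Equiv.coe_fn_mk, MonoidHom.coe_mk, OneHom.coe_mk,
      Prod.mk.injEq, true_and, Prod.mk_eq_zero]
    split_ifs <;> first | rfl | omega
  rw [cmt, this]; group

/-- Action through the base. -/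
def Lb : Equiv.Perm Om →* Equiv.Perm (XX H) where
  toFun b := Equiv.prodCongr b (Equiv.refl _)
  map_one' := by ext x <;> rfl
  map_mul' a b := by ext x <;> rfl

/-- Action through the fibres. -/
def Fb : (Om → Equiv.Perm (RR H)) →* Equiv.Perm (XX H) where
  toFun φ :=
    { toFun := fun x => (x.1, φ x.1 x.2)
      invFun := fun x => (x.1, (φ x.1)⁻¹ x.2)
      left_inv := fun x => by simp
      right_inv := fun x => by simp }
  map_one' := by ext x <;> rfl
  map_mul' a b := by ext x <;> rfl

theorem Lb_apply (b : Equiv.Perm Om) (x : XX H) : Lb b x = (b x.1, x.2) := rfl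
theorem Fb_apply (φ : Om → Equiv.Perm (RR H)) (x : XX H) : Fb φ x = (x.1, φ x.1 x.2) := rfl

theorem Lb_conj (b : Equiv.Perm Om) (φ : Om → Equiv.Perm (RR H)) :
    (Lb b)⁻¹ * Fb φ * Lb b = Fb (fun ω => φ (b ω)) := by
  rw [mul_assoc, inv_mul_eq_iff_eq_mul]
  ext x <;> rfl

open Classical in
/-- The embedding. -/
noncomputable def io : H →* Equiv.Perm (XX H) :=
  Fb.comp ((MonoidHom.mulSingle (fun _ : Om => Equiv.Perm (RR H)) 0).comp dl)

open Classical in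
/-- Generator `s`. -/
noncomputable def ss : Equiv.Perm (XX H) := Fb (Pi.mulSingle 0 sg)

/-- Generator `f`. -/
noncomputable def ff (p : H → Om) : Equiv.Perm (XX H) := Fb (Function.extend p Fh 1)

theorem io_eq (p : H → Om) (hp : Function.Injective p) (h : H) (y : Equiv.Perm Om)
    (hy : y 0 = p h) :
    io h = cmt ((Lb y)⁻¹ * ff p * Lb y) ss := by
  classical
  rw [ff, Lb_conj, ss, cmt]
  simp only [← map_inv, ← map_mul]
  rw [io]
  simp only [MonoidHom.comp_apply]
  congr 1
  funext ω
  by_cases hω : ω = 0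
  · subst hω
    simp [hy, hp.extend_apply, ← Fh_comm, cmt]
  · simp [hω]

theorem io_apply_zero (h : H) : io h ((0, (0, 1)) : XX H) = (0, (0, h)) := by
  simp [io, Fb_apply, dl]

theorem io_injective : Function.Injective (io : H →* Equiv.Perm (XX H)) := by
  intro a b hab
  have := DFunLike.congr_fun hab ((0, (0, 1)) : XX H)
  rw [io_apply_zero, io_apply_zero] at this
  simpa using this

/-- The generating set. -/
def gens (p : H → Om) : Set (Equiv.Perm (XX H)) := {Lb ub, Lb vb, ss, ff p}

/-- The big subgroup. -/
def NN : Subgroup (Equiv.Perm (XX H)) :=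
  TT (fun _ : XX H => ()) (fun x : XX H => Multiplicative.ofAdd x.1.2) ⊓
  TT (fun x : XX H => x.1.2) (fun x : XX H => Multiplicative.ofAdd x.1.1) ⊓
  TT (fun x : XX H => x.1) (fun x : XX H => Multiplicative.ofAdd x.2.1) ⊓
  TT (fun x : XX H => (x.1, x.2.1)) (fun x : XX H => x.2.2)

theorem mem_NN (π : Equiv.Perm (XX H)) : π ∈ NN ↔
    π ∈ TT (fun _ : XX H => ()) (fun x : XX H => Multiplicative.ofAdd x.1.2) ∧
    π ∈ TT (fun x : XX H => x.1.2) (fun x : XX H => Multiplicative.ofAdd x.1.1) ∧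
    π ∈ TT (fun x : XX H => x.1) (fun x : XX H => Multiplicative.ofAdd x.2.1) ∧
    π ∈ TT (fun x : XX H => (x.1, x.2.1)) (fun x : XX H => x.2.2) := by
  simp only [NN, Subgroup.mem_inf, and_assoc]

theorem mem_TT {X B A : Type*} [Group A] (β : X → B) (κ : X → A) (π : Equiv.Perm X) :
  π ∈ TT β κ ↔ (∀ x y, β x = β y ↔ β (π x) = β (π y)) ∧
    ∀ x y, β x = β y → κ (π x) * (κ x)⁻¹ = κ (π y) * (κ y)⁻¹ := Iff.rfl

theorem sat_NN (hH : SatisfiesNontrivialIdentity H) :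
    SatisfiesNontrivialIdentity ↥(NN : Subgroup (Equiv.Perm (XX H))) := by
  have hc : ∀ (K : Subgroup (Equiv.Perm (XX H))) x y, x ∈ K → y ∈ K → cmt x y ∈ K :=
    fun K x y hx hy => K.mul_mem (K.mul_mem (K.mul_mem hx hy) (K.inv_mem hx)) (K.inv_mem hy)
  let N1 : Subgroup (Equiv.Perm (XX H)) := NN ⊓ FX (fun x : XX H => x.1.2)
  let N2 : Subgroup (Equiv.Perm (XX H)) := N1 ⊓ FX (fun x : XX H => x.1.1)
  let N3 : Subgroup (Equiv.Perm (XX H)) := N2 ⊓ FX (fun x : XX H => x.2.1)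
  apply sat_of_commutator _ N1
  · intro x hx y hy
    have hx' := (mem_NN x).1 hx
    have hy' := (mem_NN y).1 hy
    refine Subgroup.mem_inf.2 ⟨hc _ _ _ hx hy, fun z => ?_⟩
    exact Multiplicative.ofAdd.injective
      (comm_FX _ _ x y hx'.1 hy'.1 (fun _ => rfl) (fun _ => rfl) z)
  apply sat_of_commutator _ N2
  · intro x hx y hy
    obtain ⟨hx1, hx2⟩ := Subgroup.mem_inf.1 hx
    obtain ⟨hy1, hy2⟩ := Subgroup.mem_inf.1 hy
    have hx' := (mem_NN x).1 hx1
    have hy' := (mem_NN y).1 hy1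
    refine Subgroup.mem_inf.2 ⟨hc _ _ _ hx hy, fun z => ?_⟩
    exact Multiplicative.ofAdd.injective (comm_FX _ _ x y hx'.2.1 hy'.2.1 hx2 hy2 z)
  apply sat_of_commutator _ N3
  · intro x hx y hy
    obtain ⟨hx0, hx3⟩ := Subgroup.mem_inf.1 hx
    obtain ⟨hy0, hy3⟩ := Subgroup.mem_inf.1 hy
    obtain ⟨hx1, hx2⟩ := Subgroup.mem_inf.1 hx0
    obtain ⟨hy1, hy2⟩ := Subgroup.mem_inf.1 hy0
    have hx' := (mem_NN x).1 hx1
    have hy' := (mem_NN y).1 hy1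
    refine Subgroup.mem_inf.2 ⟨hc _ _ _ hx hy, fun z => ?_⟩
    exact Multiplicative.ofAdd.injective (comm_FX _ _ x y hx'.2.2.1 hy'.2.2.1
      (fun z => Prod.ext (hx3 z) (hx2 z)) (fun z => Prod.ext (hy3 z) (hy2 z)) z)
  refine sat_mono _ _ ?_ (sat_FX (fun x : XX H => (x.1, x.2.1)) (fun x : XX H => x.2.2) ?_ hH)
  · intro x hx
    obtain ⟨hx0, hx4⟩ := Subgroup.mem_inf.1 hx
    obtain ⟨hx0, hx3⟩ := Subgroup.mem_inf.1 hx0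
    obtain ⟨hx1, hx2⟩ := Subgroup.mem_inf.1 hx0
    have hx' := (mem_NN x).1 hx1
    exact Subgroup.mem_inf.2 ⟨hx'.2.2.2, fun z => Prod.ext (Prod.ext (hx3 z) (hx2 z)) (hx4 z)⟩
  · rintro ⟨a, b, c⟩ ⟨a', b', c'⟩ h1 h2
    simp_all

theorem gens_le (p : H → Om) (hp : Function.Injective p) : gens p ⊆ (NN : Subgroup (Equiv.Perm (XX H))) := by
  classical
  rintro x (rfl | rfl | rfl | rfl)
  · refine (mem_NN _).2 ⟨?_, ?_, ?_, ?_⟩ <;> rw [mem_TT] <;> simp [Lb_apply, ub]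
  · refine (mem_NN _).2 ⟨?_, ?_, ?_, ?_⟩ <;> rw [mem_TT] <;> simp +contextual [Lb_apply, vb, ← ofAdd_add, ← ofAdd_neg]
  · have e0 : ∀ x : XX H, (ss x) = (x.1, ((x.2.1.1, x.2.1.2 + if x.1 = 0 then 1 else 0), x.2.2)) := by
      intro x
      by_cases h : x.1 = 0
      · simp [ss, Fb_apply, h, sg]
      · simp [ss, Fb_apply, h]
    refine (mem_NN _).2 ⟨?_, ?_, ?_, ?_⟩ <;> rw [mem_TT]
    · simp [e0]
    · simp [e0]
    · simp +contextual [e0, ← ofAdd_neg, ← ofAdd_add]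
    · simp +contextual [e0, Prod.ext_iff]
  · have e0 : ∀ x : XX H, ff p x = (x.1, ((x.2.1.1 + if x.1 ∈ Set.range p then 1 else 0, x.2.1.2), 
        (if x.2.1.1 = -1 ∧ 0 ≤ x.2.1.2 then Function.extend p id 1 x.1 else 1) * x.2.2)) := by
      intro x
      by_cases h : x.1 ∈ Set.range p
      · obtain ⟨h', hh⟩ := h
        simp [ff, Fb_apply, ← hh, hp.extend_apply, Fh]
      · rw [Set.mem_range] at h
        simp [ff, Fb_apply, h]
    refine (mem_NN _).2 ⟨?_, ?_, ?_, ?_⟩ <;> rw [mem_TT]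
    · simp [e0]
    · simp [e0]
    · simp +contextual [e0, ← ofAdd_neg, ← ofAdd_add]
    · constructor
      · intro x y
        simp only [e0, Prod.ext_iff]
        grind
      · intro x y hxy
        simp only [Prod.mk.injEq] at hxy
        simp [e0, hxy.1, hxy.2]
end

theorem exists_code {H : Type*} [Group H] (ℓ : H → ℕ) (hℓ : IsLengthFunction ℓ) (a : ℕ)
    (ha : ∀ n : ℕ, {h : H | ℓ h ≤ n}.Finite ∧ Nat.card {h : H | ℓ h ≤ n} ≤ a ^ n) :
    ∃ d : H → ℤ → ℕ, (∀ h q, d h q ≠ 0 → (ℓ h : ℤ) ≤ q ∧ q < 2 * ℓ h) ∧ (∀ h q, d h q ≤ a) ∧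
      ∀ h h', h ≠ h' → ∃ q : ℤ, (ℓ h : ℤ) ≤ q ∧ (ℓ h' : ℤ) ≤ q ∧ d h q ≠ d h' q := by
  have hE : ∀ n, ∃ E : H → ℕ → ℕ, (∀ h i, ℓ h = n → i < n → E h i < a) ∧
      ∀ h h', ℓ h = n → ℓ h' = n → (∀ i < n, E h i = E h' i) → h = h' := by
    intro n
    classical
    obtain ⟨hf, hc⟩ := ha n
    haveI := hf.fintype
    have hne : Nonempty ({h : H | ℓ h ≤ n} ↪ (Fin n → Fin a)) := by
      apply Function.Embedding.nonempty_of_card_le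
      rw [Nat.card_eq_fintype_card] at hc
      simpa using hc
    obtain ⟨e⟩ := hne
    refine ⟨fun h i => if hh : ℓ h ≤ n ∧ i < n then (e ⟨h, hh.1⟩ ⟨i, hh.2⟩ : ℕ) else 0, ?_, ?_⟩
    · intro h i h1 h2
      have : ℓ h ≤ n ∧ i < n := ⟨h1.le, h2⟩
      simp [this]
    · intro h h' h1 h2 h3
      have : (⟨h, h1.le⟩ : {h : H | ℓ h ≤ n}) = ⟨h', h2.le⟩ := by
        apply e.injective
        funext i
        have := h3 i i.2
        simp only [h1.le, h2.le, i.2, and_self, dite_true] at this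
        exact Fin.ext this
      simpa using this
  choose E hE1 hE2 using hE
  refine ⟨fun h q => if (ℓ h : ℤ) ≤ q ∧ q < 2 * ℓ h then E (ℓ h) h (q - ℓ h).toNat + 1 else 0,
    ?_, ?_, ?_⟩
  · intro h q hq
    by_contra hcon
    simp [hcon] at hq
  · intro h q
    dsimp only
    split_ifs with hq
    · exact hE1 _ _ _ rfl (by omega)
    · omega
  · have aux : ∀ h h', ℓ h < ℓ h' → ∃ q : ℤ, (ℓ h : ℤ) ≤ q ∧ (ℓ h' : ℤ) ≤ q ∧
        (if (ℓ h : ℤ) ≤ q ∧ q < 2 * ℓ h then E (ℓ h) h (q - ℓ h).toNat + 1 else 0) ≠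
        (if (ℓ h' : ℤ) ≤ q ∧ q < 2 * ℓ h' then E (ℓ h') h' (q - ℓ h').toNat + 1 else 0) := by
      intro h h' hlt
      refine ⟨2 * ℓ h' - 1, by omega, by omega, ?_⟩
      rw [if_neg (by omega), if_pos (by omega)]
      omega
    intro h h' hne
    rcases lt_trichotomy (ℓ h) (ℓ h') with hlt | heq | hlt
    · exact aux h h' hlt
    · by_contra hcon
      push Not at hcon
      apply hne
      apply hE2 (ℓ h) h h' rfl heq.symm
      intro i hi
      have := hcon (ℓ h + i) (by omega) (by omega)
      rw [if_pos (by omega), if_pos (by omega)] at this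
      rw [← heq] at this
      simpa using this
    · obtain ⟨q, h1, h2, h3⟩ := aux h' h hlt
      exact ⟨q, h2, h1, h3.symm⟩

section
variable {H : Type*} [Group H]

/-- The marked points. -/
def pt (d : H → ℤ → ℕ) (h : H) : Om := (fun q => (d h q : ℤ), 0)

/-- The label offset at a marked point. -/
def AA (h : H) (z : ℤ × ℤ) : H := if 0 ≤ z.1 ∧ 0 ≤ z.2 then h else 1

/-- The invariant of the lower bound. -/
def IV (ℓ : H → ℕ) (d : H → ℤ → ℕ) (n : ℕ) (x : XX H) : Prop :=
  ∃ (h : H) (r : ℕ), |x.1.2| ≤ r ∧ (∀ q, x.1.1 q ≠ d h q → |q - x.1.2| + |q| ≤ r) ∧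
    ℓ ((AA h x.2.1)⁻¹ * x.2.2) + r ≤ n

variable (ℓ : H → ℕ) (hℓ : IsLengthFunction ℓ) (d : H → ℤ → ℕ)
  (hd : ∀ h h', h ≠ h' → ∃ q : ℤ, (ℓ h : ℤ) ≤ q ∧ (ℓ h' : ℤ) ≤ q ∧ d h q ≠ d h' q)

theorem Inv_mono {n : ℕ} {x : XX H} (h : IV ℓ d n x) : IV ℓ d (n + 1) x := by
  obtain ⟨h, r, h1, h2, h3⟩ := h
  exact ⟨h, r, h1, h2, by omega⟩

theorem Inv_pt {n : ℕ} {h : H} {z : ℤ × ℤ} {g : H} (hle : ℓ ((AA h z)⁻¹ * g) ≤ n) :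
    IV ℓ d n (pt d h, (z, g)) :=
  ⟨h, 0, by simp [pt], by simp [pt], by simpa using hle⟩

include hℓ in
theorem AA_le (h : H) (z : ℤ × ℤ) : ℓ (AA h z) ≤ ℓ h := by
  unfold AA
  split_ifs
  · exact le_rfl
  · rw [(hℓ.1 1).2 rfl]; omega

include hℓ hd in
theorem Inv_switch {n : ℕ} {h : H} {z : ℤ × ℤ} {g : H} (hi : IV ℓ d n (pt d h, (z, g))) :
    ℓ ((AA h z)⁻¹ * g) ≤ n := by
  obtain ⟨h', r, h1, h2, h3⟩ := hi
  by_cases hh : h = h'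
  · subst hh
    dsimp only at h3
    omega
  · obtain ⟨q, q1, q2, q3⟩ := hd h h' hh
    have h4 := h2 q (by simpa [pt] using q3)
    simp only [pt, sub_zero] at h4
    have h5 : q ≤ |q| := le_abs_self q
    have e : (AA h z)⁻¹ * g = (AA h z)⁻¹ * (AA h' z * ((AA h' z)⁻¹ * g)) := by group
    have h6 := hℓ.2.2 (AA h z)⁻¹ (AA h' z * ((AA h' z)⁻¹ * g))
    have h7 := hℓ.2.2 (AA h' z) ((AA h' z)⁻¹ * g)
    rw [hℓ.2.1] at h6
    have h8 := AA_le ℓ hℓ h z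
    have h9 := AA_le ℓ hℓ h' z
    rw [e]
    dsimp only at h3
    omega

theorem AA_Fh (h : H) (x : RR H) : (AA h (Fh h x).1)⁻¹ * (Fh h x).2 = (AA h x.1)⁻¹ * x.2 := by
  obtain ⟨⟨i, j⟩, g⟩ := x
  simp only [Fh, AA, Equiv.coe_fn_mk]
  split_ifs <;> first | omega | simp

theorem pt_inj (hd : ∀ h h', h ≠ h' → ∃ q : ℤ, (ℓ h : ℤ) ≤ q ∧ (ℓ h' : ℤ) ≤ q ∧ d h q ≠ d h' q) :
    Function.Injective (pt d) := by
  intro h h' e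
  by_contra hne
  obtain ⟨q, _, _, q3⟩ := hd h h' hne
  have := congrFun (congrArg Prod.fst e) q
  simp only [pt] at this
  exact q3 (by exact_mod_cast this)

include hℓ hd in
theorem Inv_step (h1 : pt d (1 : H) = 0) (n : ℕ) (x : XX H) (hx : IV ℓ d n x)
    (y : Equiv.Perm (XX H)) (hy : y ∈ gens (pt d) ∨ y⁻¹ ∈ gens (pt d)) :
    IV ℓ d (n + 1) (y x) := by
  classical
  have key_u : ∀ (ω : Om) (z : RR H) (e : ℤ), |e| = 1 → IV ℓ d n (ω, z) →
      IV ℓ d (n + 1) ((ω.1, ω.2 + e), z) := by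
    rintro ω z e he ⟨h, r, i1, i2, i3⟩
    refine ⟨h, r + 1, ?_, ?_, ?_⟩
    · have := abs_add_le ω.2 e
      dsimp only at i1 ⊢
      push_cast; omega
    · intro q hq
      have := i2 q hq
      have h2 := abs_add_le (q - ω.2) (-e)
      rw [abs_neg, he] at h2
      dsimp only at this ⊢
      rw [show q - (ω.2 + e) = q - ω.2 + -e by ring]
      push_cast; omega
    · dsimp only at i3 ⊢
      omega
  have key_v : ∀ (ω : Om) (z : RR H) (e : ℤ), IV ℓ d n (ω, z) →
      IV ℓ d (n + 1) ((ω.1 + Pi.single ω.2 e, ω.2), z) := by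
    rintro ω z e ⟨h, r, i1, i2, i3⟩
    refine ⟨h, r, i1, ?_, ?_⟩
    · intro q hq
      by_cases hqk : q = ω.2
      · subst hqk
        simpa using i1
      · apply i2
        simpa [hqk] using hq
    · dsimp only at i3 ⊢
      omega
  have key_s : ∀ (z : RR H) (j : ℤ), IV ℓ d n (0, z) →
      IV ℓ d (n + 1) (0, ((z.1.1, j), z.2)) := by
    rintro ⟨z, g⟩ j hi
    rw [← h1] at hi ⊢
    have := Inv_switch ℓ hℓ d hd hi
    apply Inv_mono
    apply Inv_pt
    simpa [AA] using this
  have key_f : ∀ (h : H) (z z' : RR H), (AA h z.1)⁻¹ * z.2 = (AA h z'.1)⁻¹ * z'.2 →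
      IV ℓ d n (pt d h, z) → IV ℓ d (n + 1) (pt d h, z') := by
    rintro h ⟨z, g⟩ ⟨z', g'⟩ e hi
    have := Inv_switch ℓ hℓ d hd hi
    apply Inv_mono
    apply Inv_pt
    dsimp only at e
    rwa [← e]
  have hinj := pt_inj ℓ d hd
  obtain ⟨ω, z⟩ := x
  rcases hy with hy | hy
  · rcases hy with rfl | rfl | rfl | rfl
    · exact key_u ω z 1 (by simp) hx
    · exact key_v ω z 1 hx
    · by_cases h0 : ω = 0
      · subst h0
        have := key_s z (z.1.2 + 1) hx
        simpa [ss, Fb_apply, sg] using this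
      · have := Inv_mono ℓ d hx
        simpa [ss, Fb_apply, h0] using this
    · by_cases h0 : ∃ h, pt d h = ω
      · obtain ⟨h, rfl⟩ := h0
        have := key_f h z (Fh h z) (AA_Fh h z).symm hx
        simpa [ff, Fb_apply, hinj.extend_apply] using this
      · have := Inv_mono ℓ d hx
        simpa [ff, Fb_apply, h0] using this
  · obtain ⟨w, rfl⟩ : ∃ w, y = w⁻¹ := ⟨y⁻¹, by simp⟩
    rw [inv_inv] at hy
    rcases hy with rfl | rfl | rfl | rfl
    · rw [← map_inv]
      exact key_u ω z (-1) (by simp) hx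
    · rw [← map_inv]
      have := key_v ω z (-1) hx
      rw [Pi.single_neg, ← sub_eq_add_neg] at this
      exact this
    · rw [ss, ← map_inv]
      by_cases h0 : ω = 0
      · subst h0
        have := key_s z (z.1.2 - 1) hx
        rw [Fb_apply]
        simp only [Pi.inv_apply, Pi.mulSingle_eq_same]
        exact this
      · have := Inv_mono ℓ d hx
        rw [Fb_apply]
        simpa [h0] using this
    · rw [ff, ← map_inv]
      by_cases h0 : ∃ h, pt d h = ω
      · obtain ⟨h, rfl⟩ := h0
        have := key_f h z ((Fh h)⁻¹ z) (by have := AA_Fh h ((Fh h)⁻¹ z); simpa using this) hx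
        rw [Fb_apply]
        simpa [hinj.extend_apply] using this
      · have := Inv_mono ℓ d hx
        rw [Fb_apply]
        simpa [h0] using this

include hℓ hd in
theorem lower (h1 : pt d (1 : H) = 0) (h : H) (l : List (Equiv.Perm (XX H)))
    (hl : ∀ x ∈ l, x ∈ gens (pt d) ∨ x⁻¹ ∈ gens (pt d)) (hp : l.prod = io h) :
    ℓ h ≤ l.length := by
  have h0 : ∀ l : List (Equiv.Perm (XX H)), (∀ x ∈ l, x ∈ gens (pt d) ∨ x⁻¹ ∈ gens (pt d)) →
      IV ℓ d l.length (l.prod (0, (0, 1))) := by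
    intro l
    induction l with
    | nil =>
      intro _
      rw [← h1]
      apply Inv_pt
      simp [AA, (hℓ.1 1).2 rfl]
    | cons x l ih =>
      intro hl
      rw [List.prod_cons, Equiv.Perm.mul_apply, List.length_cons]
      exact Inv_step ℓ hℓ d hd h1 _ _ (ih fun y hy => hl y (by simp [hy])) x (hl x (by simp))
  have h2 := h0 l hl
  rw [hp, io_apply_zero, ← h1] at h2
  have := Inv_switch ℓ hℓ d hd h2
  simpa [AA] using this
end

/-- `g` is a product of at most `m` letters. -/
def WW {Γ : Type*} [Group Γ] (S : Set Γ) (m : ℕ) (g : Γ) : Prop :=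
  ∃ l : List Γ, l.length ≤ m ∧ (∀ x ∈ l, x ∈ S ∨ x⁻¹ ∈ S) ∧ l.prod = g

section
variable {Γ : Type*} [Group Γ] {S : Set Γ}

theorem WW.mul {m n : ℕ} {g h : Γ} (hg : WW S m g) (hh : WW S n h) : WW S (m + n) (g * h) := by
  obtain ⟨l, a1, a2, rfl⟩ := hg
  obtain ⟨l', b1, b2, rfl⟩ := hh
  refine ⟨l ++ l', by simp; omega, ?_, by simp⟩
  intro x hx
  rcases List.mem_append.1 hx with hx | hx
  · exact a2 x hx
  · exact b2 x hx

theorem WW.inv {m : ℕ} {g : Γ} (hg : WW S m g) : WW S m g⁻¹ := by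
  obtain ⟨l, a1, a2, rfl⟩ := hg
  refine ⟨(l.map (·⁻¹)).reverse, by simpa using a1, ?_, by rw [List.prod_inv_reverse]⟩
  intro x hx
  simp only [List.mem_reverse, List.mem_map] at hx
  obtain ⟨y, hy, rfl⟩ := hx
  rw [inv_inv]
  exact (a2 y hy).symm

theorem WW.one : WW S 0 (1 : Γ) := ⟨[], by simp⟩

theorem WW.gen {g : Γ} (hg : g ∈ S) : WW S 1 g := ⟨[g], by simp [hg]⟩

theorem WW.mono {m n : ℕ} {g : Γ} (hg : WW S m g) (h : m ≤ n) : WW S n g := by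
  obtain ⟨l, a1, a2⟩ := hg
  exact ⟨l, a1.trans h, a2⟩

theorem WW.pow {m : ℕ} {g : Γ} (hg : WW S m g) (n : ℕ) : WW S (n * m) (g ^ n) := by
  induction n with
  | zero => simpa using WW.one
  | succ n ih =>
    rw [pow_succ]
    exact (ih.mul hg).mono (by ring_nf; rfl)
end

/-- The walk writing the configuration `c`. -/
def qq (c : ℤ → ℕ) : ℕ → Equiv.Perm Om
  | 0 => 1
  | m + 1 => ub * vb ^ (c m) * qq c m

theorem vb_pow (n : ℕ) (x : Om) : (vb ^ n) x = (x.1 + Pi.single x.2 (n : ℤ), x.2) := by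
  induction n with
  | zero => simp
  | succ n ih =>
    rw [pow_succ', Equiv.Perm.mul_apply, ih]
    simp [vb, Pi.single_add, add_assoc]

theorem ub_pow (n : ℕ) (x : Om) : (ub ^ n) x = (x.1, x.2 + n) := by
  induction n with
  | zero => simp
  | succ n ih =>
    rw [pow_succ', Equiv.Perm.mul_apply, ih]
    simp [ub, add_assoc]

theorem qq_zero (c : ℤ → ℕ) (m : ℕ) :
    qq c m 0 = (fun q : ℤ => if 0 ≤ q ∧ q < m then (c q : ℤ) else 0, (m : ℤ)) := by
  induction m with
  | zero =>
    simp only [qq, Equiv.Perm.one_apply]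
    refine Prod.ext (funext fun q => ?_) ?_
    · simp; try omega
    · simp
  | succ m ih =>
    rw [qq, Equiv.Perm.mul_apply, Equiv.Perm.mul_apply, ih, vb_pow]
    simp only [ub, Equiv.coe_fn_mk]
    refine Prod.ext (funext fun q => ?_) ?_
    · by_cases hq : q = m
      · subst hq
        simp
      · simp only [Pi.add_apply, Pi.single_apply, hq, if_false, add_zero]
        have : (0 ≤ q ∧ q < m) ↔ (0 ≤ q ∧ q < ((m + 1 : ℕ) : ℤ)) := by push_cast; omega
        simp only [this]
    · simp

theorem upper {H : Type*} [Group H] (ℓ : H → ℕ) (hℓ : IsLengthFunction ℓ) (d : H → ℤ → ℕ) (a : ℕ)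
    (hd1 : ∀ h q, d h q ≠ 0 → (ℓ h : ℤ) ≤ q ∧ q < 2 * ℓ h) (hd2 : ∀ h q, d h q ≤ a)
    (hinj : Function.Injective (pt d)) (h : H) :
    WW (gens (pt d)) ((8 * a + 20) * ℓ h) (io h) := by
  by_cases h1 : h = 1
  · subst h1
    rw [map_one]
    exact WW.one.mono (Nat.zero_le _)
  have hpos : 1 ≤ ℓ h := by
    have := (hℓ.1 h).not.2 h1
    omega
  set N := 2 * ℓ h with hN
  let y : Equiv.Perm Om := (ub ^ N)⁻¹ * qq (d h) N
  have hy : y 0 = pt d h := by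
    simp only [y, Equiv.Perm.mul_apply, qq_zero]
    rw [Equiv.Perm.inv_eq_iff_eq, ub_pow]
    refine Prod.ext (funext fun q => ?_) ?_
    · simp only [pt]
      by_cases hq : d h q = 0
      · simp [hq]
      · have := hd1 h q hq
        rw [if_pos (by omega)]
    · simp [pt]
  have hu : WW (gens (pt d)) 1 (Lb ub) := WW.gen (by simp [gens])
  have hv : WW (gens (pt d)) 1 (Lb vb) := WW.gen (by simp [gens])
  have hs : WW (gens (pt d)) 1 (ss) := WW.gen (by simp [gens])
  have hf : WW (gens (pt d)) 1 (ff (pt d)) := WW.gen (by simp [gens])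
  have hq : ∀ m : ℕ, WW (gens (pt d)) (m * (1 + a)) (Lb (qq (d h) m)) := by
    intro m
    induction m with
    | zero => simpa [qq] using WW.one
    | succ m ih =>
      rw [qq, map_mul, map_mul, map_pow]
      refine ((hu.mul (hv.pow _)).mul ih).mono ?_
      have := hd2 h m
      rw [Nat.succ_mul]
      omega
  have hyW : WW (gens (pt d)) (N + N * (1 + a)) (Lb y) := by
    simp only [y, map_mul, map_inv, map_pow]
    refine ((hu.pow N).inv.mul (hq N)).mono (by simp)
  rw [io_eq (pt d) hinj h y hy, cmt]
  have hF := (hyW.inv.mul hf).mul hyW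
  refine (((hF.mul hs).mul hF.inv).mul hs.inv).mono ?_
  rw [hN]
  nlinarith

theorem identity_embedding_theorem {H : Type} [Group H] (ℓ : H → ℕ)
    (hℓ : IsLengthFunction ℓ) (hgrowth : AtMostExponentialGrowth ℓ)
    (hid : SatisfiesNontrivialIdentity H) :
    ∃ (G : Type) (instG : Group G) (X : Finset G) (ι : H →* G) (c : ℝ),
      SatisfiesNontrivialIdentity G ∧
      Subgroup.closure (X : Set G) = ⊤ ∧
      Function.Injective ι ∧ 0 < c ∧
      ∀ h : H, c * (wordLength (X : Set G) (ι h) : ℝ) ≤ (ℓ h : ℝ) ∧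
        ℓ h ≤ wordLength (X : Set G) (ι h) := by
  classical
  obtain ⟨a, ha⟩ := hgrowth
  obtain ⟨d, hd1, hd2, hd⟩ := exists_code ℓ hℓ a ha
  have hinj := pt_inj ℓ d hd
  have h1 : pt d (1 : H) = 0 := by
    refine Prod.ext (funext fun q => ?_) ?_
    · by_contra hq
      have := hd1 1 q (by intro h0; apply hq; simp [pt, h0])
      rw [(hℓ.1 1).2 rfl] at this
      simp at this
      omega
    · rfl
  let S := gens (pt d)
  let G := Subgroup.closure S
  have hS : S.Finite := by simp [S, gens]
  let T : Set G := (Subtype.val : G → _) ⁻¹' S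
  have hT : T.Finite := hS.preimage Subtype.val_injective.injOn
  have hup := upper ℓ hℓ d a hd1 hd2 hinj
  have hmem : ∀ x, x ∈ S ∨ x⁻¹ ∈ S → x ∈ G := by
    rintro x (hx | hx)
    · exact Subgroup.subset_closure hx
    · exact (Subgroup.inv_mem_iff _).1 (Subgroup.subset_closure hx)
  have hioG : ∀ h, io h ∈ G := by
    intro h
    obtain ⟨l, -, l2, l3⟩ := hup h
    rw [← l3]
    exact Subgroup.list_prod_mem _ fun x hx => hmem x (l2 x hx)
  let ι : H →* G := io.codRestrict G hioG
  have hset : ∀ h, ∃ l : List G, l.length ≤ (8 * a + 20) * ℓ h ∧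
      (∀ x ∈ l, x ∈ T ∨ x⁻¹ ∈ T) ∧ l.prod = ι h := by
    intro h
    obtain ⟨l, l1, l2, l3⟩ := hup h
    lift l to List G using fun x hx => hmem x (l2 x hx)
    refine ⟨l, by simpa using l1, ?_, ?_⟩
    · intro x hx
      exact l2 x.1 (List.mem_map.2 ⟨x, hx, rfl⟩)
    · apply Subtype.ext
      rw [← Subgroup.subtype_apply, map_list_prod]
      exact l3
  refine ⟨G, inferInstance, hT.toFinset, ι, ((8 * a + 20 : ℕ) : ℝ)⁻¹, ?_, ?_, ?_, by positivity, ?_⟩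
  · exact sat_mono _ _ ((Subgroup.closure_le _).2 (gens_le _ hinj)) (sat_NN hid)
  · rw [Set.Finite.coe_toFinset]
    exact Subgroup.closure_closure_coe_preimage
  · intro x y hxy
    exact io_injective (congrArg Subtype.val hxy)
  · intro h
    rw [Set.Finite.coe_toFinset]
    obtain ⟨l, l1, l2, l3⟩ := hset h
    constructor
    · have : wordLength T (ι h) ≤ (8 * a + 20) * ℓ h :=
        le_trans (Nat.sInf_le (show _ ∈ {n | ∃ l : List G, l.length = n ∧
          (∀ x ∈ l, x ∈ T ∨ x⁻¹ ∈ T) ∧ l.prod = ι h} from ⟨l, rfl, l2, l3⟩)) l1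
      rw [inv_mul_le_iff₀ (by positivity)]
      exact_mod_cast this
    · obtain ⟨l', m1, m2, m3⟩ := Nat.sInf_mem
        (s := {n | ∃ l : List G, l.length = n ∧ (∀ x ∈ l, x ∈ T ∨ x⁻¹ ∈ T) ∧ l.prod = ι h})
        ⟨_, l, rfl, l2, l3⟩
      have := lower ℓ hℓ d hd h1 h (l'.map Subtype.val) (by
        intro x hx
        obtain ⟨y, hy, rfl⟩ := List.mem_map.1 hx
        exact m2 y hy) (by
        have := congrArg G.subtype m3
        rw [map_list_prod] at this
        exact this)
      rw [List.length_map, m1] at this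
      exact this
end

section
/- Every countable amenable group H embeds (as a subgroup) into a finitely generated amenable group G. -/
open Filter
open scoped symmDiff

open scoped Classical in
/-- A group is amenable in the Følner sense: there is a sequence of non-empty finite subsets
`F n` such that for every `g`, `|g F_n △ F_n| / |F_n| → 0`. -/
def HasFolnerSequence (G : Type*) [Group G] : Prop :=
  ∃ F : ℕ → Finset G, (∀ n, (F n).Nonempty) ∧
    ∀ g : G, Tendsto
      (fun n => (((F n).image (g * ·) ∆ (F n)).card : ℝ) / ((F n).card : ℝ))
      atTop (nhds 0)

universe u

open scoped Classical in
/-- number of points of `F` moved out of `F` -/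
noncomputable def bad {G : Type*} [Group G] (s : G) (F : Finset G) : ℕ :=
  (F.filter (fun x => s * x ∉ F)).card

/-- local Folner condition -/
def Fol (G : Type*) [Group G] : Prop :=
  ∀ (S : Finset G) (ε : ℝ), 0 < ε → ∃ F : Finset G, F.Nonempty ∧
    ∀ s ∈ S, (bad s F : ℝ) ≤ ε * F.card

open scoped Classical in
theorem symmDiff_card_eq {G : Type*} [Group G] (s : G) (F : Finset G) :
    (((F.image (s * ·)) ∆ F).card) = 2 * bad s F := by
  have hc : (F.image (s * ·)).card = F.card :=
    Finset.card_image_of_injective _ (mul_right_injective s)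
  have h1 : (F.image (s * ·) \ F).card = bad s F := by
    have : F.image (s * ·) \ F = (F.filter (fun x => s * x ∉ F)).image (s * ·) := by
      ext y
      simp only [Finset.mem_sdiff, Finset.mem_image, Finset.mem_filter]
      constructor
      · rintro ⟨⟨x, hx, rfl⟩, h⟩
        exact ⟨x, ⟨hx, h⟩, rfl⟩
      · rintro ⟨x, ⟨hx, h⟩, rfl⟩
        exact ⟨⟨x, hx, rfl⟩, h⟩
    rw [this, Finset.card_image_of_injective _ (mul_right_injective s), bad]
  have h2 : (F \ F.image (s * ·)).card = (F.image (s * ·) \ F).card :=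
    (Finset.card_sdiff_comm hc).symm
  have : (F.image (s * ·)) ∆ F = (F.image (s * ·) \ F) ∪ (F \ F.image (s * ·)) := rfl
  rw [this, Finset.card_union_of_disjoint, h2, h1]
  · ring
  · exact disjoint_sdiff_sdiff

theorem Fol.of_folner {G : Type*} [Group G] (h : HasFolnerSequence G) : Fol G := by
  classical
  obtain ⟨F, hF, hl⟩ := h
  intro S ε hε
  have : ∀ᶠ n in atTop, ∀ s ∈ S, (bad s (F n) : ℝ) ≤ ε * (F n).card := by
    rw [Filter.eventually_all_finset]
    intro s _
    filter_upwards [(hl s).eventually (gt_mem_nhds hε)] with n hn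
    have hpos : (0 : ℝ) < (F n).card := by exact_mod_cast (hF n).card_pos
    have e := symmDiff_card_eq s (F n)
    rw [div_lt_iff₀ hpos] at hn
    have e' : ((((F n).image (s * ·)) ∆ (F n)).card : ℝ) = 2 * (bad s (F n) : ℝ) := by
      exact_mod_cast e
    have h0 : (0 : ℝ) ≤ bad s (F n) := by positivity
    have : 2 * (bad s (F n) : ℝ) < ε * (F n).card := by
      rw [← e']; convert hn
    linarith
  obtain ⟨n, hn⟩ := this.exists
  exact ⟨F n, hF n, hn⟩

theorem Fol.folner {G : Type*} [Group G] [Countable G] (h : Fol G) : HasFolnerSequence G := by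
  classical
  obtain ⟨e, he⟩ := exists_surjective_nat G
  choose F hF hb using fun n : ℕ => h ((Finset.range (n+1)).image e) (1 / (n+1)) (by positivity)
  refine ⟨F, hF, fun g => ?_⟩
  obtain ⟨m, rfl⟩ := he g
  have hlim : Tendsto (fun n : ℕ => 2 * (1 / ((n : ℝ) + 1))) atTop (nhds 0) := by
    simpa using (tendsto_one_div_add_atTop_nhds_zero_nat (𝕜 := ℝ)).const_mul 2
  refine tendsto_of_tendsto_of_tendsto_of_le_of_le' tendsto_const_nhds hlim
    (Eventually.of_forall fun n => by positivity) ?_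
  filter_upwards [eventually_ge_atTop m] with n hn
  have hpos : (0 : ℝ) < (F n).card := by exact_mod_cast (hF n).card_pos
  have h1 := hb n (e m) (Finset.mem_image_of_mem _ (by simp; omega))
  have e' : ((((F n).image (e m * ·)) ∆ (F n)).card : ℝ) = 2 * (bad (e m) (F n) : ℝ) := by
    exact_mod_cast symmDiff_card_eq (e m) (F n)
  rw [div_le_iff₀ hpos]
  have : (2 * (bad (e m) (F n) : ℝ)) ≤ 2 * (1 / ((n : ℝ) + 1)) * (F n).card := by linarith
  rw [← e'] at this
  convert this

theorem Fol.of_injective {G Q : Type*} [Group G] [Group Q] (φ : G →* Q)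
    (hφ : Function.Injective φ) (h : Fol Q) : Fol G := by
  classical
  intro S ε hε
  obtain ⟨F, hF, hb⟩ := h (S.image φ) (ε / (S.card + 1)) (by positivity)
  let st := QuotientGroup.rightRel φ.range
  let r : Q → Quotient st := fun x => Quotient.mk st x
  have hr : ∀ g x, r (φ g * x) = r x := by
    intro g x
    refine Quotient.sound ?_
    change QuotientGroup.rightRel φ.range _ _
    rw [QuotientGroup.rightRel_apply]
    exact ⟨g⁻¹, by simp⟩
  have hr' : ∀ x y, r x = r y → ∃ g, φ g * x = y := by
    intro x y hxy
    have : QuotientGroup.rightRel φ.range x y := Quotient.exact hxy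
    rw [QuotientGroup.rightRel_apply] at this
    obtain ⟨g, hg⟩ := this
    exact ⟨g, by rw [hg]; simp⟩
  let Fc : Quotient st → Finset Q := fun c => F.filter (fun x => r x = c)
  have hsum : ∀ s, bad (φ s) F = ∑ c ∈ F.image r, bad (φ s) (Fc c) := by
    intro s
    unfold bad
    rw [Finset.card_eq_sum_card_fiberwise (f := r) (t := F.image r)]
    · refine Finset.sum_congr rfl fun c _ => ?_
      congr 1
      ext x
      simp only [Fc, Finset.mem_filter, hr]
      tauto
    · intro x hx
      simp only [Finset.coe_filter, Set.mem_ofPred_eq] at hx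
      simpa using ⟨x, hx.1, rfl⟩
  have hcard : F.card = ∑ c ∈ F.image r, (Fc c).card :=
    Finset.card_eq_sum_card_fiberwise (fun x hx => by simpa using ⟨x, hx, rfl⟩)
  have key : ∑ c ∈ F.image r, (∑ s ∈ S, (bad (φ s) (Fc c) : ℝ)) ≤
      ∑ c ∈ F.image r, ε * ((Fc c).card : ℝ) := by
    rw [Finset.sum_comm, ← Finset.mul_sum]
    have : ∀ s ∈ S, ∑ c ∈ F.image r, (bad (φ s) (Fc c) : ℝ) ≤ ε / (S.card + 1) * F.card := by
      intro s hs
      have := hb (φ s) (Finset.mem_image_of_mem _ hs)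
      rw [hsum] at this
      exact_mod_cast this
    refine (Finset.sum_le_sum this).trans ?_
    rw [Finset.sum_const, nsmul_eq_mul]
    have e2 : (∑ c ∈ F.image r, ((Fc c).card : ℝ)) = F.card := by rw [hcard]; push_cast; rfl
    rw [e2, ← mul_assoc]
    gcongr
    rw [mul_div_assoc', div_le_iff₀ (by positivity)]
    nlinarith
  obtain ⟨c, hc, hle⟩ := Finset.exists_le_of_sum_le (hF.image r) key
  obtain ⟨x0, hx0, rfl⟩ := Finset.mem_image.1 hc
  have hinj : Function.Injective (fun g => φ g * x0) := fun a b hab => hφ (mul_right_cancel hab)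
  let E : Finset G := (Fc (r x0)).preimage (fun g => φ g * x0) hinj.injOn
  have hmem : ∀ g, g ∈ E ↔ φ g * x0 ∈ Fc (r x0) := fun g => by simp [E]
  have himg : E.image (fun g => φ g * x0) = Fc (r x0) := by
    ext y
    simp only [Finset.mem_image, hmem]
    constructor
    · rintro ⟨g, hg, rfl⟩; exact hg
    · intro hy
      obtain ⟨g, rfl⟩ := hr' x0 y (by simp [Fc] at hy; exact hy.2.symm)
      exact ⟨g, hy, rfl⟩
  have hEc : E.card = (Fc (r x0)).card := by
    rw [← himg, Finset.card_image_of_injective _ hinj]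
  have hbad : ∀ s, bad s E = bad (φ s) (Fc (r x0)) := by
    intro s
    unfold bad
    rw [← Finset.card_image_of_injective _ hinj]
    congr 1
    ext y
    simp only [Finset.mem_image, Finset.mem_filter, hmem]
    constructor
    · rintro ⟨g, ⟨h1, h2⟩, rfl⟩
      exact ⟨h1, by simpa [mul_assoc] using h2⟩
    · rintro ⟨h1, h2⟩
      obtain ⟨g, rfl⟩ := hr' x0 y (by simp [Fc] at h1; exact h1.2.symm)
      exact ⟨g, ⟨h1, by simpa [mul_assoc] using h2⟩, rfl⟩
  refine ⟨E, ⟨1, by simp [hmem, Fc, hx0]⟩, fun s hs => ?_⟩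
  rw [hbad, hEc]
  exact (Finset.single_le_sum (f := fun s => (bad (φ s) (Fc (r x0)) : ℝ))
    (fun _ _ => by positivity) hs).trans hle

theorem Fol.ext_surj {G Q : Type*} [Group G] [Group Q] (φ : G →* Q)
    (hφ : Function.Surjective φ) (h : Fol Q) (hk : Fol φ.ker) : Fol G := by
  classical
  intro S ε hε
  obtain ⟨E, hE, hEb⟩ := h (S.image φ) (ε / 2) (by positivity)
  let σ := Function.surjInv hφ
  have hσ : ∀ q, φ (σ q) = q := Function.surjInv_eq hφ
  let c : G → Q → φ.ker := fun s e => ⟨(σ (φ s * e))⁻¹ * (s * σ e), by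
    simp [MonoidHom.mem_ker, hσ]⟩
  obtain ⟨F, hF, hFb⟩ := hk ((S ×ˢ E).image (fun p => c p.1 p.2)) (ε / 2) (by positivity)
  let m : Q × φ.ker → G := fun p => σ p.1 * p.2
  have hm : Function.Injective m := by
    rintro ⟨e, f⟩ ⟨e', f'⟩ h
    simp only [m] at h
    have h1 : e = e' := by
      have := congrArg φ h
      have hf : φ f = 1 := f.2
      have hf' : φ f' = 1 := f'.2
      simpa [hσ, hf, hf'] using this
    subst h1
    simpa using h
  refine ⟨(E ×ˢ F).image m, (hE.product hF).image m, fun s hs => ?_⟩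
  have hsub : ((E ×ˢ F).image m).filter (fun x => s * x ∉ (E ×ˢ F).image m) ⊆
      (((E.filter (fun e => φ s * e ∉ E)) ×ˢ F) ∪
        (E.biUnion fun e => {e} ×ˢ (F.filter fun f => c s e * f ∉ F))).image m := by
    intro x hx
    rw [Finset.mem_filter, Finset.mem_image] at hx
    obtain ⟨⟨⟨e, f⟩, hef, rfl⟩, hx⟩ := hx
    rw [Finset.mem_product] at hef
    refine Finset.mem_image_of_mem _ ?_
    by_contra hcon
    simp only [Finset.mem_union, Finset.mem_product, Finset.mem_filter, Finset.mem_biUnion,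
      Finset.mem_singleton, not_or, not_and, not_exists] at hcon
    obtain ⟨h1, h2⟩ := hcon
    have h3 : φ s * e ∈ E := by
      by_contra h3; exact h1 ⟨hef.1, h3⟩ hef.2
    have h4 : c s e * f ∈ F := by
      by_contra h4; exact h2 e hef.1 rfl hef.2 h4
    apply hx
    refine Finset.mem_image.2 ⟨(φ s * e, c s e * f), Finset.mem_product.2 ⟨h3, h4⟩, ?_⟩
    simp [m, c, mul_assoc]
  have hb1 := hEb (φ s) (Finset.mem_image_of_mem _ hs)
  have hb2 : ∀ e ∈ E, (bad (c s e) F : ℝ) ≤ ε / 2 * F.card := fun e he =>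
    hFb _ (Finset.mem_image.2 ⟨(s, e), Finset.mem_product.2 ⟨hs, he⟩, rfl⟩)
  have hle : bad s ((E ×ˢ F).image m) ≤ bad (φ s) E * F.card + ∑ e ∈ E, bad (c s e) F := by
    refine (Finset.card_le_card hsub).trans (Finset.card_image_le.trans
      ((Finset.card_union_le _ _).trans ?_))
    refine add_le_add (by rw [Finset.card_product]; rfl) ?_
    refine Finset.card_biUnion_le.trans (Finset.sum_le_sum fun e _ => ?_)
    rw [Finset.card_product]
    rw [Finset.card_singleton, one_mul]
    exact le_of_eq (by unfold bad; congr)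
  have hle' : (bad s ((E ×ˢ F).image m) : ℝ) ≤
      bad (φ s) E * F.card + ∑ e ∈ E, (bad (c s e) F : ℝ) := by exact_mod_cast hle
  rw [Finset.card_image_of_injective _ hm, Finset.card_product]
  have h5 := Finset.sum_le_sum hb2
  rw [Finset.sum_const, nsmul_eq_mul] at h5
  have h6 : (bad (φ s) E : ℝ) * F.card ≤ ε / 2 * E.card * F.card := by gcongr
  push_cast
  nlinarith

theorem Fol.ext {G Q : Type*} [Group G] [Group Q] (φ : G →* Q)
    (h : Fol Q) (hk : Fol φ.ker) : Fol G := by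
  refine Fol.ext_surj φ.rangeRestrict φ.rangeRestrict_surjective
    (Fol.of_injective φ.range.subtype (Subgroup.subtype_injective _) h) ?_
  rw [MonoidHom.ker_rangeRestrict]
  exact hk

theorem Fol.of_local {G : Type*} [Group G]
    (h : ∀ S : Finset G, ∃ B : Subgroup G, (∀ s ∈ S, s ∈ B) ∧ Fol B) : Fol G := by
  classical
  intro S ε hε
  obtain ⟨B, hB, hf⟩ := h S
  obtain ⟨F, hF, hb⟩ := hf (S.preimage B.subtype (Subgroup.subtype_injective _).injOn) ε hε
  refine ⟨F.image B.subtype, hF.image _, fun s hs => ?_⟩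
  have := hb ⟨s, hB s hs⟩ (by simpa using hs)
  rw [Finset.card_image_of_injective _ (Subgroup.subtype_injective _)]
  refine le_trans ?_ this
  norm_cast
  unfold bad
  refine le_trans (Finset.card_le_card (t := (F.filter
    (fun x => (⟨s, hB s hs⟩ : B) * x ∉ F)).image B.subtype) ?_)
    (Finset.card_image_le.trans (le_of_eq (by congr)))
  intro x hx
  rw [Finset.mem_filter, Finset.mem_image] at hx
  obtain ⟨⟨y, hy, rfl⟩, hx⟩ := hx
  refine Finset.mem_image_of_mem _ (Finset.mem_filter.2 ⟨hy, fun h => hx ?_⟩)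
  exact Finset.mem_image.2 ⟨_, h, rfl⟩

theorem Fol.of_comm {G : Type*} [CommGroup G] : Fol G := by
  classical
  intro S ε hε
  let P : ℕ → Finset (S → ℕ) := fun k => Fintype.piFinset fun _ => Finset.range (k + 1)
  let m : (S → ℕ) → G := fun a => ∏ s : S, (s : G) ^ a s
  let F : ℕ → Finset G := fun k => (P k).image m
  have hmono : ∀ k, F k ⊆ F (k + 1) := by
    intro k
    refine Finset.image_subset_image fun a ha => ?_
    simp only [P, Fintype.mem_piFinset, Finset.mem_range] at ha ⊢
    intro s; have := ha s; omega
  have hstep : ∀ k, ∀ s ∈ S, ∀ x ∈ F k, s * x ∈ F (k + 1) := by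
    intro k s hs x hx
    obtain ⟨a, ha, rfl⟩ := Finset.mem_image.1 hx
    refine Finset.mem_image.2 ⟨a + Pi.single ⟨s, hs⟩ 1, ?_, ?_⟩
    · simp only [P, Fintype.mem_piFinset, Finset.mem_range] at ha ⊢
      intro t
      have := ha t
      by_cases h : t = ⟨s, hs⟩
      · subst h; simp; omega
      · simp [h]; omega
    · simp only [m, Pi.add_apply, pow_add, Finset.prod_mul_distrib]
      rw [mul_comm]
      congr 1
      rw [Finset.prod_eq_single ⟨s, hs⟩]
      · simp
      · intro b _ hb; simp [hb]
      · simp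
  have hcard : ∀ k, (F k).card ≤ (k + 1) ^ S.card := by
    intro k
    refine Finset.card_image_le.trans ?_
    simp [P, Fintype.card_piFinset]
  have hne : ∀ k, (F k).Nonempty := fun k => ⟨m 0, Finset.mem_image_of_mem _ (by simp [P])⟩
  by_contra hcon
  push Not at hcon
  have hgrow : ∀ k, (1 + ε) * (F k).card ≤ (F (k + 1)).card := by
    intro k
    obtain ⟨s, hs, hlt⟩ := hcon (F k) (hne k)
    have : bad s (F k) + (F k).card ≤ (F (k + 1)).card := by
      have h1 : bad s (F k) ≤ (F (k + 1) \ F k).card := by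
        unfold bad
        refine Finset.card_le_card_of_injOn (s * ·) ?_ (mul_right_injective s).injOn
        intro x hx
        simp only [Finset.coe_filter, Set.mem_ofPred_eq] at hx
        simpa using ⟨hstep k s hs x hx.1, hx.2⟩
      have := Finset.card_sdiff_add_card_eq_card (hmono k)
      omega
    have : (bad s (F k) : ℝ) + (F k).card ≤ (F (k + 1)).card := by exact_mod_cast this
    linarith
  have hexp : ∀ k, (1 + ε) ^ k ≤ ((F k).card : ℝ) := by
    intro k
    induction k with
    | zero => simpa using (hne 0).card_pos
    | succ k ih =>
      rw [pow_succ, mul_comm]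
      exact (mul_le_mul_of_nonneg_left ih (by positivity)).trans (hgrow k)
  have hlim := (tendsto_pow_const_div_const_pow_of_one_lt S.card
    (show (1 : ℝ) < 1 + ε by linarith)).comp (tendsto_atTop_mono (fun n => Nat.le_succ n) tendsto_id : Tendsto (fun n : ℕ => n + 1) atTop atTop)
  obtain ⟨k, hk⟩ := (hlim.eventually (gt_mem_nhds (show (0 : ℝ) < 1 / (1 + ε) by positivity))).exists
  simp only [Function.comp] at hk
  rw [div_lt_div_iff₀ (by positivity) (by positivity), pow_succ, one_mul] at hk
  have h1 := lt_of_mul_lt_mul_right hk (by positivity)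
  have h2 := hexp k
  have h3 : ((F k).card : ℝ) ≤ ((k + 1 : ℕ) : ℝ) ^ S.card := by exact_mod_cast hcard k
  linarith

theorem Fol.of_comm' {G : Type*} [Group G] (h : ∀ a b : G, a * b = b * a) : Fol G :=
  letI : CommGroup G := CommGroup.mk h
  Fol.of_comm

theorem Fol.of_mem {G W : Type*} [Group G] [Group W] (B : Subgroup W) (hB : Fol B)
    (ι : G →* W) (hι : Function.Injective ι) (h : ∀ g, ι g ∈ B) : Fol G :=
  Fol.of_injective (ι.codRestrict B h)
    (fun a b hab => hι (by simpa using congrArg Subtype.val hab)) hB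

/-- functions supported in `J` -/
def suppIn {I : Type*} (H : Type*) [Group H] (J : Set I) : Subgroup (I → H) where
  carrier := {f | ∀ x, x ∉ J → f x = 1}
  mul_mem' := by
    intro a b ha hb x hx
    simp [ha x hx, hb x hx]
  one_mem' := by intro x _; rfl
  inv_mem' := by
    intro a ha x hx
    simp [ha x hx]

theorem mem_suppIn {I H : Type*} [Group H] {J : Set I} {f : I → H} :
    f ∈ suppIn H J ↔ ∀ x, x ∉ J → f x = 1 := Iff.rfl

/-- finitely supported functions -/
def finSupp (I H : Type*) [Group H] : Subgroup (I → H) where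
  carrier := {f | ∀ᶠ x in cofinite, f x = 1}
  mul_mem' := by
    intro a b ha hb
    change ∀ᶠ x in cofinite, (a * b) x = 1
    filter_upwards [ha, hb] with x h1 h2
    simp [h1, h2]
  one_mem' := by
    change ∀ᶠ x in cofinite, (1 : I → H) x = 1
    exact Eventually.of_forall fun _ => rfl
  inv_mem' := by
    intro a ha
    change ∀ᶠ x in cofinite, (a⁻¹) x = 1
    filter_upwards [ha] with x h1
    simp [h1]

theorem mem_finSupp {I H : Type*} [Group H] {f : I → H} :
    f ∈ finSupp I H ↔ ∀ᶠ x in cofinite, f x = 1 := Iff.rfl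

instance finSupp_normal (I H : Type*) [Group H] : (finSupp I H).Normal := ⟨by
  intro n hn g
  change ∀ᶠ x in cofinite, (g * n * g⁻¹) x = 1
  filter_upwards [hn] with x h1
  simp [h1]⟩

theorem fol_suppIn {I H : Type*} [Group H] (hH : Fol H) (J : Finset I) :
    Fol (suppIn H (J : Set I)) := by
  classical
  induction J using Finset.induction_on with
  | empty =>
    apply Fol.of_comm'
    intro a b
    have : ∀ a : suppIn H ((∅ : Finset I) : Set I), a = 1 := by
      intro a
      ext x
      exact a.2 x (by simp)
    rw [this a, this b]
  | insert j J _ ih =>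
    refine Fol.ext ((Pi.evalMonoidHom (fun _ : I => H) j).comp
      (suppIn H ((insert j J : Finset I) : Set I)).subtype) hH ?_
    refine Fol.of_mem _ ih ((Subgroup.subtype _).comp (Subgroup.subtype _)) 
      ((Subgroup.subtype_injective _).comp (Subgroup.subtype_injective _)) ?_
    rintro ⟨⟨f, hf⟩, hk⟩ x hx
    change f x = 1
    by_cases h : x = j
    · subst h; exact hk
    · exact hf x (by simpa [h] using hx)

theorem fol_finSupp {I H : Type*} [Group H] (hH : Fol H) : Fol (finSupp I H) := by
  classical
  refine Fol.of_local fun S => ?_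
  have hfin : ∀ s : finSupp I H, {x | ¬ (s : I → H) x = 1}.Finite := fun s => s.2
  let J : Finset I := S.biUnion fun s => (hfin s).toFinset
  refine ⟨(suppIn H (J : Set I)).comap (finSupp I H).subtype, ?_, ?_⟩
  · intro s hs x hx
    by_contra hne
    exact hx (by simpa [J] using ⟨s.1, ⟨s.2, hs⟩, hne⟩)
  · exact Fol.of_mem _ (fol_suppIn hH J) ((Subgroup.subtype _).comp (Subgroup.subtype _))
      ((Subgroup.subtype_injective _).comp (Subgroup.subtype_injective _)) (fun g => g.2)

abbrev ZZ := Multiplicative ℤ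

/-- shift of functions -/
def shiftHom (K : Type*) [Group K] (z : ZZ) : (ZZ → K) →* (ZZ → K) where
  toFun f := fun x => f (z⁻¹ * x)
  map_one' := rfl
  map_mul' _ _ := rfl

theorem eventually_shift {P : ZZ → Prop} (z : ZZ) (h : ∀ᶠ x in cofinite, P x) :
    ∀ᶠ x in cofinite, P (z * x) :=
  (mul_right_injective z).tendsto_cofinite.eventually h

/-- The step function. -/
noncomputable def stepF {H : Type*} [Group H] (h : H) : ZZ → H :=
  fun x => if 0 ≤ x.toAdd then h else 1

theorem stepF_shift {H : Type*} [Group H] (h : H) (z : ZZ) :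
    ∀ᶠ x in cofinite, stepF h (z * x) = stepF h x := by
  have : {x : ZZ | ¬ stepF h (z * x) = stepF h x} ⊆
      Multiplicative.toAdd ⁻¹' (Set.Icc (-|z.toAdd|) |z.toAdd|) := by
    intro x hx
    by_contra hcon
    apply hx
    simp only [Set.mem_preimage, Set.mem_Icc, not_and_or, not_le] at hcon
    unfold stepF
    rw [toAdd_mul]
    have h1 := neg_abs_le z.toAdd
    have h2 := le_abs_self z.toAdd
    rcases hcon with hc | hc
    · rw [if_neg (by omega), if_neg (by omega)]
    · rw [if_pos (by omega), if_pos (by omega)]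
  exact ((Set.finite_Icc _ _).preimage Multiplicative.toAdd.injective.injOn).subset this

/-- The auxiliary group `K`. -/
def auxK (H : Type*) [Group H] : Subgroup ((RegularWreathProduct H ZZ) × H) where
  carrier := {w | ∀ᶠ x in cofinite, w.1.left x = stepF w.2 x}
  mul_mem' := by
    intro a b ha hb
    filter_upwards [ha, eventually_shift a.1.right⁻¹ hb, stepF_shift b.2 a.1.right⁻¹]
      with x h1 h2 h3
    simp only [Prod.fst_mul, Prod.snd_mul, RegularWreathProduct.mul_left, Pi.mul_apply]
    rw [h1, h2, h3]
    unfold stepF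
    split_ifs <;> simp
  one_mem' := by
    change ∀ᶠ x in cofinite, (1 : RegularWreathProduct H ZZ × H).1.left x = stepF (1 : H) x
    exact Eventually.of_forall fun x => by simp [stepF]
  inv_mem' := by
    intro a ha
    filter_upwards [eventually_shift a.1.right ha, stepF_shift a.2 a.1.right] with x h1 h2
    simp only [Prod.fst_inv, Prod.snd_inv, RegularWreathProduct.inv_left, Pi.inv_apply]
    rw [h1, h2]
    unfold stepF
    split_ifs <;> simp

theorem fol_auxK {H : Type*} [Group H] (hH : Fol H) : Fol (auxK H) := by
  refine Fol.ext ((RegularWreathProduct.rightHom.comp (MonoidHom.fst _ _)).comp (auxK H).subtype)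
    Fol.of_comm ?_
  refine Fol.ext (((MonoidHom.snd _ _).comp (auxK H).subtype).comp (Subgroup.subtype _)) hH ?_
  let ι : (((MonoidHom.snd (RegularWreathProduct H ZZ) H).comp (auxK H).subtype).comp
      (Subgroup.subtype ((RegularWreathProduct.rightHom.comp (MonoidHom.fst _ _)).comp
        (auxK H).subtype).ker)).ker →* (ZZ → H) :=
    { toFun := fun w => w.1.1.1.1.left
      map_one' := rfl
      map_mul' := by
        rintro ⟨⟨⟨⟨a, a'⟩, ha⟩, ha1⟩, ha2⟩ ⟨⟨⟨⟨b, b'⟩, hb⟩, hb1⟩, hb2⟩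
        have ha3 : a.right = 1 := ha1
        ext x
        simp [ha3] }
  refine Fol.of_mem _ (fol_finSupp hH) ι ?_ ?_
  · rintro ⟨⟨⟨⟨⟨a, a1⟩, a'⟩, ha⟩, ha1⟩, ha2⟩ ⟨⟨⟨⟨⟨b, b1⟩, b'⟩, hb⟩, hb1⟩, hb2⟩ hab
    have e1 : a1 = 1 := ha1
    have e2 : b1 = 1 := hb1
    have e3 : a' = 1 := ha2
    have e4 : b' = 1 := hb2
    have e5 : a = b := hab
    subst e1 e2 e3 e4 e5
    rfl
  · rintro ⟨⟨⟨⟨⟨a, a1⟩, a'⟩, ha⟩, ha1⟩, ha2⟩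
    have e3 : a' = 1 := ha2
    subst e3
    change ∀ᶠ x in cofinite, a x = 1
    filter_upwards [ha] with x hx
    simpa [stepF] using hx

/-- point mass in the wreath product -/
noncomputable def delta (K : Type*) [Group K] : K →* RegularWreathProduct K ZZ where
  toFun k := ⟨Pi.mulSingle 1 k, 1⟩
  map_one' := by ext <;> simp
  map_mul' a b := by
    ext x
    · by_cases h : x = 1
      · subst h; simp
      · simp [h]
    · simp

theorem delta_injective (K : Type*) [Group K] : Function.Injective (delta K) := by
  intro a b h
  have := congrFun (congrArg RegularWreathProduct.left h) 1
  simpa [delta] using this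

theorem exists_auxK (H : Type u) [Group H] (hH : Fol H) :
    ∃ (K : Type u) (_ : Group K) (_ : Fol K) (p : K) (a : H → K) (ι : H →* K),
      Function.Injective ι ∧ ∀ h, ι h = a h * p * (a h)⁻¹ * p⁻¹ := by
  let t : ZZ := Multiplicative.ofAdd 1
  let ι0 : H →* (RegularWreathProduct H ZZ) × H := (MonoidHom.inl _ _).comp (delta H)
  have hι0 : ∀ h, ι0 h ∈ auxK H := by
    intro h
    change ∀ᶠ x in cofinite, Pi.mulSingle (M := fun _ : ZZ => H) 1 h x = stepF (1 : H) x
    have : ∀ᶠ x : ZZ in cofinite, x ≠ 1 := by simp [Filter.eventually_cofinite]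
    filter_upwards [this] with x hx
    simp [hx, stepF]
  refine ⟨auxK H, inferInstance, fol_auxK hH, ⟨(⟨1, t⟩, 1), ?_⟩,
    fun h => ⟨(⟨stepF h, 1⟩, h), ?_⟩, ι0.codRestrict _ hι0, ?_, ?_⟩
  · change ∀ᶠ x in cofinite, (1 : ZZ → H) x = stepF (1 : H) x
    exact Eventually.of_forall fun x => by simp [stepF]
  · change ∀ᶠ x in cofinite, stepF h x = stepF h x
    exact Eventually.of_forall fun x => rfl
  · intro a b hab
    have h1 : ι0 a = ι0 b := congrArg Subtype.val hab
    exact delta_injective H (congrArg Prod.fst h1)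
  · intro h
    refine Subtype.ext (Prod.ext (RegularWreathProduct.ext ?_ ?_) ?_)
    · ext x
      change Pi.mulSingle (M := fun _ : ZZ => H) 1 h x = _
      simp only [Subgroup.coe_mul, Subgroup.coe_inv, Prod.fst_mul, Prod.fst_inv,
        RegularWreathProduct.mul_left, RegularWreathProduct.inv_left, Pi.mul_apply, Pi.inv_apply,
        RegularWreathProduct.mul_right, RegularWreathProduct.inv_right]
      have e : x = 1 ↔ x.toAdd = 0 := by rw [← toAdd_one]; exact Multiplicative.toAdd.injective.eq_iff.symm
      by_cases hx : x = 1
      · subst hx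
        simp [stepF, t]
      · have h0 : x.toAdd ≠ 0 := fun h => hx (e.2 h)
        rw [Pi.mulSingle_eq_of_ne hx]
        simp only [stepF, t, one_mul, Pi.one_apply, inv_one, mul_one, toAdd_mul, toAdd_inv, toAdd_ofAdd]
        by_cases h1 : 0 ≤ x.toAdd
        · rw [if_pos h1, if_pos (by omega)]; simp
        · rw [if_neg h1, if_neg (by omega)]; simp
    · change (1 : ZZ) = _
      simp
    · change (1 : H) = _
      simp

/-- lacunary function -/
noncomputable def lac {K : Type*} [Group K] (k : ℕ → K) : ZZ → K := fun x =>
  if x.toAdd = 2 ^ (Nat.log 2 x.toAdd.toNat) then k (Nat.log 2 x.toAdd.toNat) else 1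

theorem lac_pow {K : Type*} [Group K] (k : ℕ → K) (n : ℕ) :
    lac k (Multiplicative.ofAdd ((2 : ℤ) ^ n)) = k n := by
  have : ((2 : ℤ) ^ n).toNat = 2 ^ n := by
    have : (2 : ℤ) ^ n = ((2 ^ n : ℕ) : ℤ) := by push_cast; rfl
    rw [this, Int.toNat_natCast]
  simp [lac, this]

theorem lac_ne {K : Type*} [Group K] {k : ℕ → K} {x : ZZ} (h : lac k x ≠ 1) :
    ∃ n : ℕ, x.toAdd = 2 ^ n := by
  unfold lac at h
  split_ifs at h with h1
  · exact ⟨_, h1⟩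
  · exact absurd rfl h

theorem pow_gap (a b : ℕ) (h : a < b) : (2 : ℤ) ^ a * 2 ≤ 2 ^ b := by
  rw [← pow_succ]
  exact pow_le_pow_right₀ (by norm_num) h

theorem lac_lacunary {K : Type*} [Group K] (k : ℕ → K) (z : ZZ) (hz : z ≠ 1) :
    ∀ᶠ x in cofinite, lac k x = 1 ∨ lac k (z * x) = 1 := by
  have : {x : ZZ | ¬ (lac k x = 1 ∨ lac k (z * x) = 1)} ⊆
      Multiplicative.toAdd ⁻¹' (Set.Icc 0 (2 * |z.toAdd|)) := by
    intro x hx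
    have hx : ¬ (lac k x = 1 ∨ lac k (z * x) = 1) := hx
    rw [not_or] at hx
    obtain ⟨a, ha⟩ := lac_ne hx.1
    obtain ⟨b, hb⟩ := lac_ne hx.2
    rw [toAdd_mul] at hb
    have hz' : z.toAdd ≠ 0 := fun h => hz (Multiplicative.toAdd.injective h)
    have h1 := neg_abs_le z.toAdd
    have h2 := le_abs_self z.toAdd
    have h3 : (0 : ℤ) < 2 ^ a := by positivity
    have h4 : (0 : ℤ) < 2 ^ b := by positivity
    simp only [Set.mem_preimage, Set.mem_Icc]
    rcases lt_trichotomy a b with h | h | h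
    · have := pow_gap a b h
      constructor <;> omega
    · subst h; omega
    · have := pow_gap b a h
      constructor <;> omega
  exact ((Set.finite_Icc _ _).preimage Multiplicative.toAdd.injective.injOn).subset this

/-- base group -/
def baseD {K : Type*} [Group K] (f : ZZ → K) : Subgroup (ZZ → K) :=
  Subgroup.closure (Set.range (fun z => shiftHom K z f) ∪ (finSupp ZZ K : Set (ZZ → K)))

theorem baseD_shift {K : Type*} [Group K] (f : ZZ → K) (z : ZZ) {g : ZZ → K}
    (hg : g ∈ baseD f) : (fun x => g (z * x)) ∈ baseD f := by
  have : baseD f ≤ (baseD f).comap (shiftHom K z⁻¹) := by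
    conv_lhs => unfold baseD
    rw [Subgroup.closure_le]
    rintro g (⟨y, rfl⟩ | hg)
    · refine Subgroup.subset_closure (Or.inl ⟨z⁻¹ * y, ?_⟩)
      ext x
      simp [shiftHom, mul_assoc, mul_comm, mul_left_comm]
    · refine Subgroup.subset_closure (Or.inr ?_)
      exact eventually_shift (z⁻¹)⁻¹ hg
  have h := this hg
  have e : shiftHom K z⁻¹ g = fun x => g (z * x) := by
    ext x; simp [shiftHom]
  rw [← e]; exact h

theorem fol_baseD {K : Type*} [Group K] (hK : Fol K) (k : ℕ → K) : Fol (baseD (lac k)) := by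
  let mk := QuotientGroup.mk' (finSupp ZZ K)
  let C : Subgroup ((ZZ → K) ⧸ finSupp ZZ K) :=
    Subgroup.closure (Set.range fun z => mk (shiftHom K z (lac k)))
  have hcomm : ∀ a ∈ Set.range (fun z => mk (shiftHom K z (lac k))),
      ∀ b ∈ Set.range (fun z => mk (shiftHom K z (lac k))), a * b = b * a := by
    rintro _ ⟨z, rfl⟩ _ ⟨y, rfl⟩
    by_cases hzy : z = y
    · rw [hzy]
    simp only [← map_mul]
    refine QuotientGroup.eq.2 ?_
    have hne : y⁻¹ * z ≠ 1 := fun h => hzy (inv_mul_eq_one.1 h).symm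
    change ∀ᶠ x in cofinite, ((shiftHom K z (lac k) * shiftHom K y (lac k))⁻¹ *
      (shiftHom K y (lac k) * shiftHom K z (lac k))) x = 1
    filter_upwards [eventually_shift z⁻¹ (lac_lacunary k _ hne)] with x hx
    have e : y⁻¹ * z * (z⁻¹ * x) = y⁻¹ * x := by group
    rw [e] at hx
    simp only [Pi.mul_apply, Pi.inv_apply, shiftHom, MonoidHom.coe_mk, OneHom.coe_mk]
    rcases hx with hx | hx <;> simp [hx]
  have hC : Fol C := by
    have := Subgroup.isMulCommutative_closure hcomm
    exact Fol.of_comm' fun a b => mul_comm' a b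
  have hle : ∀ g : baseD (lac k), mk g ∈ C := by
    have : baseD (lac k) ≤ C.comap mk := by
      unfold baseD
      rw [Subgroup.closure_le]
      rintro g (⟨y, rfl⟩ | hg)
      · exact Subgroup.subset_closure ⟨y, rfl⟩
      · have : mk g = 1 := (QuotientGroup.eq_one_iff g).2 hg
        change mk g ∈ C
        rw [this]; exact C.one_mem
    exact fun g => this g.2
  refine Fol.ext ((mk.comp (Subgroup.subtype _)).codRestrict C hle) hC ?_
  refine Fol.of_mem _ (fol_finSupp (I := ZZ) hK) ((Subgroup.subtype _).comp (Subgroup.subtype _))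
    ((Subgroup.subtype_injective _).comp (Subgroup.subtype_injective _)) ?_
  rintro ⟨⟨g, hg⟩, hk⟩
  have h1 : mk g = 1 := congrArg Subtype.val hk
  exact (QuotientGroup.eq_one_iff g).1 h1

/-- amenable overgroup -/
def overU {K : Type*} [Group K] (f : ZZ → K) : Subgroup (RegularWreathProduct K ZZ) where
  carrier := {w | w.left ∈ baseD f}
  mul_mem' := by
    intro a b ha hb
    exact (baseD f).mul_mem ha (baseD_shift f a.right⁻¹ hb)
  one_mem' := (baseD f).one_mem
  inv_mem' := by
    intro a ha
    exact baseD_shift f a.right ((baseD f).inv_mem ha)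

theorem fol_overU {K : Type*} [Group K] (hK : Fol K) (k : ℕ → K) : Fol (overU (lac k)) := by
  refine Fol.ext (RegularWreathProduct.rightHom.comp (overU (lac k)).subtype) Fol.of_comm ?_
  let ι : (RegularWreathProduct.rightHom.comp (overU (lac k)).subtype).ker →* (ZZ → K) :=
    { toFun := fun w => w.1.1.left
      map_one' := rfl
      map_mul' := by
        rintro ⟨⟨a, ha⟩, ha1⟩ ⟨⟨b, hb⟩, hb1⟩
        have ha3 : a.right = 1 := ha1
        ext x
        simp [ha3] }
  refine Fol.of_mem _ (fol_baseD hK k) ι ?_ ?_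
  · rintro ⟨⟨⟨a, a1⟩, ha⟩, ha1⟩ ⟨⟨⟨b, b1⟩, hb⟩, hb1⟩ hab
    have e1 : a1 = 1 := ha1
    have e2 : b1 = 1 := hb1
    have e5 : a = b := hab
    subst e1 e2 e5
    rfl
  · rintro ⟨⟨a, ha⟩, ha1⟩
    exact ha

theorem closure_fin_countable {W : Type*} [Group W] (s : Set W) (hs : s.Finite) :
    Countable (Subgroup.closure s) := by
  have := hs.countable.to_subtype
  have hq : Countable (FreeGroup s) :=
    Function.Surjective.countable (f := (FreeGroup.mk : List (s × Bool) → FreeGroup s))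
      Quot.mk_surjective
  have e : (FreeGroup.lift (Subtype.val : s → W)).range = Subgroup.closure s := by
    rw [FreeGroup.range_lift_eq_closure, Subtype.range_coe]
  rw [← e]
  exact (FreeGroup.lift (Subtype.val : s → W)).rangeRestrict_surjective.countable

/-- Every countable amenable group embeds into a finitely generated amenable group. -/
theorem countable_amenable_embeds_in_fg_amenable (H : Type u) [Group H]
    (hc : Countable H) (ham : HasFolnerSequence H) :
    ∃ (G : Type u) (instG : Group G), Group.FG G ∧ HasFolnerSequence G ∧
      ∃ φ : H →* G, Function.Injective φ := by

  classical
  obtain ⟨K, _, hK, p, a, ι, hι, hcomm⟩ := exists_auxK H (Fol.of_folner ham)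
  obtain ⟨e, he⟩ := exists_surjective_nat H
  let k : ℕ → K := fun n => a (e n)
  let t : RegularWreathProduct K ZZ := ⟨1, Multiplicative.ofAdd 1⟩
  let f : RegularWreathProduct K ZZ := ⟨lac k, 1⟩
  let s : Set (RegularWreathProduct K ZZ) := {t, f, delta K p}
  have hs : s.Finite := by simp [s]
  let G := Subgroup.closure s
  have hc : Countable G := closure_fin_countable s hs
  have hGU : G ≤ overU (lac k) := by
    refine (Subgroup.closure_le _).2 ?_
    rintro x (rfl | rfl | rfl)
    · exact (baseD _).one_mem
    · refine Subgroup.subset_closure (Or.inl ⟨1, ?_⟩)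
      ext x
      simp [shiftHom, f]
    · refine Subgroup.subset_closure (Or.inr ?_)
      change ∀ᶠ x in cofinite, Pi.mulSingle (M := fun _ : ZZ => K) 1 p x = 1
      have : ∀ᶠ x : ZZ in cofinite, x ≠ 1 := by simp [Filter.eventually_cofinite]
      filter_upwards [this] with x hx
      simp [hx]
  have hG : Fol G := Fol.of_injective (Subgroup.inclusion hGU)
    (Subgroup.inclusion_injective hGU) (fol_overU hK k)
  have ht : t ∈ G := Subgroup.subset_closure (by simp [s])
  have hf : f ∈ G := Subgroup.subset_closure (by simp [s])
  have hp : delta K p ∈ G := Subgroup.subset_closure (by simp [s])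
  have htz : ∀ z : ℤ, (⟨1, Multiplicative.ofAdd z⟩ : RegularWreathProduct K ZZ) ∈ G := by
    intro z
    have h1 : t ^ z ∈ G := G.zpow_mem ht z
    have h2 : t ^ z = RegularWreathProduct.inl ((Multiplicative.ofAdd (1 : ℤ)) ^ z) := by
      rw [map_zpow]; rfl
    rw [h2, ← ofAdd_zsmul] at h1
    rw [smul_eq_mul, mul_one] at h1
    exact h1
  have hmem : ∀ h, (delta K).comp ι h ∈ G := by
    intro h
    obtain ⟨n, rfl⟩ := he h
    let c : RegularWreathProduct K ZZ := ⟨1, Multiplicative.ofAdd (-(2 : ℤ) ^ n)⟩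
    have hcG : c ∈ G := htz _
    let g := c * f * c⁻¹
    have hg : g ∈ G := G.mul_mem (G.mul_mem hcG hf) (G.inv_mem hcG)
    have hg1 : g.right = 1 := by simp [g, f]
    have hg2 : g.left 1 = a (e n) := by
      have := lac_pow k n
      simp [g, f, c, this, k]
    have key : delta K (ι (e n)) = g * delta K p * g⁻¹ * (delta K p)⁻¹ := by
      rw [hcomm]
      ext x
      · by_cases hx : x = 1
        · subst hx
          simp [delta, hg1, hg2]
        · simp [delta, hg1, hx]
      · simp [delta, hg1]
    rw [MonoidHom.comp_apply, key]
    exact G.mul_mem (G.mul_mem (G.mul_mem hg hp) (G.inv_mem hg)) (G.inv_mem hp)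
  refine ⟨G, inferInstance, ?_, hG.folner, ((delta K).comp ι).codRestrict G hmem, ?_⟩
  · exact (Group.fg_iff_subgroup_fg G).2 ((Subgroup.fg_iff G).2 ⟨s, rfl, hs⟩)
  · intro x y hxy
    exact hι (delta_injective K (congrArg Subtype.val hxy))
end
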